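/- arXiv:2502.08046 — 4 statements merged into one kernel-verified Lean document; each statement's English description precedes it below -/
import Mathlib

section
/- For every constant c > 0 the following holds: let n = rm → ∞ with integers r = r(n) ≥ 3, m = m(n) ≥ 1, and let d = d(n) be integers with 0 ≤ d ≤ m^{r−1} and min{d, m^{r−1} − d} ≥ c·r^{16}·m for all sufficiently large n. Then H_r(d,m) = (1+o(1))·Ĥ_r(d,m). -/
open Filter

/-- `Hcount r m d` is the number of `d`-regular `(r,r)`-graphs with classes of size `m`. -/
noncomputable def Hcount (r m d : ℕ) : ℕ :=
  Nat.card {E : Finset (Fin r → Fin m) //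
    ∀ t : Fin r, ∀ v : Fin m, (E.filter (fun e => e t = v)).card = d}

/-- The heuristic estimate `Ĥ_r(d,m) = C(m^(r-1), d)^(r*m) / C(m^r, m*d)^(r-1)`. -/
noncomputable def Hhat (r m d : ℕ) : ℝ :=
  (((m ^ (r - 1)).choose d : ℝ)) ^ (r * m) / (((m ^ r).choose (m * d) : ℝ)) ^ (r - 1)


namespace RegularCount

section

variable {r m : ℕ}

/-- The degree of the vertex `v` of class `s`. -/
def vdeg (E : Finset (Fin r → Fin m)) (s : Fin r) (v : Fin m) : ℕ :=
  (E.filter (fun e => e s = v)).card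

/-- The edge sets whose degrees in every class of `S` are prescribed by `y`. -/
def fam (S : Finset (Fin r)) (y : Fin r → Fin m → ℕ) : Finset (Finset (Fin r → Fin m)) :=
  Finset.univ.filter (fun E => ∀ s ∈ S, ∀ v, vdeg E s v = y s v)

/-- The edges through the vertex `a` of class `s` whose translate to the vertex `w` is absent. -/
def solo (E : Finset (Fin r → Fin m)) (s : Fin r) (a w : Fin m) : Finset (Fin r → Fin m) :=
  E.filter (fun e => e s = a ∧ Function.update e s w ∉ E)

/-- Replace the edge `e` by the edge `f`. -/
def mv (E : Finset (Fin r → Fin m)) (e f : Fin r → Fin m) : Finset (Fin r → Fin m) :=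
  insert f (E.erase e)

lemma mem_fam {S : Finset (Fin r)} {y : Fin r → Fin m → ℕ} {E : Finset (Fin r → Fin m)} :
    E ∈ fam S y ↔ ∀ s ∈ S, ∀ v, vdeg E s v = y s v := by
  simp [fam]

lemma mem_solo {E : Finset (Fin r → Fin m)} {s : Fin r} {a w : Fin m} {e : Fin r → Fin m} :
    e ∈ solo E s a w ↔ e ∈ E ∧ e s = a ∧ Function.update e s w ∉ E := by
  simp [solo]

lemma mem_mv {E : Finset (Fin r → Fin m)} {e f g : Fin r → Fin m} :
    g ∈ mv E e f ↔ g = f ∨ (g ≠ e ∧ g ∈ E) := by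
  simp [mv]

lemma mv_mv_cancel {E : Finset (Fin r → Fin m)} {e f : Fin r → Fin m} (he : e ∈ E)
    (hf : f ∉ E) : mv (mv E e f) f e = E := by
  ext g
  simp only [mem_mv]
  by_cases h1 : g = e <;> by_cases h2 : g = f <;> simp_all

lemma vdeg_mv {E : Finset (Fin r → Fin m)} {e f : Fin r → Fin m} (he : e ∈ E) (hf : f ∉ E)
    (s : Fin r) (v : Fin m) :
    vdeg (mv E e f) s v + (if e s = v then 1 else 0) = vdeg E s v + (if f s = v then 1 else 0) := by
  unfold vdeg mv
  rw [Finset.filter_insert, Finset.filter_erase]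
  have hf' : f ∉ (E.filter (fun g => g s = v)).erase e := by
    simp [hf]
  by_cases h1 : e s = v
  · have he' : e ∈ E.filter (fun g => g s = v) := by simp [he, h1]
    have h3 := Finset.card_erase_add_one he'
    by_cases h2 : f s = v
    · rw [if_pos h2, if_pos h1, if_pos h2, Finset.card_insert_of_notMem hf', h3]
    · rw [if_neg h2, if_pos h1, if_neg h2, h3]; rfl
  · have he' : e ∉ E.filter (fun g => g s = v) := by simp [h1]
    rw [Finset.erase_eq_of_notMem he'] at hf' ⊢
    by_cases h2 : f s = v
    · rw [if_pos h2, if_neg h1, if_pos h2, Finset.card_insert_of_notMem hf']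
    · rw [if_neg h2, if_neg h1, if_neg h2]

lemma vdeg_mv_of_eq {E : Finset (Fin r → Fin m)} {e f : Fin r → Fin m} (he : e ∈ E) (hf : f ∉ E)
    {s : Fin r} (h : e s = f s) (v : Fin m) : vdeg (mv E e f) s v = vdeg E s v := by
  have := vdeg_mv he hf s v
  rw [h] at this
  omega

/-- Exchange the positions of `e` (moved to the vertex `a` of class `s`) and `h` (moved to `w`). -/
def sw (E : Finset (Fin r → Fin m)) (s : Fin r) (a w : Fin m) (e h : Fin r → Fin m) :
    Finset (Fin r → Fin m) :=
  mv (mv E e (Function.update e s a)) h (Function.update h s w)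

lemma update_update_self {s : Fin r} {w : Fin m} (a : Fin m) {e : Fin r → Fin m} (h : e s = w) :
    Function.update (Function.update e s a) s w = e := by
  rw [Function.update_idem, ← h, Function.update_eq_self]

lemma update_injOn {s : Fin r} {w : Fin m} (a : Fin m) {e f : Fin r → Fin m} (he : e s = w)
    (hf : f s = w) (h : Function.update e s a = Function.update f s a) : e = f := by
  rw [← update_update_self a he, ← update_update_self a hf, h]

lemma mem_sw {E : Finset (Fin r → Fin m)} {s : Fin r} {a w : Fin m} {e h g : Fin r → Fin m} :
    g ∈ sw E s a w e h ↔ g = Function.update h s w ∨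
      (g ≠ h ∧ (g = Function.update e s a ∨ (g ≠ e ∧ g ∈ E))) := by
  simp [sw, mem_mv]

section Swap

variable {E : Finset (Fin r → Fin m)} {s : Fin r} {a w : Fin m} {e h : Fin r → Fin m}

lemma solo_ne (haw : a ≠ w) (he : e ∈ solo E s w a) (hh : h ∈ solo E s a w) :
    e ≠ h ∧ Function.update e s a ≠ h ∧ e ≠ Function.update h s w ∧
      Function.update e s a ≠ Function.update h s w ∧ e ≠ Function.update e s a ∧
      h ≠ Function.update h s w := by
  obtain ⟨h1, h2, h3⟩ := mem_solo.1 he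
  obtain ⟨h4, h5, h6⟩ := mem_solo.1 hh
  refine ⟨?_, ?_, ?_, ?_, ?_, ?_⟩
  · rintro rfl; exact haw (h5.symm.trans h2)
  · rintro rfl; exact h3 h4
  · rintro rfl; exact h6 h1
  · intro hc
    have := congrFun hc s
    simp at this; exact haw this
  · intro hc; exact h3 (hc ▸ h1)
  · intro hc; exact h6 (hc ▸ h4)

lemma sw_mem_fam {S : Finset (Fin r)} {y : Fin r → Fin m → ℕ} (haw : a ≠ w)
    (he : e ∈ solo E s w a) (hh : h ∈ solo E s a w) (hE : E ∈ fam S y) :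
    sw E s a w e h ∈ fam S y := by
  obtain ⟨n1, n2, n3, n4, n5, n6⟩ := solo_ne haw he hh
  obtain ⟨h1, h2, h3⟩ := mem_solo.1 he
  obtain ⟨h4, h5, h6⟩ := mem_solo.1 hh
  rw [mem_fam] at hE ⊢
  intro i hi v
  rw [← hE i hi v]
  have k1 : h ∈ mv E e (Function.update e s a) := mem_mv.2 (Or.inr ⟨n1.symm, h4⟩)
  have k2 : Function.update h s w ∉ mv E e (Function.update e s a) := by
    rw [mem_mv]; push Not; exact ⟨n4.symm, fun _ => h6⟩
  by_cases his : i = s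
  · subst his
    have e1 := vdeg_mv h1 h3 i v
    have e2 := vdeg_mv k1 k2 i v
    simp only [Function.update_self, h2, h5] at e1 e2
    unfold sw
    omega
  · unfold sw
    rw [vdeg_mv_of_eq k1 k2 (by rw [Function.update_of_ne his]),
      vdeg_mv_of_eq h1 h3 (by rw [Function.update_of_ne his])]

lemma solo_mv (haw : a ≠ w) (he : e ∈ solo E s w a) :
    solo (mv E e (Function.update e s a)) s w a = (solo E s w a).erase e := by
  obtain ⟨h1, h2, h3⟩ := mem_solo.1 he
  ext g
  rw [Finset.mem_erase, mem_solo, mem_solo, mem_mv, mem_mv]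
  constructor
  · rintro ⟨hg, hgs, hgu⟩
    push Not at hgu
    have hga : g ≠ Function.update e s a := by
      rintro rfl; simp at hgs; exact haw hgs
    obtain ⟨hge, hgE⟩ := hg.resolve_left hga
    refine ⟨hge, hgE, hgs, ?_⟩
    apply hgu.2
    intro hc
    have := congrFun hc s
    rw [Function.update_self, h2] at this
    exact haw this
  · rintro ⟨hge, hgE, hgs, hgu⟩
    refine ⟨Or.inr ⟨hge, hgE⟩, hgs, ?_⟩
    push Not
    exact ⟨fun hc => hge (update_injOn a hgs h2 hc), fun _ => hgu⟩

lemma solo_mv' (haw : a ≠ w) (he : e ∈ solo E s w a) :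
    solo (mv E e (Function.update e s a)) s a w = insert (Function.update e s a) (solo E s a w) := by
  obtain ⟨h1, h2, h3⟩ := mem_solo.1 he
  ext g
  rw [Finset.mem_insert, mem_solo, mem_solo, mem_mv, mem_mv]
  constructor
  · rintro ⟨hg, hgs, hgu⟩
    push Not at hgu
    by_cases hga : g = Function.update e s a
    · exact Or.inl hga
    obtain ⟨hge, hgE⟩ := hg.resolve_left hga
    refine Or.inr ⟨hgE, hgs, ?_⟩
    apply hgu.2
    intro hc
    apply hga
    rw [← hc, update_update_self w hgs]
  · rintro (rfl | ⟨hgE, hgs, hgu⟩)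
    · refine ⟨Or.inl rfl, by simp, ?_⟩
      rw [update_update_self a h2]
      push Not
      refine ⟨fun hc => h3 (hc ▸ h1), fun hc => (hc rfl).elim⟩
    · refine ⟨Or.inr ⟨?_, hgE⟩, hgs, ?_⟩
      · rintro rfl; exact haw (hgs.symm.trans h2)
      · push Not
        refine ⟨?_, fun _ => hgu⟩
        intro hc
        have := congrFun hc s
        simp at this; exact haw this.symm

lemma card_solo_mv (haw : a ≠ w) (he : e ∈ solo E s w a) :
    (solo (mv E e (Function.update e s a)) s w a).card + 1 = (solo E s w a).card ∧
    (solo (mv E e (Function.update e s a)) s a w).card = (solo E s a w).card + 1 := by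
  rw [solo_mv haw he, solo_mv' haw he]
  refine ⟨Finset.card_erase_add_one he, Finset.card_insert_of_notMem ?_⟩
  rw [mem_solo]
  exact fun hc => (mem_solo.1 he).2.2 hc.1

lemma mem_solo_mv (haw : a ≠ w) (he : e ∈ solo E s w a) (hh : h ∈ solo E s a w) :
    h ∈ solo (mv E e (Function.update e s a)) s a w := by
  rw [solo_mv' haw he]
  exact Finset.mem_insert_of_mem hh

lemma card_solo_sw (haw : a ≠ w) (he : e ∈ solo E s w a) (hh : h ∈ solo E s a w) :
    (solo (sw E s a w e h) s w a).card = (solo E s w a).card ∧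
    (solo (sw E s a w e h) s a w).card = (solo E s a w).card := by
  have h1 := card_solo_mv haw he
  have h2 := card_solo_mv haw.symm (mem_solo_mv haw he hh)
  unfold sw
  omega

lemma sw_mem_solo (haw : a ≠ w) (he : e ∈ solo E s w a) (hh : h ∈ solo E s a w) :
    Function.update e s a ∈ solo (sw E s a w e h) s a w ∧
      Function.update h s w ∈ solo (sw E s a w e h) s w a := by
  obtain ⟨n1, n2, n3, n4, n5, n6⟩ := solo_ne haw he hh
  have h' := mem_solo_mv haw he hh
  unfold sw
  rw [solo_mv haw.symm h', solo_mv' haw.symm h', solo_mv haw he, solo_mv' haw he]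
  exact ⟨Finset.mem_erase.2 ⟨n2, Finset.mem_insert_self _ _⟩, Finset.mem_insert_self _ _⟩

lemma sw_sw (haw : a ≠ w) (he : e ∈ solo E s w a) (hh : h ∈ solo E s a w) :
    sw (sw E s a w e h) s w a (Function.update e s a) (Function.update h s w) = E := by
  obtain ⟨n1, n2, n3, n4, n5, n6⟩ := solo_ne haw he hh
  obtain ⟨h1, h2, h3⟩ := mem_solo.1 he
  obtain ⟨h4, h5, h6⟩ := mem_solo.1 hh
  ext g
  rw [mem_sw, mem_sw, update_update_self a h2, update_update_self w h5]
  by_cases c1 : g = e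
  · subst c1; simp [h1, n3]
  by_cases c2 : g = h
  · subst c2; simp [h4]
  by_cases c3 : g = Function.update e s a
  · subst c3; simp [h3, Ne.symm n5, n2]
  by_cases c4 : g = Function.update h s w
  · subst c4; simp [h6, Ne.symm n6]
  simp [c1, c2, c3, c4]

end Swap

/-- The exchange of two edges is a bijection between the configurations in which `α` is present
with `α` moved to `a` absent and those in which the roles are reversed. -/
lemma sum_swap {S : Finset (Fin r)} {y : Fin r → Fin m → ℕ} {s : Fin r} {a w : Fin m}
    (haw : a ≠ w) {α β : Fin r → Fin m} (hα : α s = w) (hβ : β = Function.update α s a)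
    (F : Finset (Fin r → Fin m) → (Fin r → Fin m) → ℝ) :
    ∑ E ∈ (fam S y).filter (fun E => α ∈ solo E s w a), ∑ h ∈ solo E s a w, F E h =
    ∑ E ∈ (fam S y).filter (fun E => β ∈ solo E s a w), ∑ h ∈ solo E s w a,
      F (sw E s w a β h) (Function.update h s a) := by
  have hβα : Function.update β s w = α := by rw [hβ, update_update_self a hα]
  rw [Finset.sum_sigma', Finset.sum_sigma']
  refine Finset.sum_bij' (fun p _ => ⟨sw p.1 s a w α p.2, Function.update p.2 s w⟩)
    (fun p _ => ⟨sw p.1 s w a β p.2, Function.update p.2 s a⟩) ?_ ?_ ?_ ?_ ?_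
  · rintro ⟨E, h⟩ hp
    simp only [Finset.mem_sigma, Finset.mem_filter] at hp ⊢
    obtain ⟨⟨hE, hα'⟩, hh⟩ := hp
    have := sw_mem_solo haw hα' hh
    rw [← hβ] at this
    exact ⟨⟨sw_mem_fam haw hα' hh hE, this.1⟩, this.2⟩
  · rintro ⟨E, h⟩ hp
    simp only [Finset.mem_sigma, Finset.mem_filter] at hp ⊢
    obtain ⟨⟨hE, hα'⟩, hh⟩ := hp
    have := sw_mem_solo haw.symm hα' hh
    rw [hβα] at this
    exact ⟨⟨sw_mem_fam haw.symm hα' hh hE, this.1⟩, this.2⟩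
  · rintro ⟨E, h⟩ hp
    simp only [Finset.mem_sigma, Finset.mem_filter] at hp
    obtain ⟨⟨hE, hα'⟩, hh⟩ := hp
    have := sw_sw haw hα' hh
    rw [← hβ] at this
    simp only [this, update_update_self w (mem_solo.1 hh).2.1]
  · rintro ⟨E, h⟩ hp
    simp only [Finset.mem_sigma, Finset.mem_filter] at hp
    obtain ⟨⟨hE, hα'⟩, hh⟩ := hp
    have := sw_sw haw.symm hα' hh
    rw [hβα] at this
    simp only [this, update_update_self a (mem_solo.1 hh).2.1]
  · rintro ⟨E, h⟩ hp
    simp only [Finset.mem_sigma, Finset.mem_filter] at hp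
    obtain ⟨⟨hE, hα'⟩, hh⟩ := hp
    have := sw_sw haw hα' hh
    rw [← hβ] at this
    simp only [this, update_update_self w (mem_solo.1 hh).2.1]

end

section

variable {r m : ℕ}

/-- The edges through the vertex `a` of class `s` whose translate to the vertex `w` is present. -/
def duo (E : Finset (Fin r → Fin m)) (s : Fin r) (a w : Fin m) : Finset (Fin r → Fin m) :=
  E.filter (fun e => e s = a ∧ Function.update e s w ∈ E)

lemma mem_duo {E : Finset (Fin r → Fin m)} {s : Fin r} {a w : Fin m} {e : Fin r → Fin m} :
    e ∈ duo E s a w ↔ e ∈ E ∧ e s = a ∧ Function.update e s w ∈ E := by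
  simp [duo]

lemma card_solo_add_card_duo (E : Finset (Fin r → Fin m)) (s : Fin r) (a w : Fin m) :
    (solo E s a w).card + (duo E s a w).card = vdeg E s a := by
  unfold vdeg
  rw [← Finset.card_filter_add_card_filter_not (s := E.filter (fun e => e s = a))
    (fun e => Function.update e s w ∉ E), Finset.filter_filter, Finset.filter_filter]
  simp only [not_not]
  rfl

lemma card_duo_comm (E : Finset (Fin r → Fin m)) (s : Fin r) (a w : Fin m) :
    (duo E s a w).card = (duo E s w a).card := by
  refine Finset.card_bij' (fun e _ => Function.update e s w) (fun e _ => Function.update e s a)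
    ?_ ?_ ?_ ?_
  · intro e he
    rw [mem_duo] at he ⊢
    exact ⟨he.2.2, by simp, by rw [update_update_self w he.2.1]; exact he.1⟩
  · intro e he
    rw [mem_duo] at he ⊢
    exact ⟨he.2.2, by simp, by rw [update_update_self a he.2.1]; exact he.1⟩
  · intro e he
    exact update_update_self w (mem_duo.1 he).2.1
  · intro e he
    exact update_update_self a (mem_duo.1 he).2.1

lemma card_solo_add_vdeg (E : Finset (Fin r → Fin m)) (s : Fin r) (a w : Fin m) :
    (solo E s a w).card + vdeg E s w = (solo E s w a).card + vdeg E s a := by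
  have h1 := card_solo_add_card_duo E s a w
  have h2 := card_solo_add_card_duo E s w a
  have h3 := card_duo_comm E s a w
  omega

/-- In an unconstrained class an edge can be moved freely. -/
lemma sum_move {S : Finset (Fin r)} {y : Fin r → Fin m → ℕ} {s : Fin r} (hs : s ∉ S)
    {a w : Fin m} (haw : a ≠ w) {α β : Fin r → Fin m} (hα : α s = w)
    (hβ : β = Function.update α s a) (F : Finset (Fin r → Fin m) → ℝ) :
    ∑ E ∈ (fam S y).filter (fun E => α ∈ solo E s w a), F E =
    ∑ E ∈ (fam S y).filter (fun E => β ∈ solo E s a w), F (mv E β α) := by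
  have hβα : Function.update β s w = α := by rw [hβ, update_update_self a hα]
  have hβs : β s = a := by rw [hβ]; simp
  have key : ∀ {b c : Fin m} {e f : Fin r → Fin m} {E : Finset (Fin r → Fin m)}, b ≠ c → e s = c →
      f = Function.update e s b → E ∈ (fam S y).filter (fun E => e ∈ solo E s c b) →
      mv E e f ∈ (fam S y).filter (fun E => f ∈ solo E s b c) := by
    intro b c e f E hbc he hf hE
    rw [Finset.mem_filter] at hE ⊢
    obtain ⟨hE, he'⟩ := hE
    have h1 := mem_solo.1 he'
    rw [← hf] at h1
    refine ⟨?_, ?_⟩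
    · rw [mem_fam] at hE ⊢
      intro i hi v
      rw [vdeg_mv_of_eq h1.1 h1.2.2, hE i hi v]
      rw [hf, Function.update_of_ne (fun h : i = s => hs (h ▸ hi))]
    · rw [hf, solo_mv' hbc he']
      exact Finset.mem_insert_self _ _
  refine Finset.sum_bij' (fun E _ => mv E α β) (fun E _ => mv E β α) ?_ ?_ ?_ ?_ ?_
  · intro E hE; exact key haw hα hβ hE
  · intro E hE; exact key haw.symm hβs hβα.symm hE
  · intro E hE
    have := mem_solo.1 (Finset.mem_filter.1 hE).2
    exact mv_mv_cancel this.1 (hβ ▸ this.2.2)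
  · intro E hE
    have := mem_solo.1 (Finset.mem_filter.1 hE).2
    exact mv_mv_cancel this.1 (hβα ▸ this.2.2)
  · intro E hE
    have := mem_solo.1 (Finset.mem_filter.1 hE).2
    have h := mv_mv_cancel this.1 (hβ ▸ this.2.2)
    exact congrArg F h.symm

/-- Moving one edge changes the degree vector of one class. -/
lemma sum_solo_eq {S : Finset (Fin r)} {y y' : Fin r → Fin m → ℕ} {t : Fin r} {u v : Fin m}
    (huv : u ≠ v) (hy : ∀ s, s ≠ t → y' s = y s)
    (hx : ∀ z, y' t z + (if z = v then 1 else 0) = y t z + (if z = u then 1 else 0)) :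
    ∑ E ∈ fam S y, (solo E t v u).card = ∑ E ∈ fam S y', (solo E t u v).card := by
  simp only [Finset.card_eq_sum_ones]
  rw [Finset.sum_sigma', Finset.sum_sigma']
  have key : ∀ {z z' : Fin r → Fin m → ℕ} {b c : Fin m} {E : Finset (Fin r → Fin m)}
      {e : Fin r → Fin m}, b ≠ c → (∀ s, s ≠ t → z' s = z s) →
      (∀ q, z' t q + (if q = c then 1 else 0) = z t q + (if q = b then 1 else 0)) →
      E ∈ fam S z → e ∈ solo E t c b →
      mv E e (Function.update e t b) ∈ fam S z' ∧
      Function.update e t b ∈ solo (mv E e (Function.update e t b)) t b c := by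
    intro z z' b c E e hbc hz hq hE he
    have h1 := mem_solo.1 he
    refine ⟨?_, ?_⟩
    · rw [mem_fam] at hE ⊢
      intro i hi q
      have h2 := hE i hi q
      by_cases hit : i = t
      · subst hit
        have h3 := vdeg_mv h1.1 h1.2.2 i q
        have h4 := hq q
        simp only [h1.2.1, Function.update_self] at h3
        simp only [eq_comm (a := c), eq_comm (a := b)] at h3
        omega
      · rw [vdeg_mv_of_eq h1.1 h1.2.2 (by rw [Function.update_of_ne hit]), h2, hz i hit]
    · rw [solo_mv' hbc he]
      exact Finset.mem_insert_self _ _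
  refine Finset.sum_bij' (fun p _ => ⟨mv p.1 p.2 (Function.update p.2 t u), Function.update p.2 t u⟩)
    (fun p _ => ⟨mv p.1 p.2 (Function.update p.2 t v), Function.update p.2 t v⟩) ?_ ?_ ?_ ?_ ?_
  · rintro ⟨E, h⟩ hp
    simp only [Finset.mem_sigma] at hp ⊢
    exact key huv hy hx hp.1 hp.2
  · rintro ⟨E, h⟩ hp
    simp only [Finset.mem_sigma] at hp ⊢
    exact key huv.symm (fun s hs => (hy s hs).symm) (fun q => (hx q).symm) hp.1 hp.2
  · rintro ⟨E, h⟩ hp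
    simp only [Finset.mem_sigma] at hp
    have h1 := mem_solo.1 hp.2
    simp only [update_update_self u h1.2.1, mv_mv_cancel h1.1 h1.2.2]
  · rintro ⟨E, h⟩ hp
    simp only [Finset.mem_sigma] at hp
    have h1 := mem_solo.1 hp.2
    simp only [update_update_self v h1.2.1, mv_mv_cancel h1.1 h1.2.2]
  · intros; rfl

/-- The number of edge sets of a family containing two given edges. -/
def pc (Ω : Finset (Finset (Fin r → Fin m))) (γ α : Fin r → Fin m) : ℕ :=
  (Ω.filter (fun E => γ ∈ E ∧ α ∈ E)).card

lemma pc_comm (Ω : Finset (Finset (Fin r → Fin m))) (γ α : Fin r → Fin m) :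
    pc Ω γ α = pc Ω α γ := by
  simp only [pc, and_comm]

lemma pc_eq_solo_add (Ω : Finset (Finset (Fin r → Fin m))) {γ α : Fin r → Fin m} {s : Fin r}
    {a w : Fin m} (hα : α s = w) :
    pc Ω γ α = (Ω.filter (fun E => α ∈ solo E s w a ∧ γ ∈ E)).card +
      (Ω.filter (fun E => γ ∈ E ∧ α ∈ E ∧ Function.update α s a ∈ E)).card := by
  unfold pc
  rw [← Finset.card_filter_add_card_filter_not (fun E => Function.update α s a ∉ E),
    Finset.filter_filter, Finset.filter_filter]
  congr 2
  · ext E; simp only [Finset.mem_filter, mem_solo]; tauto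
  · ext E; simp only [Finset.mem_filter]; tauto

lemma pc_sub_pc (Ω : Finset (Finset (Fin r → Fin m))) {γ α β : Fin r → Fin m} {s : Fin r}
    {a w : Fin m} (hα : α s = w) (hβ : β = Function.update α s a) :
    (pc Ω γ α : ℝ) - pc Ω γ β =
      (Ω.filter (fun E => α ∈ solo E s w a ∧ γ ∈ E)).card -
      (Ω.filter (fun E => β ∈ solo E s a w ∧ γ ∈ E)).card := by
  have hβα : Function.update β s w = α := by rw [hβ, update_update_self a hα]
  have hβs : β s = a := by rw [hβ]; simp
  rw [pc_eq_solo_add Ω (γ := γ) (a := a) hα, pc_eq_solo_add Ω (γ := γ) (a := w) hβs, ← hβ, hβα]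
  have : (Ω.filter (fun E => γ ∈ E ∧ β ∈ E ∧ α ∈ E)) = Ω.filter (fun E => γ ∈ E ∧ α ∈ E ∧ β ∈ E) := by
    ext E; simp only [Finset.mem_filter]; tauto
  rw [this]; push_cast; ring

lemma pc_eq_of_notMem {S : Finset (Fin r)} {y : Fin r → Fin m → ℕ} {s : Fin r} (hs : s ∉ S)
    {a w : Fin m} (haw : a ≠ w) {α β γ : Fin r → Fin m} (hα : α s = w)
    (hβ : β = Function.update α s a) (hγα : γ ≠ α) (hγβ : γ ≠ β) :
    (pc (fam S y) γ α : ℝ) = pc (fam S y) γ β := by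
  rw [← sub_eq_zero, pc_sub_pc _ hα hβ, sub_eq_zero]
  have h := sum_move (y := y) hs haw hα hβ (fun E => if γ ∈ E then 1 else 0)
  simp only [mem_mv, hγα, hγβ, false_or, ne_eq, not_false_eq_true, true_and] at h
  rw [← Finset.sum_filter, ← Finset.sum_filter, Finset.filter_filter, Finset.filter_filter] at h
  simpa using h

lemma sum_ite_ne_div {ι : Type*} [DecidableEq ι] (A : Finset ι) (g : ι) (Z : ℝ)
    (hZ : (A.card : ℝ) = Z) (hZ0 : 0 < Z) :
    (∑ h ∈ A, if h ≠ g then 1 / Z else 0) = 1 - (if g ∈ A then 1 / Z else 0) := by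
  have h1 : ∀ h ∈ A, (if h ≠ g then 1 / Z else 0) = 1 / Z - (if h = g then 1 / Z else 0) := by
    intro h _
    by_cases hg : h = g <;> simp [hg]
  rw [Finset.sum_congr rfl h1, Finset.sum_sub_distrib, Finset.sum_const, nsmul_eq_mul, hZ,
    Finset.sum_ite_eq' A g]
  field_simp

lemma abs_pc_sub_pc_le {S : Finset (Fin r)} {y : Fin r → Fin m → ℕ} {s : Fin r} (hs : s ∈ S)
    {a w : Fin m} (haw : a ≠ w) (hy : y s a = y s w) {α β γ : Fin r → Fin m} (hα : α s = w)
    (hβ : β = Function.update α s a) (hγα : γ ≠ α) (hγβ : γ ≠ β) {z : ℝ} (hz : 0 < z) :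
    |(pc (fam S y) γ α : ℝ) - pc (fam S y) γ β| ≤
      ((pc (fam S y) γ α : ℝ) + pc (fam S y) γ β) / z +
        ((fam S y).filter (fun E => ((solo E s a w).card : ℝ) < z)).card := by
  have hβα : Function.update β s w = α := by rw [hβ, update_update_self a hα]
  have hβs : β s = a := by rw [hβ]; simp
  have hcard : ∀ E ∈ fam S y, (solo E s w a).card = (solo E s a w).card := by
    intro E hE
    have h1 := card_solo_add_vdeg E s a w
    rw [mem_fam] at hE
    have h2 := hE s hs a
    have h3 := hE s hs w
    omega
  rw [pc_sub_pc _ hα hβ]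
  set c1 := (fam S y).filter (fun E => α ∈ solo E s w a ∧ γ ∈ E) with hc1
  set c2 := (fam S y).filter (fun E => β ∈ solo E s a w ∧ γ ∈ E) with hc2
  have hZ1 : ∀ E ∈ c1, 0 < ((solo E s a w).card : ℝ) := by
    intro E hE
    rw [hc1, Finset.mem_filter] at hE
    rw [← hcard E hE.1]
    exact_mod_cast Finset.card_pos.2 ⟨α, hE.2.1⟩
  have hZ2 : ∀ E ∈ c2, 0 < ((solo E s a w).card : ℝ) := by
    intro E hE
    rw [hc2, Finset.mem_filter] at hE
    exact_mod_cast Finset.card_pos.2 ⟨β, hE.2.1⟩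
  have h := sum_swap (y := y) (S := S) haw hα hβ
    (fun E h => if γ ∈ E then (if h ≠ γ then 1 / ((solo E s a w).card : ℝ) else 0) else 0)
  have hL : ∑ E ∈ (fam S y).filter (fun E => α ∈ solo E s w a), ∑ h ∈ solo E s a w,
      (if γ ∈ E then (if h ≠ γ then 1 / ((solo E s a w).card : ℝ) else 0) else 0) =
      ∑ E ∈ c1, (1 - (if γ ∈ solo E s a w then 1 / ((solo E s a w).card : ℝ) else 0)) := by
    rw [hc1, ← Finset.filter_filter, Finset.sum_filter (fun E => γ ∈ E)]
    refine Finset.sum_congr rfl fun E hE => ?_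
    split_ifs with h1 h2
    · rw [sum_ite_ne_div _ _ _ rfl (hZ1 E (by
        rw [Finset.mem_filter] at hE; rw [hc1, Finset.mem_filter]; tauto)), if_pos h2]
    · rw [sum_ite_ne_div _ _ _ rfl (hZ1 E (by
        rw [Finset.mem_filter] at hE; rw [hc1, Finset.mem_filter]; tauto)), if_neg h2]
    · simp
  have hR : ∑ E ∈ (fam S y).filter (fun E => β ∈ solo E s a w), ∑ h ∈ solo E s w a,
      (if γ ∈ sw E s w a β h then (if Function.update h s a ≠ γ then
        1 / ((solo (sw E s w a β h) s a w).card : ℝ) else 0) else 0) =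
      ∑ E ∈ c2, (1 - (if γ ∈ solo E s w a then 1 / ((solo E s a w).card : ℝ) else 0)) := by
    rw [hc2, ← Finset.filter_filter, Finset.sum_filter (fun E => γ ∈ E)]
    refine Finset.sum_congr rfl fun E hE => ?_
    rw [Finset.mem_filter] at hE
    have h1 : ∀ h ∈ solo E s w a, (if γ ∈ sw E s w a β h then (if Function.update h s a ≠ γ then
        1 / ((solo (sw E s w a β h) s a w).card : ℝ) else 0) else 0) =
        if γ ∈ E then (if h ≠ γ then 1 / ((solo E s a w).card : ℝ) else 0) else 0 := by
      intro h hh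
      rw [(card_solo_sw haw.symm hE.2 hh).1]
      have h2 := mem_solo.1 hh
      by_cases k1 : γ = h
      · subst k1
        have : γ ∉ sw E s w a β γ := by
          rw [mem_sw, hβα]
          have := solo_ne haw.symm hE.2 hh
          simp [this.2.2.2.2.2]
        simp [this]
      by_cases k2 : γ = Function.update h s a
      · subst k2
        simp [h2.2.2]
      have : γ ∈ sw E s w a β h ↔ γ ∈ E := by
        rw [mem_sw, hβα]
        simp [k1, k2, hγα, hγβ]
      simp [this, Ne.symm k1, Ne.symm k2]
    rw [Finset.sum_congr rfl h1]
    split_ifs with k1 k2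
    · rw [sum_ite_ne_div _ _ _ (by exact_mod_cast hcard E hE.1) (hZ2 E (by
        rw [hc2, Finset.mem_filter]; tauto)), if_pos k2]
    · rw [sum_ite_ne_div _ _ _ (by exact_mod_cast hcard E hE.1) (hZ2 E (by
        rw [hc2, Finset.mem_filter]; tauto)), if_neg k2]
    · simp
  rw [hL, hR, Finset.sum_sub_distrib, Finset.sum_sub_distrib] at h
  simp only [Finset.sum_const, nsmul_eq_mul, mul_one] at h
  have hbd : ∀ (c : Finset (Finset (Fin r → Fin m))) (δ : Fin r → Fin m) (b b' : Fin m),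
      c ⊆ (fam S y).filter (fun E => γ ∈ E ∧ δ ∈ E) →
      (∀ E ∈ c, 0 < ((solo E s a w).card : ℝ)) →
      0 ≤ ∑ E ∈ c, (if γ ∈ solo E s b b' then 1 / ((solo E s a w).card : ℝ) else 0) ∧
      ∑ E ∈ c, (if γ ∈ solo E s b b' then 1 / ((solo E s a w).card : ℝ) else 0) ≤
        (pc (fam S y) γ δ : ℝ) / z +
          ((fam S y).filter (fun E => ((solo E s a w).card : ℝ) < z)).card := by
    intro c δ b b' hc hpos
    constructor
    · exact Finset.sum_nonneg fun E _ => by positivity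
    · have h1 : ∀ E ∈ c, (if γ ∈ solo E s b b' then 1 / ((solo E s a w).card : ℝ) else 0) ≤
          1 / z + (if ((solo E s a w).card : ℝ) < z then 1 else 0) := by
        intro E hE
        have hp := hpos E hE
        have hle : (if γ ∈ solo E s b b' then 1 / ((solo E s a w).card : ℝ) else 0) ≤
            1 / ((solo E s a w).card : ℝ) := by
          split_ifs
          · exact le_rfl
          · positivity
        refine hle.trans ?_
        split_ifs with k
        · have : 1 / ((solo E s a w).card : ℝ) ≤ 1 := by
            rw [div_le_one hp]
            have : 0 < (solo E s a w).card := by exact_mod_cast hp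
            exact_mod_cast this
          have : 0 < 1 / z := by positivity
          linarith
        · rw [add_zero]
          exact one_div_le_one_div_of_le hz (not_lt.1 k)
      refine (Finset.sum_le_sum h1).trans ?_
      rw [Finset.sum_add_distrib, Finset.sum_const, nsmul_eq_mul, ← Finset.sum_filter,
        Finset.sum_const, nsmul_eq_mul, mul_one]
      have h2 : (c.card : ℝ) ≤ pc (fam S y) γ δ := by
        exact_mod_cast Finset.card_le_card hc
      have h3 : ((c.filter (fun E => ((solo E s a w).card : ℝ) < z)).card : ℝ) ≤
          ((fam S y).filter (fun E => ((solo E s a w).card : ℝ) < z)).card := by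
        exact_mod_cast Finset.card_le_card
          (Finset.filter_subset_filter _ (hc.trans (Finset.filter_subset _ _)))
      have h4 : (c.card : ℝ) * (1 / z) ≤ (pc (fam S y) γ δ : ℝ) / z := by
        rw [mul_one_div]
        gcongr
      linarith
  have b1 := hbd c1 α a w (by
    intro E hE; rw [hc1, Finset.mem_filter, mem_solo] at hE; rw [Finset.mem_filter]; tauto) hZ1
  have b2 := hbd c2 β w a (by
    intro E hE; rw [hc2, Finset.mem_filter, mem_solo] at hE; rw [Finset.mem_filter]; tauto) hZ2
  have p1 : (0 : ℝ) ≤ (pc (fam S y) γ α : ℝ) / z := by positivity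
  have p2 : (0 : ℝ) ≤ (pc (fam S y) γ β : ℝ) / z := by positivity
  rw [add_div, abs_le]
  constructor <;> linarith [b1.1, b1.2, b2.1, b2.2]

end

section

variable {r m : ℕ}

/-- The potential edges through the vertex `w` of class `s`. -/
def layer (s : Fin r) (w : Fin m) : Finset (Fin r → Fin m) :=
  Finset.univ.filter (fun h => h s = w)

lemma mem_layer {s : Fin r} {w : Fin m} {h : Fin r → Fin m} : h ∈ layer s w ↔ h s = w := by
  simp [layer]

lemma sum_layer_update {M : Type*} [AddCommMonoid M] (s : Fin r) (v w : Fin m)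
    (f : (Fin r → Fin m) → M) :
    ∑ h ∈ layer s v, f (Function.update h s w) = ∑ h ∈ layer s w, f h := by
  refine Finset.sum_bij' (fun h _ => Function.update h s w) (fun h _ => Function.update h s v)
    ?_ ?_ ?_ ?_ ?_
  · intro h _; simp [mem_layer]
  · intro h _; simp [mem_layer]
  · intro h hh; exact update_update_self w (mem_layer.1 hh)
  · intro h hh; exact update_update_self v (mem_layer.1 hh)
  · intros; rfl

lemma sum_eq_sum_layer {M : Type*} [AddCommMonoid M] (s : Fin r) (f : (Fin r → Fin m) → M) :
    ∑ h, f h = ∑ v, ∑ h ∈ layer s v, f h := by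
  unfold layer
  exact (Finset.sum_fiberwise _ _ _).symm

lemma sum_update (s : Fin r) (w : Fin m) (f : (Fin r → Fin m) → ℕ) :
    ∑ h, f (Function.update h s w) = m * ∑ h ∈ layer s w, f h := by
  rw [sum_eq_sum_layer s]
  simp [sum_layer_update s _ w f]

lemma card_layer (s : Fin r) (w : Fin m) : (layer s w).card = m ^ (r - 1) := by
  have h := sum_update s w (fun _ => 1)
  simp only [Finset.sum_const, Finset.card_univ, Fintype.card_fun, Fintype.card_fin, smul_eq_mul,
    mul_one] at h
  have hr : m ^ r = m * m ^ (r - 1) := (mul_pow_sub_one s.pos.ne' m).symm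
  rw [hr] at h
  exact (Nat.eq_of_mul_eq_mul_left w.pos h).symm

/-- The point with first `k` coordinates from `g'` and the others from `g`. -/
def hyb (k : ℕ) (g g' : Fin r → Fin m) : Fin r → Fin m := fun i => if i.val < k then g' i else g i

lemma hyb_succ (i : Fin r) (g g' : Fin r → Fin m) :
    hyb (i.val + 1) g g' = Function.update (hyb i.val g g') i (g' i) := by
  ext j
  by_cases h : j = i
  · subst h; simp [hyb]
  · rw [Function.update_of_ne h]
    have : j.val ≠ i.val := fun hh => h (Fin.ext hh)
    have h2 : j.val < i.val + 1 ↔ j.val < i.val := by omega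
    simp [hyb, h2]

lemma hyb_hyb (k : ℕ) (g g' : Fin r → Fin m) : hyb k (hyb k g g') (hyb k g' g) = g := by
  ext j
  by_cases h : j.val < k <;> simp [hyb, h]

lemma sum_hyb (i : Fin r) (φ : (Fin r → Fin m) → Fin m → ℕ) :
    ∑ p : (Fin r → Fin m) × (Fin r → Fin m), φ (hyb i.val p.1 p.2) (p.2 i) =
      m ^ (r - 1) * ∑ h, ∑ c, φ h c := by
  have h1 : ∑ p : (Fin r → Fin m) × (Fin r → Fin m), φ (hyb i.val p.1 p.2) (p.2 i) =
      ∑ p : (Fin r → Fin m) × (Fin r → Fin m), φ p.1 (p.2 i) := by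
    refine Finset.sum_bij' (fun p _ => (hyb i.val p.1 p.2, hyb i.val p.2 p.1))
      (fun p _ => (hyb i.val p.1 p.2, hyb i.val p.2 p.1)) ?_ ?_ ?_ ?_ ?_
    · simp
    · simp
    · intro p _; simp [hyb_hyb]
    · intro p _; simp [hyb_hyb]
    · intro p _; simp [hyb]
  rw [h1, Fintype.sum_prod_type, Finset.mul_sum]
  refine Finset.sum_congr rfl fun h _ => ?_
  rw [sum_eq_sum_layer i, Finset.mul_sum]
  refine Finset.sum_congr rfl fun c _ => ?_
  rw [Finset.sum_congr rfl (g := fun _ => φ h c) (fun q hq => by simp only [mem_layer.1 hq]),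
    Finset.sum_const, card_layer, smul_eq_mul]

lemma one_le_sum_hyb (P : (Fin r → Fin m) → Prop) [DecidablePred P] {g g' : Fin r → Fin m}
    (hg : P g) (hg' : ¬ P g') :
    1 ≤ ∑ i : Fin r, if P (hyb i.val g g') ∧ ¬ P (hyb (i.val + 1) g g') then 1 else 0 := by
  by_contra hlt
  have h0 : ∀ i : Fin r, ¬ (P (hyb i.val g g') ∧ ¬ P (hyb (i.val + 1) g g')) := by
    intro i hi
    have := Finset.single_le_sum (f := fun i : Fin r =>
      if P (hyb i.val g g') ∧ ¬ P (hyb (i.val + 1) g g') then 1 else 0)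
      (fun _ _ => Nat.zero_le _) (Finset.mem_univ i)
    simp only [if_pos hi] at this
    exact hlt this
  have h1 : ∀ k, k ≤ r → P (hyb k g g') := by
    intro k
    induction k with
    | zero => intro _; rwa [show hyb 0 g g' = g from by ext; simp [hyb]]
    | succ k ih =>
      intro hk
      have := h0 ⟨k, hk⟩
      simp only [not_and, not_not] at this
      exact this (ih (by omega))
  have h2 := h1 r le_rfl
  rw [show hyb r g g' = g' from by ext; simp [hyb]] at h2
  exact hg' h2

/-- An edge isoperimetric inequality for the Hamming graph. -/
lemma isoperimetry (P : (Fin r → Fin m) → Prop) [DecidablePred P] :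
    (Finset.univ.filter P).card * (Finset.univ.filter (fun h => ¬ P h)).card ≤
      m ^ (r - 1) * ∑ h, ∑ i, ∑ c, if P h ∧ ¬ P (Function.update h i c) then 1 else 0 := by
  calc (Finset.univ.filter P).card * (Finset.univ.filter (fun h => ¬ P h)).card
      = ∑ p : (Fin r → Fin m) × (Fin r → Fin m), if P p.1 ∧ ¬ P p.2 then 1 else 0 := by
        rw [← Finset.card_product, ← Finset.card_filter]
        congr 1; ext p; simp
    _ ≤ ∑ p : (Fin r → Fin m) × (Fin r → Fin m), ∑ i : Fin r,
          if P (hyb i.val p.1 p.2) ∧ ¬ P (hyb (i.val + 1) p.1 p.2) then 1 else 0 := by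
        refine Finset.sum_le_sum fun p _ => ?_
        split_ifs with h
        · exact one_le_sum_hyb P h.1 h.2
        · exact Nat.zero_le _
    _ = _ := by
        rw [Finset.sum_comm]
        simp only [hyb_succ]
        rw [Finset.sum_comm (s := Finset.univ (α := Fin r → Fin m)), Finset.mul_sum]
        exact Finset.sum_congr rfl fun i _ =>
          sum_hyb i (fun h c => if P h ∧ ¬ P (Function.update h i c) then 1 else 0)

lemma layer_isoperimetry {s : Fin r} {w : Fin m} {D : Finset (Fin r → Fin m)}
    (hD : D ⊆ layer s w) :
    m * (D.card * (m ^ (r - 1) - D.card)) ≤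
      m ^ (r - 1) * ∑ h ∈ D, ∑ i ∈ Finset.univ.erase s,
        (Finset.univ.filter (fun c => Function.update h i c ∉ D)).card := by
  have h := isoperimetry (fun h : Fin r → Fin m => Function.update h s w ∈ D)
  have h1 : (Finset.univ.filter (fun h : Fin r → Fin m => Function.update h s w ∈ D)).card =
      m * D.card := by
    rw [Finset.card_filter, sum_update s w (fun h => if h ∈ D then 1 else 0), ← Finset.card_filter,
      Finset.filter_mem_eq_inter, Finset.inter_eq_right.2 hD]
  have h2 : (Finset.univ.filter (fun h : Fin r → Fin m => Function.update h s w ∉ D)).card =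
      m * (m ^ (r - 1) - D.card) := by
    rw [Finset.card_filter, sum_update s w (fun h => if h ∉ D then 1 else 0), ← Finset.card_filter,
      Finset.filter_notMem_eq_sdiff, Finset.card_sdiff_of_subset hD, card_layer]
  have h3 : (∑ h : Fin r → Fin m, ∑ i, ∑ c, if Function.update h s w ∈ D ∧
      ¬ Function.update (Function.update h i c) s w ∈ D then 1 else 0) =
      m * ∑ h ∈ D, ∑ i ∈ Finset.univ.erase s,
        (Finset.univ.filter (fun c => Function.update h i c ∉ D)).card := by
    rw [← Finset.inter_eq_right.2 hD, ← Finset.filter_mem_eq_inter, Finset.sum_filter,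
      Finset.filter_mem_eq_inter, Finset.inter_eq_right.2 hD, ← sum_update s w]
    refine Finset.sum_congr rfl fun h _ => ?_
    split_ifs with hh
    · rw [← Finset.sum_erase_add _ _ (Finset.mem_univ s)]
      simp only [Function.update_idem, hh, not_true, and_false, if_false, Finset.sum_const_zero,
        add_zero, true_and]
      refine Finset.sum_congr rfl fun i hi => ?_
      rw [Finset.card_filter]
      refine Finset.sum_congr rfl fun c _ => ?_
      rw [Function.update_comm (Finset.ne_of_mem_erase hi)]
    · simp [hh]
  rw [h1, h2, h3] at h
  rcases Nat.eq_zero_or_pos m with h0 | h0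
  · exact absurd w.isLt (by omega)
  refine le_of_mul_le_mul_left (a := m) ?_ h0
  calc m * (m * (D.card * (m ^ (r - 1) - D.card)))
      = m * D.card * (m * (m ^ (r - 1) - D.card)) := by ring
    _ ≤ _ := h
    _ = _ := by ring

end

section

variable {r m : ℕ}

/-- The number of edges at two vertices of a class that have no counterpart at the other vertex. -/
def usolo (E : Finset (Fin r → Fin m)) (s : Fin r) (a w : Fin m) : ℕ :=
  (solo E s a w).card + (solo E s w a).card

lemma card_solo_le_mv (E : Finset (Fin r → Fin m)) (e f : Fin r → Fin m) (s : Fin r)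
    (a w : Fin m) : (solo E s a w).card ≤ (solo (mv E e f) s a w).card + 2 := by
  have h : solo E s a w ⊆ solo (mv E e f) s a w ∪ {e, Function.update f s a} := by
    intro g hg
    obtain ⟨h1, h2, h3⟩ := mem_solo.1 hg
    simp only [Finset.mem_union, Finset.mem_insert, Finset.mem_singleton, mem_solo, mem_mv]
    by_cases hge : g = e
    · exact Or.inr (Or.inl hge)
    by_cases hgf : Function.update g s w = f
    · exact Or.inr (Or.inr (by rw [← hgf, update_update_self w h2]))
    · exact Or.inl ⟨Or.inr ⟨hge, h1⟩, h2, by tauto⟩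
  refine (Finset.card_le_card h).trans ((Finset.card_union_le _ _).trans ?_)
  have := Finset.card_le_two (a := e) (b := Function.update f s a)
  omega

lemma usolo_le_mv (E : Finset (Fin r → Fin m)) (e f : Fin r → Fin m) (s : Fin r)
    (a w : Fin m) : usolo E s a w ≤ usolo (mv E e f) s a w + 4 := by
  have h1 := card_solo_le_mv E e f s a w
  have h2 := card_solo_le_mv E e f s w a
  unfold usolo
  omega

lemma usolo_le_sw (E : Finset (Fin r → Fin m)) (e f : Fin r → Fin m) (i : Fin r) (p q : Fin m)
    (s : Fin r) (a w : Fin m) : usolo E s a w ≤ usolo (sw E i p q e f) s a w + 8 := by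
  have h1 := usolo_le_mv E e (Function.update e i p) s a w
  have h2 := usolo_le_mv (mv E e (Function.update e i p)) f (Function.update f i q) s a w
  unfold sw
  omega

/-- The edge sets of a family that are lopsided between two vertices of a constrained class. -/
def lopsided (S : Finset (Fin r)) (y : Fin r → Fin m → ℕ) (i : Fin r) (p q : Fin m) :
    Finset (Finset (Fin r → Fin m)) :=
  (fam S y).filter (fun E => i ∈ S ∧ 2 * (solo E i q p).card < (solo E i p q).card)

/-- Both `α` and its translate are present, while both translates in direction `i` are absent. -/
def full (S : Finset (Fin r)) (y : Fin r → Fin m → ℕ) (s : Fin r) (a w : Fin m) (u : ℕ)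
    (α : Fin r → Fin m) (i : Fin r) (c : Fin m) : Finset (Finset (Fin r → Fin m)) :=
  (fam S y).filter (fun E => usolo E s a w ≤ u ∧ α ∈ E ∧ Function.update α s a ∈ E ∧
    Function.update α i c ∉ E ∧ Function.update (Function.update α s a) i c ∉ E)

/-- The configuration obtained from `full` by moving `α` in direction `i`. -/
def half (S : Finset (Fin r)) (y : Fin r → Fin m → ℕ) (s : Fin r) (a w : Fin m) (u : ℕ)
    (α : Fin r → Fin m) (i : Fin r) (c : Fin m) : Finset (Finset (Fin r → Fin m)) :=
  (fam S y).filter (fun E => usolo E s a w ≤ u ∧ α ∉ E ∧ Function.update α s a ∈ E ∧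
    Function.update α i c ∈ E ∧ Function.update (Function.update α s a) i c ∉ E)

lemma card_full_le {S : Finset (Fin r)} {y : Fin r → Fin m → ℕ} {s i : Fin r} (his : i ≠ s)
    {a w : Fin m} (haw : a ≠ w) {α : Fin r → Fin m} (hα : α s = w) {c : Fin m} (hc : c ≠ α i)
    (u : ℕ) :
    (full S y s a w u α i c).card ≤
      2 * (half S y s a w (u + 8) α i c).card + (lopsided S y i (α i) c).card := by
  set α' := Function.update α s a with hα'
  set β := Function.update α i c with hβ
  set β' := Function.update α' i c with hβ'
  have hα'i : α' i = α i := by rw [hα', Function.update_of_ne his]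
  have hα's : α' s = a := by rw [hα', Function.update_self]
  have hβs : β s = w := by rw [hβ, Function.update_of_ne his.symm, hα]
  have hβ's : β' s = a := by rw [hβ', Function.update_of_ne his.symm, hα's]
  have hβi : β i = c := by rw [hβ, Function.update_self]
  have hβ'i : β' i = c := by rw [hβ', Function.update_self]
  have hβα : Function.update β i (α i) = α := update_update_self c rfl
  have n1 : α' ≠ α := fun h => haw (by rw [← hα's, h, hα])
  have n2 : α' ≠ β := fun h => haw (by rw [← hα's, h, hβs])
  have n3 : β' ≠ α := fun h => haw (by rw [← hβ's, h, hα])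
  have n4 : β' ≠ β := fun h => haw (by rw [← hβ's, h, hβs])
  by_cases hi : i ∈ S
  · let Φ : Finset (Fin r → Fin m) → Prop := fun E => usolo E s a w ≤ u ∧ α' ∈ E ∧ β' ∉ E ∧
      (solo E i (α i) c).card ≤ 2 * (solo E i c (α i)).card
    classical
    have h := sum_swap (S := S) (y := y) hc (rfl : α i = α i) hβ
      (fun E _ => if Φ E then 1 / ((solo E i c (α i)).card : ℝ) else 0)
    have hL : ((full S y s a w u α i c).card : ℝ) - (lopsided S y i (α i) c).card ≤
        ∑ E ∈ (fam S y).filter (fun E => α ∈ solo E i (α i) c), ∑ h ∈ solo E i c (α i),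
          if Φ E then 1 / ((solo E i c (α i)).card : ℝ) else 0 := by
      have h1 : ∀ E ∈ (fam S y).filter (fun E => α ∈ solo E i (α i) c),
          (∑ h ∈ solo E i c (α i), if Φ E then 1 / ((solo E i c (α i)).card : ℝ) else 0) =
          if Φ E then 1 else 0 := by
        intro E hE
        rw [Finset.sum_const, nsmul_eq_mul]
        split_ifs with hΦ
        · have h2 : 0 < (solo E i (α i) c).card :=
            Finset.card_pos.2 ⟨α, (Finset.mem_filter.1 hE).2⟩
          have h3 : 0 < (solo E i c (α i)).card := by have := hΦ.2.2.2; omega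
          field_simp
        · simp
      rw [Finset.sum_congr rfl h1, ← Finset.sum_filter, Finset.filter_filter, Finset.sum_const,
        nsmul_eq_mul, mul_one, sub_le_iff_le_add]
      have h2 : full S y s a w u α i c ⊆
          (fam S y).filter (fun E => α ∈ solo E i (α i) c ∧ Φ E) ∪ lopsided S y i (α i) c := by
        intro E hE
        simp only [full, Finset.mem_filter] at hE
        simp only [Finset.mem_union, lopsided, Finset.mem_filter, mem_solo, Φ]
        obtain ⟨k1, k2, k3, k4, k5, k6⟩ := hE
        by_cases hg : (solo E i (α i) c).card ≤ 2 * (solo E i c (α i)).card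
        · exact Or.inl ⟨k1, ⟨k3, trivial, k5⟩, k2, k4, k6, hg⟩
        · exact Or.inr ⟨k1, hi, not_le.1 hg⟩
      have h3 := (Finset.card_le_card h2).trans (Finset.card_union_le _ _)
      exact_mod_cast h3
    have hR : ∑ E ∈ (fam S y).filter (fun E => β ∈ solo E i c (α i)), ∑ h ∈ solo E i (α i) c,
        (if Φ (sw E i (α i) c β h) then
          1 / ((solo (sw E i (α i) c β h) i c (α i)).card : ℝ) else 0) ≤
        2 * (half S y s a w (u + 8) α i c).card := by
      have h1 : ∀ E ∈ (fam S y).filter (fun E => β ∈ solo E i c (α i)),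
          (∑ h ∈ solo E i (α i) c, (if Φ (sw E i (α i) c β h) then
            1 / ((solo (sw E i (α i) c β h) i c (α i)).card : ℝ) else 0)) ≤
          if (usolo E s a w ≤ u + 8 ∧ α ∉ E ∧ α' ∈ E ∧ β ∈ E ∧ β' ∉ E) then 2 else 0 := by
        intro E hE
        have hβE := (Finset.mem_filter.1 hE).2
        have hβE' := mem_solo.1 hβE
        have himp : ∀ h ∈ solo E i (α i) c, Φ (sw E i (α i) c β h) →
            (usolo E s a w ≤ u + 8 ∧ α ∉ E ∧ α' ∈ E ∧ β ∈ E ∧ β' ∉ E) ∧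
            (solo E i (α i) c).card ≤ 2 * (solo E i c (α i)).card := by
          intro h hh ⟨k1, k2, k3, k4⟩
          have hh' := mem_solo.1 hh
          have k5 := usolo_le_sw E β h i (α i) c s a w
          rw [(card_solo_sw hc.symm hβE hh).1, (card_solo_sw hc.symm hβE hh).2] at k4
          rw [mem_sw, hβα] at k2 k3
          refine ⟨⟨by omega, by rw [← hβα]; exact hβE'.2.2, ?_, hβE'.1, ?_⟩, k4⟩
          · rcases k2 with k2 | ⟨-, k2 | ⟨-, k2⟩⟩
            · exact absurd (by rw [← hα'i, k2, Function.update_self]) hc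
            · exact absurd k2 n1
            · exact k2
          · intro k
            refine k3 (Or.inr ⟨fun k6 => hc (by rw [← hβ'i, k6, hh'.2.1]), Or.inr ⟨n4, k⟩⟩)
        split_ifs with hcond
        · by_cases hg : (solo E i (α i) c).card ≤ 2 * (solo E i c (α i)).card
          · have h3 : 0 < (solo E i c (α i)).card := Finset.card_pos.2 ⟨β, hβE⟩
            calc _ ≤ ∑ h ∈ solo E i (α i) c, 1 / ((solo E i c (α i)).card : ℝ) := by
                  refine Finset.sum_le_sum fun h hh => ?_
                  have h4 := (card_solo_sw hc.symm hβE hh).1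
                  split_ifs
                  · rw [h4]
                  · positivity
              _ = ((solo E i (α i) c).card : ℝ) / (solo E i c (α i)).card := by
                  rw [Finset.sum_const, nsmul_eq_mul, mul_one_div]
              _ ≤ 2 := by
                  rw [div_le_iff₀ (by exact_mod_cast h3)]
                  exact_mod_cast hg
          · rw [Finset.sum_eq_zero fun h hh => if_neg fun k => hg (himp h hh k).2]
            norm_num
        · rw [Finset.sum_eq_zero fun h hh => if_neg fun k => hcond (himp h hh k).1]
      refine (Finset.sum_le_sum h1).trans ?_
      rw [← Finset.sum_filter, Finset.filter_filter, Finset.sum_const, nsmul_eq_mul, mul_comm]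
      refine mul_le_mul_of_nonneg_left ?_ (by norm_num)
      unfold half
      exact_mod_cast Finset.card_le_card fun E hE => by
        simp only [Finset.mem_filter] at hE ⊢
        exact ⟨hE.1, hE.2.2⟩
    have h5 : ((full S y s a w u α i c).card : ℝ) ≤
        2 * (half S y s a w (u + 8) α i c).card + (lopsided S y i (α i) c).card := by
      have := hL.trans (h.le.trans hR)
      linarith
    exact_mod_cast h5
  · have h := sum_move (y := y) hi hc (rfl : α i = α i) hβ
      (fun E => if usolo E s a w ≤ u ∧ α' ∈ E ∧ β' ∉ E then 1 else 0)
    rw [← Finset.sum_filter, ← Finset.sum_filter, Finset.filter_filter, Finset.filter_filter] at h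
    simp only [Finset.sum_const, nsmul_eq_mul, mul_one] at h
    have h1 : (full S y s a w u α i c) ⊆ (fam S y).filter (fun E => α ∈ solo E i (α i) c ∧
        usolo E s a w ≤ u ∧ α' ∈ E ∧ β' ∉ E) := by
      intro E hE
      simp only [full, Finset.mem_filter, mem_solo] at hE ⊢
      exact ⟨hE.1, ⟨hE.2.2.1, trivial, hE.2.2.2.2.1⟩, hE.2.1, hE.2.2.2.1, hE.2.2.2.2.2⟩
    have h2 : (fam S y).filter (fun E => β ∈ solo E i c (α i) ∧
        usolo (mv E β α) s a w ≤ u ∧ α' ∈ mv E β α ∧ β' ∉ mv E β α) ⊆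
        half S y s a w (u + 8) α i c := by
      intro E hE
      simp only [half, Finset.mem_filter, mem_solo, mem_mv, hβα, n1, n2, n3, n4, false_or,
        ne_eq, not_false_eq_true, true_and] at hE ⊢
      have := usolo_le_mv E β α s a w
      exact ⟨hE.1, by omega, hE.2.1.2.2, hE.2.2.2.1, hE.2.1.1, hE.2.2.2.2⟩
    have h3 := Finset.card_le_card h1
    have h4 := Finset.card_le_card h2
    have h5 : ((fam S y).filter (fun E => α ∈ solo E i (α i) c ∧
        usolo E s a w ≤ u ∧ α' ∈ E ∧ β' ∉ E)).card = ((fam S y).filter (fun E =>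
        β ∈ solo E i c (α i) ∧ usolo (mv E β α) s a w ≤ u ∧ α' ∈ mv E β α ∧
          β' ∉ mv E β α)).card := by exact_mod_cast h
    omega

end

section

variable {r m : ℕ}

/-- The edge sets of a family with few unmatched edges at two vertices. -/
def few (S : Finset (Fin r)) (y : Fin r → Fin m → ℕ) (s : Fin r) (a w : Fin m) (u : ℕ) :
    Finset (Finset (Fin r → Fin m)) :=
  (fam S y).filter (fun E => usolo E s a w ≤ u)

lemma sum_card_filter_update (i : Fin r) (Z : Finset (Fin r → Fin m)) :
    ∑ h, (Finset.univ.filter (fun c => Function.update h i c ∈ Z)).card = m * Z.card := by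
  simp only [Finset.card_filter]
  rw [Finset.sum_comm]
  simp only [sum_update i _ (fun g => if g ∈ Z then 1 else 0)]
  rw [← Finset.mul_sum, ← sum_eq_sum_layer i (fun g => if g ∈ Z then 1 else 0)]
  simp

/-- The positions of the other end of a translated pair where exactly one edge is present. -/
def unmatched (E : Finset (Fin r → Fin m)) (s : Fin r) (a w : Fin m) : Finset (Fin r → Fin m) :=
  solo E s w a ∪ (solo E s a w).image (fun h => Function.update h s w)

lemma card_unmatched_le (E : Finset (Fin r → Fin m)) (s : Fin r) (a w : Fin m) :
    (unmatched E s a w).card ≤ usolo E s a w := by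
  unfold unmatched usolo
  refine (Finset.card_union_le _ _).trans ?_
  have := Finset.card_image_le (s := solo E s a w) (f := fun h => Function.update h s w)
  omega

lemma le_card_full_config {E : Finset (Fin r → Fin m)} {s : Fin r} {a w : Fin m} {d u : ℕ}
    (hd : 2 * d ≤ m ^ (r - 1)) (h1 : 7 * d ≤ 8 * vdeg E s w) (h2 : 8 * vdeg E s w ≤ 9 * d)
    (hu : usolo E s a w ≤ u) (hud : 16 * r * u ≤ d) :
    m * d ≤ 4 * ∑ α ∈ layer s w, ∑ i ∈ Finset.univ.erase s,
      (Finset.univ.filter (fun c => α ∈ E ∧ Function.update α s a ∈ E ∧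
        Function.update α i c ∉ E ∧
        Function.update (Function.update α s a) i c ∉ E)).card := by
  set D := duo E s w a with hD
  have hDl : D ⊆ layer s w := fun h hh => mem_layer.2 (mem_duo.1 hh).2.1
  have hiso := layer_isoperimetry hDl
  have hDc := card_solo_add_card_duo E s w a
  rw [← hD] at hDc
  have hr : 1 ≤ r := s.pos
  have hud' : 16 * u ≤ d := le_trans (by nlinarith) hud
  have hs : (solo E s w a).card ≤ u := le_trans (by unfold usolo; omega) hu
  have hD1 : 3 * d ≤ 4 * D.card := by omega
  have hD2 : 7 * m ^ (r - 1) ≤ 16 * (m ^ (r - 1) - D.card) := by omega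
  set bd := ∑ h ∈ D, ∑ i ∈ Finset.univ.erase s,
    (Finset.univ.filter (fun c => Function.update h i c ∉ D)).card with hbd
  have hbd1 : 21 * (m * d) ≤ 64 * bd := by
    rcases Nat.eq_zero_or_pos (m ^ (r - 1)) with h0 | h0
    · have : d = 0 := by omega
      simp [this]
    refine le_of_mul_le_mul_left ?_ h0
    calc m ^ (r - 1) * (21 * (m * d)) = m * ((3 * d) * (7 * m ^ (r - 1))) := by ring
      _ ≤ m * ((4 * D.card) * (16 * (m ^ (r - 1) - D.card))) := by gcongr
      _ = 64 * (m * (D.card * (m ^ (r - 1) - D.card))) := by ring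
      _ ≤ 64 * (m ^ (r - 1) * bd) := by gcongr
      _ = m ^ (r - 1) * (64 * bd) := by ring
  set Z := unmatched E s a w with hZ
  have hZc : Z.card ≤ u := (card_unmatched_le E s a w).trans hu
  have hsplit : bd ≤ (∑ α ∈ layer s w, ∑ i ∈ Finset.univ.erase s,
      (Finset.univ.filter (fun c => α ∈ E ∧ Function.update α s a ∈ E ∧
        Function.update α i c ∉ E ∧
        Function.update (Function.update α s a) i c ∉ E)).card) + r * (m * u) := by
    have hpt : ∀ h ∈ D, ∀ i ∈ Finset.univ.erase s,
        (Finset.univ.filter (fun c => Function.update h i c ∉ D)).card ≤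
        (Finset.univ.filter (fun c => h ∈ E ∧ Function.update h s a ∈ E ∧
        Function.update h i c ∉ E ∧
        Function.update (Function.update h s a) i c ∉ E)).card +
        (Finset.univ.filter (fun c => Function.update h i c ∈ Z)).card := by
      intro h hh i hi
      have his := Finset.ne_of_mem_erase hi
      obtain ⟨k1, k2, k3⟩ := mem_duo.1 hh
      refine (Finset.card_le_card ?_).trans (Finset.card_union_le _ _)
      intro c hc
      simp only [Finset.mem_union, Finset.mem_filter, Finset.mem_univ, true_and, hD, mem_duo] at hc ⊢
      have hgs : Function.update h i c s = w := by rw [Function.update_of_ne his.symm, k2]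
      have hcm : Function.update (Function.update h i c) s a =
        Function.update (Function.update h s a) i c := Function.update_comm his ..
      rw [hcm] at hc
      by_cases q1 : Function.update h i c ∈ E
      · right
        refine Finset.mem_union_left _ (mem_solo.2 ⟨q1, hgs, ?_⟩)
        rw [hcm]; tauto
      · by_cases q2 : Function.update (Function.update h s a) i c ∈ E
        · right
          refine Finset.mem_union_right _ (Finset.mem_image.2 ⟨_, mem_solo.2 ⟨q2, ?_, ?_⟩, ?_⟩)
          · rw [Function.update_of_ne his.symm, Function.update_self]
          · rw [← hcm, update_update_self a hgs]; exact q1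
          · rw [← hcm, update_update_self a hgs]
        · exact Or.inl ⟨k1, k3, q1, q2⟩
    calc bd ≤ ∑ h ∈ D, ∑ i ∈ Finset.univ.erase s, ((Finset.univ.filter (fun c => h ∈ E ∧
        Function.update h s a ∈ E ∧ Function.update h i c ∉ E ∧
        Function.update (Function.update h s a) i c ∉ E)).card +
        (Finset.univ.filter (fun c => Function.update h i c ∈ Z)).card) :=
          Finset.sum_le_sum fun h hh => Finset.sum_le_sum fun i hi => hpt h hh i hi
      _ = (∑ h ∈ D, ∑ i ∈ Finset.univ.erase s, (Finset.univ.filter (fun c => h ∈ E ∧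
        Function.update h s a ∈ E ∧ Function.update h i c ∉ E ∧
        Function.update (Function.update h s a) i c ∉ E)).card) +
        ∑ h ∈ D, ∑ i ∈ Finset.univ.erase s,
          (Finset.univ.filter (fun c => Function.update h i c ∈ Z)).card := by
          simp only [Finset.sum_add_distrib]
      _ ≤ _ := by
          refine Nat.add_le_add (Finset.sum_le_sum_of_subset hDl) ?_
          calc _ ≤ ∑ h, ∑ i, (Finset.univ.filter (fun c => Function.update h i c ∈ Z)).card := by
                refine (Finset.sum_le_sum_of_subset (Finset.subset_univ D)).trans ?_
                exact Finset.sum_le_sum fun h _ =>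
                  Finset.sum_le_sum_of_subset (Finset.erase_subset _ _)
            _ = r * (m * Z.card) := by
                rw [Finset.sum_comm]
                simp [sum_card_filter_update]
            _ ≤ _ := by gcongr
  have : 64 * (r * (m * u)) ≤ 4 * (m * d) := by
    calc 64 * (r * (m * u)) = 4 * (m * (16 * r * u)) := by ring
      _ ≤ _ := by gcongr
  omega

lemma sum_card_filter_comm {ι κ : Type*} (A : Finset ι) (B : Finset κ) (R : ι → κ → Prop)
    [∀ i, DecidablePred (R i)] [∀ k, DecidablePred (fun i => R i k)] :
    ∑ i ∈ A, (B.filter (R i)).card = ∑ k ∈ B, (A.filter (fun i => R i k)).card := by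
  simp only [Finset.card_filter]
  rw [Finset.sum_comm]

lemma sum_card_half_le (S : Finset (Fin r)) (y : Fin r → Fin m → ℕ) (s : Fin r) (a w : Fin m)
    (u : ℕ) :
    ∑ α ∈ layer s w, ∑ i ∈ Finset.univ.erase s, ∑ c, (half S y s a w u α i c).card ≤
      (few S y s a w u).card * (u * (r * m)) := by
  have h1 : ∀ α i c, (half S y s a w u α i c).card ≤
      ((few S y s a w u).filter (fun E => α ∉ E ∧ Function.update α s a ∈ E)).card := by
    intro α i c
    refine Finset.card_le_card fun E hE => ?_
    simp only [half, few, Finset.mem_filter] at hE ⊢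
    tauto
  calc _ ≤ ∑ α ∈ layer s w, ∑ i : Fin r, ∑ c : Fin m,
        ((few S y s a w u).filter (fun E => α ∉ E ∧ Function.update α s a ∈ E)).card := by
        refine Finset.sum_le_sum fun α _ => ?_
        refine (Finset.sum_le_sum_of_subset (Finset.erase_subset _ _)).trans ?_
        exact Finset.sum_le_sum fun i _ => Finset.sum_le_sum fun c _ => h1 α i c
    _ = (∑ α ∈ layer s w,
        ((few S y s a w u).filter (fun E => α ∉ E ∧ Function.update α s a ∈ E)).card) *
          (r * m) := by
        simp only [Finset.sum_const, Finset.card_univ, Fintype.card_fin, smul_eq_mul]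
        rw [Finset.sum_mul]
        exact Finset.sum_congr rfl fun _ _ => by ring
    _ ≤ ((few S y s a w u).card * u) * (r * m) := by
        refine Nat.mul_le_mul_right _ ?_
        rw [sum_card_filter_comm, ← smul_eq_mul, ← Finset.sum_const]
        refine Finset.sum_le_sum fun E hE => ?_
        have hE' := (Finset.mem_filter.1 hE).2
        refine le_trans ?_ (le_trans (Nat.le_add_right _ _ : (solo E s a w).card ≤ _) hE')
        refine Finset.card_le_card_of_injOn (fun α => Function.update α s a) ?_ ?_
        · intro α hα
          simp only [Finset.coe_filter, Set.mem_ofPred_eq, mem_layer] at hα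
          simp only [Finset.mem_coe, mem_solo, Function.update_self, true_and]
          rw [update_update_self a hα.1]
          tauto
        · intro α hα β hβ h
          simp only [Finset.coe_filter, Set.mem_ofPred_eq, mem_layer] at hα hβ
          exact update_injOn a hα.1 hβ.1 h
    _ = _ := by ring

lemma card_few_le {S : Finset (Fin r)} {y : Fin r → Fin m → ℕ} {s : Fin r} (hs : s ∈ S)
    {a w : Fin m} (haw : a ≠ w) {d u B : ℕ} (hd : 2 * d ≤ m ^ (r - 1)) (h1 : 7 * d ≤ 8 * y s w)
    (h2 : 8 * y s w ≤ 9 * d) (hu : 16 * r * u ≤ d)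
    (hB : ∀ i, i ≠ s → ∀ p q, p ≠ q → (lopsided S y i p q).card ≤ B) :
    d * (few S y s a w u).card ≤
      8 * r * (u + 8) * (few S y s a w (u + 8)).card + 4 * r * m ^ (r - 1) * B := by
  have hfull : ∀ α ∈ layer s w, ∀ i ∈ Finset.univ.erase s, ∀ c,
      (full S y s a w u α i c).card ≤ 2 * (half S y s a w (u + 8) α i c).card + B := by
    intro α hα i hi c
    have his := Finset.ne_of_mem_erase hi
    by_cases hc : c = α i
    · have : full S y s a w u α i c = ∅ := by
        unfold full
        refine Finset.filter_eq_empty_iff.2 fun E _ => ?_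
        rw [hc, Function.update_eq_self]
        tauto
      rw [this]; simp
    · exact (card_full_le his haw (mem_layer.1 hα) hc u).trans
        (Nat.add_le_add_left (hB i his _ _ (Ne.symm hc)) _)
  have hsum : (few S y s a w u).card * (m * d) ≤
      4 * ∑ α ∈ layer s w, ∑ i ∈ Finset.univ.erase s, ∑ c, (full S y s a w u α i c).card := by
    have : ∑ α ∈ layer s w, ∑ i ∈ Finset.univ.erase s, ∑ c, (full S y s a w u α i c).card =
        ∑ E ∈ few S y s a w u, ∑ α ∈ layer s w, ∑ i ∈ Finset.univ.erase s,
          (Finset.univ.filter (fun c => α ∈ E ∧ Function.update α s a ∈ E ∧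
          Function.update α i c ∉ E ∧
          Function.update (Function.update α s a) i c ∉ E)).card := by
      symm
      rw [Finset.sum_comm]
      refine Finset.sum_congr rfl fun α _ => ?_
      rw [Finset.sum_comm]
      refine Finset.sum_congr rfl fun i _ => ?_
      rw [sum_card_filter_comm]
      refine Finset.sum_congr rfl fun c _ => ?_
      unfold full few
      rw [Finset.filter_filter]
    rw [this, Finset.mul_sum, ← smul_eq_mul, ← Finset.sum_const]
    refine Finset.sum_le_sum fun E hE => ?_
    have hE' := Finset.mem_filter.1 hE
    have hy := mem_fam.1 hE'.1 s hs w
    exact le_card_full_config hd (hy ▸ h1) (hy ▸ h2) hE'.2 hu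
  have hsum2 : ∑ α ∈ layer s w, ∑ i ∈ Finset.univ.erase s, ∑ c, (full S y s a w u α i c).card ≤
      2 * ((few S y s a w (u + 8)).card * ((u + 8) * (r * m))) + m ^ (r - 1) * (r * (m * B)) := by
    refine (Finset.sum_le_sum fun α hα => Finset.sum_le_sum fun i hi => Finset.sum_le_sum
      fun c _ => hfull α hα i hi c).trans ?_
    simp only [Finset.sum_add_distrib, ← Finset.mul_sum]
    refine Nat.add_le_add (Nat.mul_le_mul_left _ (sum_card_half_le S y s a w (u + 8))) ?_
    simp only [Finset.sum_const, Finset.card_univ, Fintype.card_fin, smul_eq_mul, card_layer]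
    gcongr
    exact (Finset.card_le_univ _).trans (by simp)
  refine le_of_mul_le_mul_left ?_ w.pos
  calc m * (d * (few S y s a w u).card) = (few S y s a w u).card * (m * d) := by ring
    _ ≤ _ := hsum
    _ ≤ 4 * (2 * ((few S y s a w (u + 8)).card * ((u + 8) * (r * m))) +
        m ^ (r - 1) * (r * (m * B))) := by gcongr
    _ = _ := by ring

end

section

variable {r m : ℕ}

/-- All prescribed classes are `d`-regular, except for the class `t` whose degrees are close
to `d`. -/
structure NearReg (S : Finset (Fin r)) (y : Fin r → Fin m → ℕ) (t : Fin r) (d : ℕ) : Prop where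
  mem : t ∈ S
  reg : ∀ s ∈ S, s ≠ t → ∀ v, y s v = d
  lower : ∀ v, 192 * r * d ≤ 192 * r * y t v + d
  upper : ∀ v, 192 * r * y t v ≤ 192 * r * d + d

variable {S : Finset (Fin r)} {y : Fin r → Fin m → ℕ} {s t : Fin r} {d : ℕ}

lemma NearReg.bounds (h : NearReg S y t d) {s : Fin r} (hs : s ∈ S) (v : Fin m) :
    7 * d ≤ 8 * y s v ∧ 8 * y s v ≤ 9 * d := by
  by_cases hst : s = t
  · subst hst
    have h1 := h.lower v
    have h2 := h.upper v
    have hr : 1 ≤ r := s.pos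
    have h3 : d ≤ r * d := by nlinarith
    have h4 : r * (191 * d) ≤ r * (192 * y s v) := by nlinarith
    have h5 : r * (192 * y s v) ≤ r * (193 * d) := by nlinarith
    have h6 := le_of_mul_le_mul_left h4 hr
    have h7 := le_of_mul_le_mul_left h5 hr
    omega
  · rw [h.reg s hs hst v]; omega

lemma few_halving (h : NearReg S y t d) (hs : s ∈ S) {a w : Fin m} (haw : a ≠ w)
    (hd0 : 0 < d) (hd : 2 * d ≤ m ^ (r - 1)) {B : ℕ}
    (hB : ∀ i, i ≠ s → ∀ p q, p ≠ q → (lopsided S y i p q).card ≤ B) {u : ℕ}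
    (hu : 16 * r * (u + 8) ≤ d) :
    ((few S y s a w u).card : ℝ) ≤ (few S y s a w (u + 8)).card / 2 +
      4 * r * m ^ (r - 1) * B / d := by
  have h1 := card_few_le hs haw hd (h.bounds hs w).1 (h.bounds hs w).2 (u := u) (by nlinarith) hB
  have h2 : (d : ℝ) * (few S y s a w u).card ≤
      8 * r * (u + 8) * (few S y s a w (u + 8)).card + 4 * r * m ^ (r - 1) * B := by
    exact_mod_cast h1
  have h3 : (16 * r * (u + 8) : ℝ) ≤ d := by exact_mod_cast hu
  have hd0' : (0 : ℝ) < d := by exact_mod_cast hd0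
  have h4 : (8 * r * (u + 8) : ℝ) * (few S y s a w (u + 8)).card ≤
      d / 2 * (few S y s a w (u + 8)).card := by
    gcongr; linarith
  have h5 : (d : ℝ) * (few S y s a w u).card ≤
      d * ((few S y s a w (u + 8)).card / 2 + 4 * r * m ^ (r - 1) * B / d) := by
    have : (d : ℝ) * (4 * r * m ^ (r - 1) * B / d) = 4 * r * m ^ (r - 1) * B := by field_simp
    rw [mul_add, this]; linarith
  exact le_of_mul_le_mul_left h5 hd0'

lemma few_iterate (h : NearReg S y t d) (hs : s ∈ S) {a w : Fin m} (haw : a ≠ w)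
    (hd0 : 0 < d) (hd : 2 * d ≤ m ^ (r - 1)) {B : ℕ}
    (hB : ∀ i, i ≠ s → ∀ p q, p ≠ q → (lopsided S y i p q).card ≤ B) (j : ℕ) :
    ∀ u, 16 * r * (u + 8 * j) ≤ d → ((few S y s a w u).card : ℝ) ≤
      (fam S y).card / 2 ^ j + 8 * r * m ^ (r - 1) * B / d := by
  induction j with
  | zero =>
    intro u _
    have h1 : (few S y s a w u).card ≤ (fam S y).card := Finset.card_filter_le _ _
    have h2 : (0 : ℝ) ≤ 8 * r * m ^ (r - 1) * B / d := by positivity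
    have h3 : ((few S y s a w u).card : ℝ) ≤ (fam S y).card := by exact_mod_cast h1
    simp only [pow_zero, div_one]
    linarith
  | succ j ih =>
    intro u hu
    have h1 := few_halving h hs haw hd0 hd hB (u := u) (by nlinarith)
    have h2 := ih (u + 8) (by nlinarith)
    have h3 : ((fam S y).card : ℝ) / 2 ^ (j + 1) = (fam S y).card / 2 ^ j / 2 := by
      rw [pow_succ, div_div]
    have h4 : (8 * r * m ^ (r - 1) * B / d : ℝ) = 2 * (4 * r * m ^ (r - 1) * B / d) := by ring
    rw [h3]
    linarith

lemma NearReg.card_solo_eq (h : NearReg S y t d) (hs : s ∈ S) (hst : s ≠ t) (p q : Fin m)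
    {E : Finset (Fin r → Fin m)} (hE : E ∈ fam S y) :
    (solo E s p q).card = (solo E s q p).card := by
  have h1 := card_solo_add_vdeg E s p q
  rw [mem_fam] at hE
  rw [hE s hs p, hE s hs q, h.reg s hs hst, h.reg s hs hst] at h1
  omega

lemma NearReg.lopsided_eq_empty (h : NearReg S y t d) {i : Fin r} (hi : i ≠ t) (p q : Fin m) :
    lopsided S y i p q = ∅ := by
  refine Finset.filter_eq_empty_iff.2 fun E hE hc => ?_
  have := h.card_solo_eq hc.1 hi p q hE
  omega

lemma NearReg.lopsided_subset (h : NearReg S y t d) (p q : Fin m) :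
    lopsided S y t p q ⊆ few S y t p q (d / (32 * r)) := by
  intro E hE
  have hr : 1 ≤ r := t.pos
  simp only [lopsided, few, Finset.mem_filter] at hE ⊢
  obtain ⟨hE, -, hc⟩ := hE
  refine ⟨hE, ?_⟩
  have h1 := card_solo_add_vdeg E t p q
  rw [mem_fam] at hE
  rw [hE t h.mem p, hE t h.mem q] at h1
  have h2 := h.lower q
  have h3 := h.upper p
  rw [Nat.le_div_iff_mul_le (by omega)]
  unfold usolo
  set A := (solo E t p q).card
  set B := (solo E t q p).card
  have h4 : r * (A + B + 3 * y t q) ≤ r * (3 * y t p) := Nat.mul_le_mul_left _ (by omega)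
  nlinarith

lemma NearReg.card_few_self_le (h : NearReg S y t d) {a w : Fin m} (haw : a ≠ w)
    (hd0 : 0 < d) (hd : 2 * d ≤ m ^ (r - 1)) :
    ((few S y t a w (d / (32 * r))).card : ℝ) ≤ (fam S y).card / 2 ^ (d / (256 * r)) := by
  have h1 := few_iterate h h.mem haw hd0 hd (B := 0)
    (fun i hi p q _ => by rw [h.lopsided_eq_empty hi]; simp) (d / (256 * r)) (d / (32 * r)) (by
      have h1 := Nat.div_mul_le_self d (32 * r)
      have h2 := Nat.div_mul_le_self d (256 * r)
      nlinarith)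
  simpa using h1

/-- In a regular class there are many unmatched edges for all but a tiny fraction of the family. -/
lemma NearReg.card_solo_lt_le (h : NearReg S y t d) (hs : s ∈ S) (hst : s ≠ t) {a w : Fin m}
    (haw : a ≠ w) (hd0 : 0 < d) (hrd : r ≤ d) (hd : 2 * d ≤ m ^ (r - 1)) :
    (((fam S y).filter (fun E => ((solo E s a w).card : ℝ) < d / (64 * r))).card : ℝ) ≤
      9 * m ^ (r - 1) * (fam S y).card / 2 ^ (d / (256 * r)) := by
  set j := d / (256 * r) with hj
  have hr : 1 ≤ r := t.pos
  have hsub : (fam S y).filter (fun E => ((solo E s a w).card : ℝ) < d / (64 * r)) ⊆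
      few S y s a w (d / (32 * r)) := by
    intro E hE
    simp only [few, Finset.mem_filter] at hE ⊢
    refine ⟨hE.1, ?_⟩
    have h1 := h.card_solo_eq hs hst a w hE.1
    have h2 := hE.2
    rw [lt_div_iff₀ (by positivity)] at h2
    have h3 : (solo E s a w).card * (64 * r) < d := by exact_mod_cast h2
    rw [Nat.le_div_iff_mul_le (by omega)]
    unfold usolo
    nlinarith
  have hB : ∀ i, i ≠ s → ∀ p q, p ≠ q → (lopsided S y i p q).card ≤ (fam S y).card / 2 ^ j := by
    intro i _ p q hpq
    by_cases hi : i = t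
    · subst hi
      have h1 := h.card_few_self_le hpq hd0 hd
      have h2 := Finset.card_le_card (h.lopsided_subset p q)
      rw [Nat.le_div_iff_mul_le (by positivity)]
      rw [le_div_iff₀ (by positivity)] at h1
      have h3 : (few S y i p q (d / (32 * r))).card * 2 ^ j ≤ (fam S y).card := by exact_mod_cast h1
      exact (Nat.mul_le_mul_right _ h2).trans h3
    · rw [h.lopsided_eq_empty hi]; simp
  have h1 := few_iterate h hs haw hd0 hd hB j (d / (32 * r)) (by
      have h1 := Nat.div_mul_le_self d (32 * r)
      have h2 := Nat.div_mul_le_self d (256 * r)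
      nlinarith)
  have h2 : (((fam S y).filter (fun E => ((solo E s a w).card : ℝ) < d / (64 * r))).card : ℝ) ≤
      (few S y s a w (d / (32 * r))).card := by exact_mod_cast Finset.card_le_card hsub
  have h3 : (((fam S y).card / 2 ^ j : ℕ) : ℝ) ≤ (fam S y).card / 2 ^ j := by
    simpa using Nat.cast_div_le (α := ℝ) (m := (fam S y).card) (n := 2 ^ j)
  have hd0' : (0 : ℝ) < d := by exact_mod_cast hd0
  have hrd' : (r : ℝ) ≤ d := by exact_mod_cast hrd
  have hm : (1 : ℝ) ≤ (m : ℝ) ^ (r - 1) := by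
    have : 1 ≤ m ^ (r - 1) := Nat.one_le_pow _ _ a.pos
    exact_mod_cast this
  set K : ℝ := (fam S y).card / 2 ^ j with hK
  have hK0 : 0 ≤ K := by positivity
  calc _ ≤ _ := h2
    _ ≤ _ := h1
    _ ≤ m ^ (r - 1) * K + 8 * d * m ^ (r - 1) * K / d := by
        refine add_le_add ?_ ?_
        · nlinarith
        · gcongr
    _ = 9 * m ^ (r - 1) * (fam S y).card / 2 ^ j := by
        rw [hK]; field_simp; ring

end

section

variable {r m : ℕ} {S : Finset (Fin r)} {y : Fin r → Fin m → ℕ} {s t : Fin r} {d : ℕ}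

lemma abs_sub_le_of_coordinate (φ : (Fin r → Fin m) → ℝ) {t : Fin r} {u : Fin m} {κ : ℝ}
    (hκ : 0 ≤ κ)
    (h : ∀ α, α t = u → ∀ s, s ≠ t → ∀ a, |φ α - φ (Function.update α s a)| ≤ κ)
    {e f : Fin r → Fin m} (he : e t = u) (hf : f t = u) : |φ e - φ f| ≤ r * κ := by
  have h1 : ∀ k : ℕ, k ≤ r → |φ e - φ (hyb k e f)| ≤ k * κ := by
    intro k
    induction k with
    | zero => intro _; rw [show hyb 0 e f = e from by ext; simp [hyb]]; simp
    | succ k ih =>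
      intro hk
      have h2 := hyb_succ ⟨k, hk⟩ e f
      simp only at h2
      have ht : hyb k e f t = u := by unfold hyb; split_ifs <;> assumption
      have h3 : |φ (hyb k e f) - φ (hyb (k + 1) e f)| ≤ κ := by
        rw [h2]
        by_cases hkt : (⟨k, hk⟩ : Fin r) = t
        · rw [hkt, hf, ← ht, Function.update_eq_self]; simpa using hκ
        · exact h _ ht _ hkt _
      have h4 := abs_sub_le (φ e) (φ (hyb k e f)) (φ (hyb (k + 1) e f))
      have h5 := ih (by omega)
      push_cast
      linarith
  have h2 := h1 r le_rfl
  rwa [show hyb r e f = f from by ext; simp [hyb]] at h2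

lemma sum_card_duo (Ω : Finset (Finset (Fin r → Fin m))) (t : Fin r) (u v : Fin m) :
    ∑ E ∈ Ω, (duo E t v u).card = ∑ e ∈ layer t v, pc Ω e (Function.update e t u) := by
  unfold pc
  rw [← sum_card_filter_comm]
  refine Finset.sum_congr rfl fun E _ => congrArg _ ?_
  ext e
  simp only [mem_duo, Finset.mem_filter, mem_layer]
  tauto

lemma sum_pc (S : Finset (Fin r)) (y : Fin r → Fin m → ℕ) {t : Fin r} (ht : t ∈ S) (u v : Fin m) :
    ∑ e ∈ layer t v, ∑ f ∈ layer t u, pc (fam S y) e f = (fam S y).card * (y t v * y t u) := by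
  have h1 : ∀ E ∈ fam S y, ∀ w, ((layer t w).filter (fun e => e ∈ E)).card = y t w := by
    intro E hE w
    rw [← mem_fam.1 hE t ht w]
    unfold vdeg layer
    congr 1
    ext; simp [and_comm]
  have h2 : ∀ e, ∑ f ∈ layer t u, pc (fam S y) e f =
      ∑ E ∈ fam S y, ((layer t u).filter (fun f => e ∈ E ∧ f ∈ E)).card := fun e =>
    (sum_card_filter_comm _ _ (fun E f => e ∈ E ∧ f ∈ E)).symm
  simp only [h2]
  rw [Finset.sum_comm, ← smul_eq_mul, ← Finset.sum_const]
  refine Finset.sum_congr rfl fun E hE => ?_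
  rw [← h1 E hE v, ← h1 E hE u, ← smul_eq_mul, ← Finset.sum_const, Finset.sum_filter]
  refine Finset.sum_congr rfl fun e _ => ?_
  split_ifs with h <;> simp [h]

/-- Bound on the deviation of the mean number of matched edges at two vertices. -/
noncomputable def devBound (r m d : ℕ) : ℝ :=
  512 * r ^ 2 * d / m ^ (r - 1) + 18 * r * (m ^ (r - 1)) ^ 2 / 2 ^ (d / (256 * r))

set_option maxHeartbeats 1000000 in
lemma NearReg.abs_sum_card_duo_sub_le (h : NearReg S y t d) {u v : Fin m} (huv : u ≠ v)
    (hrd : 512 * r ^ 2 ≤ d) (hd : 2 * d ≤ m ^ (r - 1)) :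
    |((∑ E ∈ fam S y, (duo E t v u).card : ℕ) : ℝ) -
      (fam S y).card * (y t v * y t u / m ^ (r - 1))| ≤ (fam S y).card * devBound r m d := by
  have hr : 1 ≤ r := t.pos
  have hd0 : 0 < d := lt_of_lt_of_le (by positivity) hrd
  have hrd' : r ≤ d := le_trans (by nlinarith) hrd
  have hd0' : (0 : ℝ) < d := by exact_mod_cast hd0
  have hr' : (1 : ℝ) ≤ r := by exact_mod_cast hr
  have hrd2 : (512 * r ^ 2 : ℝ) ≤ d := by exact_mod_cast hrd
  set n : ℝ := (m : ℝ) ^ (r - 1) with hn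
  have hn0 : 0 < n := by have := u.pos; positivity
  have hcard : ∀ w : Fin m, ((layer t w).card : ℝ) = n := by
    intro w; rw [card_layer]; push_cast; rfl
  set Ω := fam S y with hΩ
  set N : ℝ := (Ω.card : ℝ) with hN
  set z : ℝ := d / (64 * r) with hz
  have hz0 : 0 < z := by positivity
  set T : ℝ := 9 * n * N / 2 ^ (d / (256 * r)) with hT
  have hT0 : 0 ≤ T := by positivity
  have hne : ∀ {e f : Fin r → Fin m}, e t = v → f t = u → e ≠ f := by
    intro e f he hf hef
    exact huv (by rw [← hf, ← hef, he])
  obtain ⟨p, hp, hmax⟩ := Finset.exists_max_image (layer t v ×ˢ layer t u)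
    (fun p => pc Ω p.1 p.2) ⟨(fun _ => v, fun _ => u), by simp [mem_layer]⟩
  rw [Finset.mem_product, mem_layer, mem_layer] at hp
  set M : ℝ := (pc Ω p.1 p.2 : ℝ) with hM
  have hM0 : 0 ≤ M := by positivity
  have hle : ∀ {e f : Fin r → Fin m}, e t = v → f t = u → (pc Ω e f : ℝ) ≤ M := by
    intro e f he hf
    exact Nat.cast_le.2 (hmax (e, f) (by simp [mem_layer, he, hf]))
  set κ : ℝ := 2 * M / z + T with hκ
  have hκ0 : 0 ≤ κ := by positivity
  have hstep : ∀ {γ α : Fin r → Fin m} (s : Fin r), s ≠ t → ∀ a : Fin m, γ ≠ α →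
      γ ≠ Function.update α s a → (pc Ω γ α : ℝ) ≤ M → (pc Ω γ (Function.update α s a) : ℝ) ≤ M →
      |(pc Ω γ α : ℝ) - pc Ω γ (Function.update α s a)| ≤ κ := by
    intro γ α s hst a h1 h2 h3 h4
    by_cases ha : a = α s
    · rw [ha, Function.update_eq_self]; simpa using hκ0
    by_cases hs : s ∈ S
    · refine (abs_pc_sub_pc_le hs ha (by rw [h.reg s hs hst, h.reg s hs hst]) rfl rfl h1 h2
        hz0).trans ?_
      refine add_le_add ?_ (h.card_solo_lt_le hs hst ha hd0 hrd' hd)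
      gcongr
      linarith
    · rw [hΩ, pc_eq_of_notMem hs ha rfl rfl h1 h2, sub_self, abs_zero]; exact hκ0
  have hright : ∀ {e f g : Fin r → Fin m}, e t = v → f t = u → g t = u →
      |(pc Ω e f : ℝ) - pc Ω e g| ≤ r * κ := by
    intro e f g he hf hg
    refine abs_sub_le_of_coordinate (fun x => (pc Ω e x : ℝ)) hκ0 ?_ hf hg
    intro α hα s hst a
    have hα' : Function.update α s a t = u := by rw [Function.update_of_ne hst.symm, hα]
    exact hstep s hst a (hne he hα) (hne he hα') (hle he hα) (hle he hα')
  have hleft : ∀ {e f g : Fin r → Fin m}, e t = v → f t = v → g t = u →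
      |(pc Ω e g : ℝ) - pc Ω f g| ≤ r * κ := by
    intro e f g he hf hg
    refine abs_sub_le_of_coordinate (fun x => (pc Ω x g : ℝ)) hκ0 ?_ he hf
    intro α hα s hst a
    have hα' : Function.update α s a t = v := by rw [Function.update_of_ne hst.symm, hα]
    have h1 := hle hα hg
    have h2 := hle hα' hg
    rw [pc_comm] at h1 h2
    rw [pc_comm Ω α, pc_comm Ω _ g]
    exact hstep s hst a (hne hα hg).symm (hne hα' hg).symm h1 h2
  have hsum : ∑ e ∈ layer t v, ∑ f ∈ layer t u, (pc Ω e f : ℝ) = N * (y t v * y t u) := by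
    rw [hN, hΩ]
    exact_mod_cast sum_pc S y h.mem u v
  have hMle : M * n ^ 2 ≤ N * (y t v * y t u) + 2 * r * κ * n ^ 2 := by
    have h1 : ∑ e ∈ layer t v, ∑ f ∈ layer t u, (M - 2 * r * κ) ≤
        ∑ e ∈ layer t v, ∑ f ∈ layer t u, (pc Ω e f : ℝ) := by
      refine Finset.sum_le_sum fun e he => Finset.sum_le_sum fun f hf => ?_
      rw [mem_layer] at he hf
      have h1 := hright hp.1 hp.2 hf
      have h2 := hleft hp.1 he hf
      rw [abs_le] at h1 h2
      linarith [h1.2, h2.2]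
    rw [hsum] at h1
    simp only [Finset.sum_const, nsmul_eq_mul, hcard] at h1
    nlinarith
  have hbd : ∀ w, (y t w : ℝ) ≤ 9 / 8 * d := by
    intro w
    have h1 : (8 * y t w : ℝ) ≤ 9 * d := by exact_mod_cast (h.bounds h.mem w).2
    linarith
  have hxx : (y t v * y t u : ℝ) ≤ 2 * d ^ 2 := by
    calc (y t v * y t u : ℝ) ≤ (9 / 8 * d) * (9 / 8 * d) := by gcongr <;> exact hbd _
      _ ≤ 2 * d ^ 2 := by nlinarith
  have hzi : 1 / z = 64 * r / d := by rw [hz, one_div_div]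
  have hκ' : κ = M * (128 * r / d) + T := by
    rw [hκ]
    have : 2 * M / z = 2 * M * (1 / z) := by ring
    rw [this, hzi]; ring
  have hrr : r * (r / d : ℝ) ≤ 1 / 512 := by
    rw [mul_div_assoc', div_le_div_iff₀ hd0' (by norm_num)]; linarith
  have hM2 : M * n ^ 2 ≤ 4 * N * d ^ 2 + 4 * r * T * n ^ 2 := by
    have h1 : 2 * r * κ * n ^ 2 = 256 * (M * n ^ 2) * (r * (r / d)) + 2 * r * T * n ^ 2 := by
      rw [hκ']; ring
    have h2 : 256 * (M * n ^ 2) * (r * (r / d)) ≤ 256 * (M * n ^ 2) * (1 / 512) := by gcongr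
    have h3 : N * (y t v * y t u) ≤ N * (2 * d ^ 2) := by gcongr
    linarith
  have hκ2 : r * κ * n ^ 2 ≤ 512 * r ^ 2 * N * d + 2 * r * T * n ^ 2 := by
    have h1 : r * κ * n ^ 2 = (M * n ^ 2) * (128 * r * (r / d)) + r * T * n ^ 2 := by
      rw [hκ']; ring
    have h2 : (M * n ^ 2) * (128 * r * (r / d : ℝ)) ≤
        (4 * N * d ^ 2 + 4 * r * T * n ^ 2) * (128 * r * (r / d)) := by gcongr
    have h3 : (4 * N * d ^ 2 : ℝ) * (128 * r * (r / d)) = 512 * r ^ 2 * N * d := by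
      field_simp; ring
    have h4 : (4 * r * T * n ^ 2) * (128 * r * (r / d : ℝ)) ≤ r * T * n ^ 2 := by
      calc (4 * r * T * n ^ 2) * (128 * r * (r / d : ℝ)) =
          512 * (r * T * n ^ 2) * (r * (r / d)) := by ring
        _ ≤ 512 * (r * T * n ^ 2) * (1 / 512) := by gcongr
        _ = _ := by ring
    rw [add_mul, h3] at h2
    linarith
  have hfin : |((∑ E ∈ Ω, (duo E t v u).card : ℕ) : ℝ) - N * (y t v * y t u / n)| ≤ n * (r * κ) := by
    rw [sum_card_duo]
    have h1 : N * (y t v * y t u / n) =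
        ∑ e ∈ layer t v, (∑ f ∈ layer t u, (pc Ω e f : ℝ)) / n := by
      rw [← Finset.sum_div, hsum]; ring
    push_cast
    rw [h1, ← Finset.sum_sub_distrib]
    refine (Finset.abs_sum_le_sum_abs _ _).trans ?_
    have hc : ∀ w : Fin m, n * (r * κ) = ∑ _e ∈ layer t w, r * κ := fun w => by
      rw [Finset.sum_const, nsmul_eq_mul, hcard]
    rw [hc v]
    refine Finset.sum_le_sum fun e he => ?_
    rw [mem_layer] at he
    have h2 : (pc Ω e (Function.update e t u) : ℝ) - (∑ f ∈ layer t u, (pc Ω e f : ℝ)) / n =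
        (∑ f ∈ layer t u, ((pc Ω e (Function.update e t u) : ℝ) - pc Ω e f)) / n := by
      rw [Finset.sum_sub_distrib, Finset.sum_const, nsmul_eq_mul, hcard]
      field_simp
    rw [h2, abs_div, abs_of_pos hn0, div_le_iff₀ hn0]
    refine (Finset.abs_sum_le_sum_abs _ _).trans ?_
    rw [mul_comm, hc u]
    refine Finset.sum_le_sum fun f hf => ?_
    exact hright he (by simp) (mem_layer.1 hf)
  refine hfin.trans ?_
  have h6 : n * (r * κ) = (r * κ * n ^ 2) / n := by field_simp
  rw [h6, div_le_iff₀ hn0]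
  refine hκ2.trans (le_of_eq ?_)
  unfold devBound
  rw [hT, ← hn]
  field_simp
  ring

end

section

variable {m K d : ℕ} {n Δ : ℝ}

/-- A degree vector all of whose entries are within `d / K` of `d`. -/
def Near (K d : ℕ) (x : Fin m → ℕ) : Prop := ∀ w, K * d ≤ K * x w + d ∧ K * x w ≤ K * d + d

/-- A function of degree vectors whose change under moving one unit from `v` to `u` is governed by
a symmetric local quantity close to the product of the two degrees. -/
structure Switch (K d : ℕ) (n Δ : ℝ) (N : (Fin m → ℕ) → ℝ)
    (Y : (Fin m → ℕ) → Fin m → Fin m → ℝ) : Prop where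
  nonneg : ∀ x, 0 ≤ N x
  eq : ∀ x x' u v, u ≠ v →
    (∀ z, x' z + (if z = v then 1 else 0) = x z + (if z = u then 1 else 0)) →
    N x * (x v - Y x u v) = N x' * (x' u - Y x' u v)
  close : ∀ x u v, u ≠ v → Near K d x → |Y x u v - x u * x v / n| ≤ Δ

lemma Near.bounds {x : Fin m → ℕ} (h : Near K d x) (hK : 8 ≤ K) (w : Fin m) :
    7 * d ≤ 8 * x w ∧ 8 * x w ≤ 9 * d := by
  obtain ⟨h1, h2⟩ := h w
  constructor
  · have : K * (7 * d) ≤ K * (8 * x w) := by nlinarith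
    exact le_of_mul_le_mul_left this (by omega)
  · have : K * (8 * x w) ≤ K * (9 * d) := by nlinarith
    exact le_of_mul_le_mul_left this (by omega)

lemma Switch.gap {N : (Fin m → ℕ) → ℝ} {Y : (Fin m → ℕ) → Fin m → Fin m → ℝ}
    (hN : Switch K d n Δ N Y) (hK : 8 ≤ K) (hdn : 2 * d ≤ n) (hΔ : 8 * Δ ≤ d) (hd : 0 < d)
    {x : Fin m → ℕ} (hx : Near K d x) {u v : Fin m} (huv : u ≠ v) :
    (d : ℝ) / 4 ≤ x u - Y x u v ∧ (d : ℝ) / 4 ≤ x v - Y x u v := by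
  have h1 := (abs_le.1 (hN.close x u v huv hx)).2
  have hd' : (0 : ℝ) < d := by exact_mod_cast hd
  have hb : ∀ w, (7 * d : ℝ) ≤ 8 * x w ∧ (8 * x w : ℝ) ≤ 9 * d := fun w => by
    exact_mod_cast hx.bounds hK w
  have key : ∀ a b : ℝ, 7 * d ≤ 8 * a → 8 * b ≤ 9 * d → 0 ≤ b →
      a * b / n ≤ 9 / 16 * a := by
    intro a b ha hb hb0
    rw [div_le_iff₀ (by linarith)]
    nlinarith
  have h2 := key (x u) (x v) (hb u).1 (hb v).2 (by positivity)
  have h3 := key (x v) (x u) (hb v).1 (hb u).2 (by positivity)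
  rw [mul_comm] at h3
  have h4 := (hb u).1
  have h5 := (hb v).1
  constructor <;> linarith

lemma div_le_exp_of_sub_le {a b g ε : ℝ} (hg : 0 < g) (hb : g ≤ b) (h : a - b ≤ ε) (hε : 0 ≤ ε) :
    a ≤ Real.exp (ε / g) * b := by
  have h1 : ε / g + 1 ≤ Real.exp (ε / g) := Real.add_one_le_exp _
  have h2 : ε ≤ ε / g * b := by
    rw [div_mul_eq_mul_div, le_div_iff₀ hg]
    nlinarith
  have : (ε / g + 1) * b ≤ Real.exp (ε / g) * b := by
    apply mul_le_mul_of_nonneg_right h1; linarith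
  nlinarith

/-- The squared distance of a degree vector from the constant `d`. -/
def devSq (d : ℕ) (x : Fin m → ℕ) : ℤ := ∑ w, ((x w : ℤ) - d) ^ 2

/-- The number of entries different from `d`. -/
def unsettled (d : ℕ) (x : Fin m → ℕ) : ℕ := (Finset.univ.filter (fun w => x w ≠ d)).card

lemma devSq_move {x x' : Fin m → ℕ} {u v : Fin m} (huv : u ≠ v)
    (hx : ∀ z, x' z + (if z = v then 1 else 0) = x z + (if z = u then 1 else 0)) :
    devSq d x = devSq d x' + 2 * (x v - x u) - 2 := by
  unfold devSq
  rw [← Finset.add_sum_erase _ _ (Finset.mem_univ u),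
    ← Finset.add_sum_erase _ _ (Finset.mem_erase.2 ⟨huv.symm, Finset.mem_univ v⟩),
    ← Finset.add_sum_erase _ (fun w => ((x' w : ℤ) - d) ^ 2) (Finset.mem_univ u),
    ← Finset.add_sum_erase _ (fun w => ((x' w : ℤ) - d) ^ 2)
      (Finset.mem_erase.2 ⟨huv.symm, Finset.mem_univ v⟩)]
  have h1 := hx u
  have h2 := hx v
  rw [if_neg huv, if_pos rfl] at h1
  rw [if_pos rfl, if_neg huv.symm] at h2
  have h3 : ∀ w ∈ (Finset.univ.erase u).erase v, ((x w : ℤ) - d) ^ 2 = ((x' w : ℤ) - d) ^ 2 := by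
    intro w hw
    rw [Finset.mem_erase, Finset.mem_erase] at hw
    have h4 := hx w
    rw [if_neg hw.1, if_neg hw.2.1] at h4
    simp only [add_zero] at h4
    rw [h4]
  rw [Finset.sum_congr rfl h3]
  have h5 : (x v : ℤ) = x' v + 1 := by omega
  have h6 : (x' u : ℤ) = x u + 1 := by omega
  rw [h5, h6]
  ring

/-- Comparison of two switch functions. The second conjunct is the statement carried along a
sequence of moves between two fixed vertices. -/
lemma Switch.compare_aux {N N' : (Fin m → ℕ) → ℝ} {Y Y' : (Fin m → ℕ) → Fin m → Fin m → ℝ}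
    (hN : Switch K d n Δ N Y) (hN' : Switch K d n Δ N' Y') (hK : 8 ≤ K) (hdn : 2 * d ≤ n)
    (hΔ0 : 0 ≤ Δ) (hΔ : 8 * Δ ≤ d) (hd : 0 < d) (q : ℕ) :
    ∀ x : Fin m → ℕ, Near K d x → ∑ w, x w = m * d → devSq d x = q →
      N x * N' (fun _ => d) ≤
        Real.exp (16 * Δ / d * unsettled d x + 32 * Δ / d ^ 2 * q) * (N' x * N (fun _ => d)) ∧
      ∀ u v, u ≠ v → x u ≤ d → d ≤ x v →
        N x * (x u - Y x u v) * N' (fun _ => d) ≤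
          Real.exp (16 * Δ / d * (unsettled d x - (if x u < d ∧ d < x v then 1 else 0)) +
            8 * Δ / d + 32 * Δ / d ^ 2 * q) * (N' x * (x u - Y' x u v) * N (fun _ => d)) := by
  have hd' : (0 : ℝ) < d := by exact_mod_cast hd
  induction q using Nat.strong_induction_on with
  | _ q ih =>
  intro x hx hsum hq
  have hA := hN.nonneg (fun _ => d)
  have hA' := hN'.nonneg (fun _ => d)
  have hYY : ∀ u v, u ≠ v → |Y x u v - Y' x u v| ≤ 2 * Δ := by
    intro u v huv
    have h1 := abs_le.1 (hN.close x u v huv hx)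
    have h2 := abs_le.1 (hN'.close x u v huv hx)
    rw [abs_le]
    constructor <;> linarith [h1.1, h1.2, h2.1, h2.2]
  have hconv : ∀ u v, u ≠ v → (x u - Y x u v : ℝ) ≤ Real.exp (8 * Δ / d) * (x u - Y' x u v) ∧
      (x u - Y' x u v : ℝ) ≤ Real.exp (8 * Δ / d) * (x u - Y x u v) := by
    intro u v huv
    have h1 := abs_le.1 (hYY u v huv)
    have h2 := (hN.gap hK hdn hΔ hd hx huv).1
    have h3 := (hN'.gap hK hdn hΔ hd hx huv).1
    have h4 : 8 * Δ / d = 2 * Δ / (d / 4) := by field_simp; ring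
    rw [h4]
    constructor
    · exact div_le_exp_of_sub_le (by positivity) h3 (by linarith [h1.1]) (by positivity)
    · exact div_le_exp_of_sub_le (by positivity) h2 (by linarith [h1.2]) (by positivity)
  have hmove : ∀ u v, u ≠ v → x u < d → d < x v →
        N x * (x u - Y x u v) * N' (fun _ => d) ≤
          Real.exp (16 * Δ / d * (unsettled d x - 1) +
            8 * Δ / d + 32 * Δ / d ^ 2 * q) * (N' x * (x u - Y' x u v) * N (fun _ => d)) := by
    intro u v huv hu hv
    let x' : Fin m → ℕ := fun z => if z = u then x u + 1 else if z = v then x v - 1 else x z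
    have hx'u : x' u = x u + 1 := by simp [x']
    have hx'v : x' v = x v - 1 := by simp [x', huv.symm]
    have hx' : ∀ z, x' z + (if z = v then 1 else 0) = x z + (if z = u then 1 else 0) := by
      intro z
      by_cases h1 : z = u
      · subst h1; simp [x', huv]
      · by_cases h2 : z = v
        · subst h2; simp [x', h1]; omega
        · simp [x', h1, h2]
    have hnear : Near K d x' := by
      intro w
      by_cases h1 : w = u
      · subst h1
        have := hx w
        rw [hx'u]
        constructor <;> nlinarith
      · by_cases h2 : w = v
        · subst h2
          have := hx w
          obtain ⟨k, hk⟩ : ∃ k, x w = d + k + 1 := ⟨x w - d - 1, by omega⟩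
          rw [hx'v, hk]
          rw [hk] at this
          have e1 : d + k + 1 - 1 = d + k := by omega
          rw [e1]
          constructor <;> nlinarith
        · have : x' w = x w := by simp [x', h1, h2]
          rw [this]; exact hx w
    have hsum' : ∑ w, x' w = m * d := by
      have h1 := Finset.sum_congr rfl (fun z (_ : z ∈ Finset.univ) => hx' z)
      rw [Finset.sum_add_distrib, Finset.sum_add_distrib] at h1
      simp at h1
      omega
    have hdev := devSq_move (d := d) huv hx'
    have hdev0 : 0 ≤ devSq d x' := Finset.sum_nonneg fun _ _ => sq_nonneg _
    obtain ⟨q', hq'⟩ := Int.eq_ofNat_of_zero_le hdev0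
    have hqq : q' + (x v - x u) ≤ q := by omega
    have hqlt : q' < q := by omega
    have hih := (ih q' hqlt x' hnear hsum' hq').2 u v huv (by omega) (by omega)
    have huns : (unsettled d x' : ℝ) - (if x' u < d ∧ d < x' v then 1 else 0) ≤
        unsettled d x - 1 := by
      have hsub : (Finset.univ.filter (fun w => x' w ≠ d)) ⊆
          Finset.univ.filter (fun w => x w ≠ d) := by
        intro w hw
        simp only [Finset.mem_filter, Finset.mem_univ, true_and] at hw ⊢
        by_cases h1 : w = u
        · subst h1; omega
        · by_cases h2 : w = v
          · subst h2; omega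
          · have : x' w = x w := by simp [x', h1, h2]
            rwa [← this]
      split_ifs with hc
      · have : unsettled d x' ≤ unsettled d x := Finset.card_le_card hsub
        have h2 : (unsettled d x' : ℝ) ≤ unsettled d x := by exact_mod_cast this
        linarith
      · have : unsettled d x' < unsettled d x := by
          refine Finset.card_lt_card (Finset.ssubset_iff_subset_ne.2 ⟨hsub, fun he => ?_⟩)
          have hu' : u ∈ Finset.univ.filter (fun w => x w ≠ d) := by simp; omega
          have hv' : v ∈ Finset.univ.filter (fun w => x w ≠ d) := by simp; omega
          rw [← he] at hu' hv'
          simp only [Finset.mem_filter, Finset.mem_univ, true_and] at hu' hv'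
          omega
        have h2 : (unsettled d x' + 1 : ℝ) ≤ unsettled d x := by exact_mod_cast this
        linarith
    have g1 := hN.gap hK hdn hΔ hd hx huv
    have g2 := hN'.gap hK hdn hΔ hd hx huv
    have e1 := hN.eq x x' u v huv hx'
    have e2 := hN'.eq x x' u v huv hx'
    rw [← e1, ← e2] at hih
    have hstep : (x u - Y x u v : ℝ) * (x v - Y' x u v) ≤
        Real.exp (32 * Δ / d ^ 2 * (x v - x u)) * ((x v - Y x u v) * (x u - Y' x u v)) := by
      have h1 := abs_le.1 (hYY u v huv)
      have hvu : (0 : ℝ) ≤ x v - x u := by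
        have : (x u : ℝ) ≤ x v := by exact_mod_cast (by omega : x u ≤ x v)
        linarith
      have h2 : 32 * Δ / d ^ 2 * ((x v : ℝ) - x u) =
          (2 * Δ * (x v - x u)) / ((d / 4) * (d / 4)) := by
        field_simp; ring
      rw [h2]
      refine div_le_exp_of_sub_le (by positivity) ?_ ?_ (by positivity)
      · exact mul_le_mul g1.2 g2.1 (by positivity) (by linarith [g1.2])
      · nlinarith [h1.1, h1.2]
    set c := Real.exp (16 * Δ / d * (unsettled d x' - (if x' u < d ∧ d < x' v then 1 else 0)) +
      8 * Δ / d + 32 * Δ / d ^ 2 * q') with hc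
    have hpos : (0 : ℝ) < x v - Y x u v := by linarith [g1.2]
    have hpos' : (0 : ℝ) < x v - Y' x u v := by linarith [g2.2]
    have hposu : (0 : ℝ) < x u - Y x u v := by linarith [g1.1]
    have hposu' : (0 : ℝ) < x u - Y' x u v := by linarith [g2.1]
    have hfin : N x * (x u - Y x u v) * N' (fun _ => d) ≤
        c * Real.exp (32 * Δ / d ^ 2 * (x v - x u)) *
          (N' x * (x u - Y' x u v) * N (fun _ => d)) := by
      have hNA : 0 ≤ N' x * N (fun _ => d) := mul_nonneg (hN'.nonneg x) hA
      refine le_of_mul_le_mul_left ?_ hpos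
      calc (x v - Y x u v) * (N x * (x u - Y x u v) * N' (fun _ => d))
          = (x u - Y x u v) * (N x * (x v - Y x u v) * N' (fun _ => d)) := by ring
        _ ≤ (x u - Y x u v) * (c * (N' x * (x v - Y' x u v) * N (fun _ => d))) := by gcongr
        _ = (c * (N' x * N (fun _ => d))) * ((x u - Y x u v) * (x v - Y' x u v)) := by ring
        _ ≤ (c * (N' x * N (fun _ => d))) * (Real.exp (32 * Δ / d ^ 2 * (x v - x u)) *
            ((x v - Y x u v) * (x u - Y' x u v))) := by gcongr
        _ = _ := by ring
    refine hfin.trans ?_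
    rw [hc, ← Real.exp_add]
    have hNA : 0 ≤ N' x * (x u - Y' x u v) * N (fun _ => d) :=
      mul_nonneg (mul_nonneg (hN'.nonneg x) hposu'.le) hA
    refine mul_le_mul_of_nonneg_right (Real.exp_le_exp.2 ?_) hNA
    have hqq' : (q' : ℝ) + (x v - x u) ≤ q := by
      rw [← Nat.cast_sub (by omega)]
      exact_mod_cast hqq
    have t1 : 32 * Δ / d ^ 2 * (q' + ((x v : ℝ) - x u)) ≤ 32 * Δ / d ^ 2 * q := by gcongr
    have t2 := mul_le_mul_of_nonneg_left huns (by positivity : 0 ≤ 16 * Δ / d)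
    rw [mul_add] at t1
    linarith
  have hP : N x * N' (fun _ => d) ≤
      Real.exp (16 * Δ / d * unsettled d x + 32 * Δ / d ^ 2 * q) * (N' x * N (fun _ => d)) := by
    by_cases hc : x = fun _ => d
    · rw [hc, mul_comm]
      have h1 : 1 ≤ Real.exp (16 * Δ / d * unsettled d (fun _ : Fin m => d) +
        32 * Δ / d ^ 2 * q) := Real.one_le_exp (by positivity)
      nlinarith [mul_nonneg hA' hA]
    · have hex : ∃ u v, u ≠ v ∧ x u < d ∧ d < x v := by
        have hs0 : ∑ w, x w = ∑ _w : Fin m, d := by simp [hsum]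
        obtain ⟨w, hw⟩ := Function.ne_iff.1 hc
        have h1 : ∃ u, x u < d := by
          by_contra! hno
          have := (Finset.sum_eq_sum_iff_of_le (fun i _ => hno i)).1 hs0.symm w (Finset.mem_univ w)
          exact hw this.symm
        have h2 : ∃ v, d < x v := by
          by_contra! hno
          have := (Finset.sum_eq_sum_iff_of_le (fun i _ => hno i)).1 hs0 w (Finset.mem_univ w)
          exact hw this
        obtain ⟨u, hu⟩ := h1
        obtain ⟨v, hv⟩ := h2
        exact ⟨u, v, fun h => by rw [h] at hu; omega, hu, hv⟩
      obtain ⟨u, v, huv, hu, hv⟩ := hex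
      have h1 := hmove u v huv hu hv
      have h2 := (hconv u v huv).2
      have g1 := (hN.gap hK hdn hΔ hd hx huv).1
      have hpos : (0 : ℝ) < x u - Y x u v := by linarith
      have hNA : 0 ≤ N' x * N (fun _ => d) := mul_nonneg (hN'.nonneg x) hA
      refine le_of_mul_le_mul_left ?_ hpos
      set c := Real.exp (16 * Δ / d * (unsettled d x - 1) + 8 * Δ / d + 32 * Δ / d ^ 2 * q) with hc
      calc (x u - Y x u v) * (N x * N' (fun _ => d))
          = N x * (x u - Y x u v) * N' (fun _ => d) := by ring
        _ ≤ _ := h1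
        _ = c * (N' x * N (fun _ => d)) * (x u - Y' x u v) := by ring
        _ ≤ c * (N' x * N (fun _ => d)) * (Real.exp (8 * Δ / d) * (x u - Y x u v)) := by gcongr
        _ = (x u - Y x u v) * ((c * Real.exp (8 * Δ / d)) * (N' x * N (fun _ => d))) := by ring
        _ = _ := by
          rw [hc, ← Real.exp_add]
          congr 3
          ring_nf
  refine ⟨hP, ?_⟩
  intro u v huv hu hv
  split_ifs with hcase
  · exact hmove u v huv hcase.1 hcase.2
  · have h2 := (hconv u v huv).1
    have g2 := (hN'.gap hK hdn hΔ hd hx huv).1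
    have g1 := (hN.gap hK hdn hΔ hd hx huv).1
    have hNA : 0 ≤ N x * N' (fun _ => d) := mul_nonneg (hN.nonneg x) hA'
    have hpos : (0 : ℝ) < x u - Y' x u v := by linarith
    set c := Real.exp (16 * Δ / d * unsettled d x + 32 * Δ / d ^ 2 * q) with hc
    calc N x * (x u - Y x u v) * N' (fun _ => d)
        = N x * N' (fun _ => d) * (x u - Y x u v) := by ring
      _ ≤ N x * N' (fun _ => d) * (Real.exp (8 * Δ / d) * (x u - Y' x u v)) := by gcongr
      _ = (Real.exp (8 * Δ / d) * (x u - Y' x u v)) * (N x * N' (fun _ => d)) := by ring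
      _ ≤ (Real.exp (8 * Δ / d) * (x u - Y' x u v)) * (c * (N' x * N (fun _ => d))) := by gcongr
      _ = (c * Real.exp (8 * Δ / d)) * (N' x * (x u - Y' x u v) * N (fun _ => d)) := by ring
      _ = _ := by
        rw [hc, ← Real.exp_add]
        congr 2
        ring_nf

lemma Switch.compare {N N' : (Fin m → ℕ) → ℝ} {Y Y' : (Fin m → ℕ) → Fin m → Fin m → ℝ}
    (hN : Switch K d n Δ N Y) (hN' : Switch K d n Δ N' Y') (hK : 8 ≤ K) (hdn : 2 * d ≤ n)
    (hΔ0 : 0 ≤ Δ) (hΔ : 8 * Δ ≤ d) (hd : 0 < d) {x : Fin m → ℕ} (hx : Near K d x)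
    (hsum : ∑ w, x w = m * d) {Q : ℝ} (hQ : (devSq d x : ℝ) ≤ Q) :
    N x * N' (fun _ => d) ≤
      Real.exp (16 * Δ / d * m + 32 * Δ / d ^ 2 * Q) * (N' x * N (fun _ => d)) := by
  have hdev0 : 0 ≤ devSq d x := Finset.sum_nonneg fun _ _ => sq_nonneg _
  obtain ⟨q, hq⟩ := Int.eq_ofNat_of_zero_le hdev0
  have hqQ : (q : ℝ) ≤ Q := by
    rw [hq] at hQ
    exact_mod_cast hQ
  refine (hN.compare_aux hN' hK hdn hΔ0 hΔ hd q x hx hsum hq).1.trans ?_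
  have hNA : 0 ≤ N' x * N (fun _ => d) := mul_nonneg (hN'.nonneg x) (hN.nonneg _)
  have hu : (unsettled d x : ℝ) ≤ m := by
    have : unsettled d x ≤ m := (Finset.card_le_univ _).trans (by simp)
    exact_mod_cast this
  have hd' : (0 : ℝ) < d := by exact_mod_cast hd
  gcongr

end

section

variable {r m : ℕ}

/-- The number of edge sets with degrees `x` in class `t` and `d`-regular in the classes of `C`. -/
noncomputable def numFam (C : Finset (Fin r)) (t : Fin r) (d : ℕ) (x : Fin m → ℕ) : ℝ :=
  (fam (insert t C) (Function.update (fun _ _ => d) t x)).card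

/-- The mean number of edges through `v` of class `t` whose translate to `u` is also present. -/
noncomputable def meanDuo (C : Finset (Fin r)) (t : Fin r) (d : ℕ) (x : Fin m → ℕ)
    (u v : Fin m) : ℝ :=
  if numFam C t d x = 0 then x u * x v / (m : ℝ) ^ (r - 1) else
    ((∑ E ∈ fam (insert t C) (Function.update (fun _ _ => d) t x), (duo E t v u).card : ℕ) : ℝ) /
      numFam C t d x

lemma numFam_mul_meanDuo (C : Finset (Fin r)) (t : Fin r) (d : ℕ) (x : Fin m → ℕ) (u v : Fin m) :
    numFam C t d x * meanDuo C t d x u v =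
      ((∑ E ∈ fam (insert t C) (Function.update (fun _ _ => d) t x), (duo E t v u).card : ℕ) : ℝ) := by
  unfold meanDuo
  split_ifs with h
  · have h0 : fam (insert t C) (Function.update (fun _ _ => d) t x) = ∅ := by
      rw [← Finset.card_eq_zero]
      exact Nat.cast_eq_zero (R := ℝ).1 h
    rw [h0, h]
    simp
  · field_simp

lemma numFam_mul_sub (C : Finset (Fin r)) (t : Fin r) (d : ℕ) (x : Fin m → ℕ) (u v : Fin m) :
    numFam C t d x * (x v - meanDuo C t d x u v) =
      ((∑ E ∈ fam (insert t C) (Function.update (fun _ _ => d) t x), (solo E t v u).card : ℕ) : ℝ) := by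
  rw [mul_sub, numFam_mul_meanDuo, numFam, sub_eq_iff_eq_add, ← Nat.cast_add,
    ← Finset.sum_add_distrib, ← nsmul_eq_mul, ← Nat.cast_smul_eq_nsmul ℝ]
  rw [Finset.sum_congr rfl (g := fun _ => x v) (fun E hE => by
    rw [card_solo_add_card_duo, mem_fam.1 hE t (Finset.mem_insert_self _ _) v,
      Function.update_self])]
  simp

lemma meanDuo_comm (C : Finset (Fin r)) (t : Fin r) (d : ℕ) (x : Fin m → ℕ) (u v : Fin m) :
    meanDuo C t d x u v = meanDuo C t d x v u := by
  unfold meanDuo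
  rw [mul_comm (x u : ℝ), Finset.sum_congr rfl (fun E _ => card_duo_comm E t v u)]

lemma switch_numFam (C : Finset (Fin r)) (t : Fin r) {d : ℕ}
    (hrd : 512 * r ^ 2 ≤ d) (hd : 2 * d ≤ m ^ (r - 1)) :
    Switch (192 * r) d ((m : ℝ) ^ (r - 1)) (devBound r m d) (numFam (m := m) C t d)
      (meanDuo C t d) where
  nonneg x := Nat.cast_nonneg _
  eq x x' u v huv hx := by
    rw [numFam_mul_sub, meanDuo_comm C t d x', numFam_mul_sub, sum_solo_eq huv
      (y' := Function.update (fun _ _ => d) t x')]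
    · intro s hs
      simp [hs]
    · intro z
      simpa using hx z
  close x u v huv hx := by
    by_cases h : numFam C t d x = 0
    · have : meanDuo C t d x u v = x u * x v / (m : ℝ) ^ (r - 1) := by simp [meanDuo, h]
      rw [this, sub_self, abs_zero]
      unfold devBound
      positivity
    · have hpos : 0 < numFam C t d x := lt_of_le_of_ne (Nat.cast_nonneg _) (Ne.symm h)
      have hreg : NearReg (insert t C) (Function.update (fun _ _ => d) t x) t d :=
        { mem := Finset.mem_insert_self _ _
          reg := fun s _ hs v => by simp [hs]
          lower := fun v => by simpa using (hx v).1
          upper := fun v => by simpa using (hx v).2 }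
      have := hreg.abs_sum_card_duo_sub_le huv hrd hd
      rw [← numFam_mul_meanDuo] at this
      simp only [Function.update_self] at this
      change |_ - numFam C t d x * _| ≤ numFam C t d x * _ at this
      rw [← mul_sub, abs_mul, abs_of_pos hpos] at this
      have := le_of_mul_le_mul_left this hpos
      rw [mul_comm (x u : ℝ)]
      exact_mod_cast this

end

section

variable {r m : ℕ}

/-- On each line in direction `t`, exchange the vertex `v` with the vertex prescribed by `κ`. -/
def lineSwap (t : Fin r) (v : Fin m) (κ : (Fin r → Fin m) → Fin m) (e : Fin r → Fin m) :
    Fin r → Fin m :=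
  Function.update e t (Equiv.swap v (κ (Function.update e t v)) (e t))

lemma lineSwap_involutive (t : Fin r) (v : Fin m) (κ : (Fin r → Fin m) → Fin m) :
    Function.Involutive (lineSwap t v κ) := by
  intro e
  simp [lineSwap]

lemma lineSwap_of_ne {s t : Fin r} (h : s ≠ t) (v : Fin m) (κ : (Fin r → Fin m) → Fin m)
    (e : Fin r → Fin m) : lineSwap t v κ e s = e s := by
  simp [lineSwap, h]

lemma lineSwap_of_eq {t : Fin r} {v : Fin m} (κ : (Fin r → Fin m) → Fin m)
    {e : Fin r → Fin m} (h : e t = v) : lineSwap t v κ e = Function.update e t (κ e) := by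
  have : Function.update e t v = e := by rw [← h, Function.update_eq_self]
  rw [lineSwap, this, h, Equiv.swap_apply_left]

/-- The edge set obtained from `E` by `lineSwap`. -/
def swapSet (t : Fin r) (v : Fin m) (κ : (Fin r → Fin m) → Fin m) (E : Finset (Fin r → Fin m)) :
    Finset (Fin r → Fin m) :=
  Finset.univ.filter (fun e => lineSwap t v κ e ∈ E)

lemma mem_swapSet {t : Fin r} {v : Fin m} {κ : (Fin r → Fin m) → Fin m}
    {E : Finset (Fin r → Fin m)} {e : Fin r → Fin m} :
    e ∈ swapSet t v κ E ↔ lineSwap t v κ e ∈ E := by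
  simp [swapSet]

lemma swapSet_involutive (t : Fin r) (v : Fin m) (κ : (Fin r → Fin m) → Fin m) :
    Function.Involutive (swapSet t v κ) := by
  intro E
  ext e
  rw [mem_swapSet, mem_swapSet, lineSwap_involutive t v κ e]

lemma card_swapSet (t : Fin r) (v : Fin m) (κ : (Fin r → Fin m) → Fin m)
    (E : Finset (Fin r → Fin m)) : (swapSet t v κ E).card = E.card :=
  Finset.card_bij' (fun e _ => lineSwap t v κ e) (fun e _ => lineSwap t v κ e)
    (fun _ he => mem_swapSet.1 he)
    (fun e he => mem_swapSet.2 (by rwa [lineSwap_involutive t v κ e]))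
    (fun e _ => lineSwap_involutive t v κ e) (fun e _ => lineSwap_involutive t v κ e)

lemma vdeg_swapSet {s t : Fin r} (h : s ≠ t) (v : Fin m) (κ : (Fin r → Fin m) → Fin m)
    (E : Finset (Fin r → Fin m)) (w : Fin m) : vdeg (swapSet t v κ E) s w = vdeg E s w := by
  unfold vdeg
  refine Finset.card_bij' (fun e _ => lineSwap t v κ e) (fun e _ => lineSwap t v κ e) ?_ ?_
    (fun e _ => lineSwap_involutive t v κ e) (fun e _ => lineSwap_involutive t v κ e)
  · intro e he
    simp only [Finset.mem_filter, mem_swapSet, lineSwap_of_ne h] at he ⊢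
    exact he
  · intro e he
    simp only [Finset.mem_filter, mem_swapSet, lineSwap_of_ne h, lineSwap_involutive t v κ e] at he ⊢
    exact he

lemma vdeg_swapSet_self (t : Fin r) (v : Fin m) (κ : (Fin r → Fin m) → Fin m)
    (E : Finset (Fin r → Fin m)) :
    vdeg (swapSet t v κ E) t v =
      (Finset.univ.filter (fun g => g t = v ∧ Function.update g t (κ g) ∈ E)).card := by
  unfold vdeg
  congr 1
  ext e
  simp only [Finset.mem_filter, mem_swapSet, Finset.mem_univ, true_and]
  constructor
  · rintro ⟨h1, h2⟩
    exact ⟨h2, by rwa [← lineSwap_of_eq κ h2]⟩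
  · rintro ⟨h1, h2⟩
    exact ⟨by rwa [lineSwap_of_eq κ h1], h1⟩

lemma sum_card_line (t : Fin r) (v : Fin m) (E : Finset (Fin r → Fin m)) :
    ∑ g, (Finset.univ.filter (fun j : Fin m => g t = v ∧ Function.update g t j ∈ E)).card =
      E.card := by
  rw [← Finset.card_sigma]
  refine Finset.card_bij' (fun p _ => Function.update p.1 t p.2)
    (fun e _ => ⟨Function.update e t v, e t⟩) ?_ ?_ ?_ ?_
  · rintro ⟨g, j⟩ h
    simp only [Finset.mem_sigma, Finset.mem_filter, Finset.mem_univ, true_and] at h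
    exact h.2
  · intro e h
    simpa using h
  · rintro ⟨g, j⟩ h
    simp only [Finset.mem_sigma, Finset.mem_filter, Finset.mem_univ, true_and] at h
    simp [← h.1]
  · intro e _
    simp

lemma sum_pow_line_le (t : Fin r) (v : Fin m) (E : Finset (Fin r → Fin m)) {x : ℝ} (hx : 0 ≤ x) :
    ∑ κ : (Fin r → Fin m) → Fin m, x ^ vdeg (swapSet t v κ E) t v ≤
      Fintype.card ((Fin r → Fin m) → Fin m) * Real.exp (E.card / m * (x - 1)) := by
  have hm : (0 : ℝ) < m := by exact_mod_cast v.pos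
  have h1 : ∀ κ : (Fin r → Fin m) → Fin m, x ^ vdeg (swapSet t v κ E) t v =
      ∏ g, if g t = v ∧ Function.update g t (κ g) ∈ E then x else 1 := by
    intro κ
    rw [vdeg_swapSet_self, Finset.prod_ite, Finset.prod_const, Finset.prod_const_one, mul_one]
  have h2 : ∀ g : Fin r → Fin m,
      ∑ j, (if g t = v ∧ Function.update g t j ∈ E then x else 1) ≤
      m * Real.exp ((Finset.univ.filter
        (fun j : Fin m => g t = v ∧ Function.update g t j ∈ E)).card / m * (x - 1)) := by
    intro g
    have : ∀ j : Fin m, (if g t = v ∧ Function.update g t j ∈ E then x else 1) =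
        1 + (if g t = v ∧ Function.update g t j ∈ E then x - 1 else 0) := by
      intro j
      split_ifs <;> ring
    rw [Finset.sum_congr rfl (fun j _ => this j), Finset.sum_add_distrib, ← Finset.sum_filter,
      Finset.sum_const, Finset.sum_const, Finset.card_univ, Fintype.card_fin, nsmul_eq_mul,
      nsmul_eq_mul, mul_one]
    have h3 := mul_le_mul_of_nonneg_left (Real.add_one_le_exp ((Finset.univ.filter
        (fun j : Fin m => g t = v ∧ Function.update g t j ∈ E)).card / m * (x - 1))) hm.le
    refine le_trans (le_of_eq ?_) h3
    field_simp
    ring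
  have h4 := Finset.prod_univ_sum (fun _ : Fin r → Fin m => (Finset.univ : Finset (Fin m)))
    (fun g j => if g t = v ∧ Function.update g t j ∈ E then x else 1)
  rw [Fintype.piFinset_univ] at h4
  rw [Finset.sum_congr rfl (fun κ _ => h1 κ), ← h4]
  refine (Finset.prod_le_prod (fun g _ => Finset.sum_nonneg fun j _ => ?_)
    (fun g _ => h2 g)).trans (le_of_eq ?_)
  · split_ifs <;> simp [hx]
  · rw [Finset.prod_mul_distrib, ← Real.exp_sum, ← Finset.sum_mul, ← Finset.sum_div,
      ← Nat.cast_sum, sum_card_line]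
    simp

/-- The edge sets of size `m * d` that are `d`-regular in all classes of `C`. -/
def part (C : Finset (Fin r)) (m d : ℕ) : Finset (Finset (Fin r → Fin m)) :=
  Finset.univ.filter (fun E => E.card = m * d ∧ ∀ s ∈ C, ∀ v, vdeg E s v = d)

lemma mem_part {C : Finset (Fin r)} {d : ℕ} {E : Finset (Fin r → Fin m)} :
    E ∈ part C m d ↔ E.card = m * d ∧ ∀ s ∈ C, ∀ v, vdeg E s v = d := by
  simp [part]

variable {C : Finset (Fin r)} {t : Fin r} {d : ℕ}

lemma swapSet_mem_part (ht : t ∉ C) (v : Fin m) (κ : (Fin r → Fin m) → Fin m)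
    {E : Finset (Fin r → Fin m)} (hE : E ∈ part C m d) : swapSet t v κ E ∈ part C m d := by
  rw [mem_part] at hE ⊢
  refine ⟨by rw [card_swapSet, hE.1], fun s hs w => ?_⟩
  rw [vdeg_swapSet (ne_of_mem_of_not_mem hs ht), hE.2 s hs]

lemma sum_pow_vdeg_le (ht : t ∉ C) (v : Fin m) {x : ℝ} (hx : 0 ≤ x) :
    ∑ E ∈ part C m d, x ^ vdeg E t v ≤ (part C m d).card * Real.exp (d * (x - 1)) := by
  have hm : (0 : ℝ) < m := by exact_mod_cast v.pos
  have hpos : (0 : ℝ) < Fintype.card ((Fin r → Fin m) → Fin m) := by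
    have : Nonempty (Fin m) := ⟨v⟩
    exact_mod_cast Fintype.card_pos
  refine le_of_mul_le_mul_left ?_ hpos
  have h1 : ∀ κ : (Fin r → Fin m) → Fin m,
      ∑ E ∈ part C m d, x ^ vdeg E t v = ∑ E ∈ part C m d, x ^ vdeg (swapSet t v κ E) t v :=
    fun κ => Finset.sum_bij' (fun E _ => swapSet t v κ E) (fun E _ => swapSet t v κ E)
      (fun E hE => swapSet_mem_part ht v κ hE) (fun E hE => swapSet_mem_part ht v κ hE)
      (fun E _ => swapSet_involutive t v κ E) (fun E _ => swapSet_involutive t v κ E)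
      (fun E _ => by rw [swapSet_involutive t v κ E])
  calc _ = ∑ κ : (Fin r → Fin m) → Fin m, ∑ E ∈ part C m d, x ^ vdeg E t v := by
        rw [Finset.sum_const, nsmul_eq_mul, Finset.card_univ]
    _ = ∑ E ∈ part C m d, ∑ κ : (Fin r → Fin m) → Fin m, x ^ vdeg (swapSet t v κ E) t v := by
        rw [Finset.sum_congr rfl (fun κ _ => h1 κ), Finset.sum_comm]
    _ ≤ ∑ E ∈ part C m d, Fintype.card ((Fin r → Fin m) → Fin m) *
          Real.exp (d * (x - 1)) := by
        refine Finset.sum_le_sum fun E hE => (sum_pow_line_le t v E hx).trans (le_of_eq ?_)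
        rw [(mem_part.1 hE).1, Nat.cast_mul, mul_div_cancel_left₀ _ hm.ne']
    _ = _ := by
        rw [Finset.sum_const, nsmul_eq_mul]
        ring

lemma sum_exp_vdeg_le (ht : t ∉ C) (v : Fin m) {θ : ℝ} (hθ : |θ| ≤ 1) :
    ∑ E ∈ part C m d, Real.exp (θ * (vdeg E t v - d)) ≤
      (part C m d).card * Real.exp (d * θ ^ 2) := by
  have h1 := sum_pow_vdeg_le (d := d) ht v (Real.exp_pos θ).le
  have h2 : ∀ E : Finset (Fin r → Fin m), Real.exp (θ * (vdeg E t v - d)) =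
      Real.exp (-(θ * d)) * Real.exp θ ^ vdeg E t v := by
    intro E
    rw [← Real.exp_nat_mul, ← Real.exp_add]
    ring_nf
  rw [Finset.sum_congr rfl (fun E _ => h2 E), ← Finset.mul_sum]
  refine (mul_le_mul_of_nonneg_left h1 (Real.exp_pos _).le).trans ?_
  rw [mul_left_comm, ← Real.exp_add]
  refine mul_le_mul_of_nonneg_left (Real.exp_le_exp.2 ?_) (Nat.cast_nonneg _)
  have h3 := (abs_le.1 (Real.abs_exp_sub_one_sub_id_le hθ)).2
  nlinarith [mul_le_mul_of_nonneg_left h3 (Nat.cast_nonneg d : (0 : ℝ) ≤ d)]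

lemma card_filter_lt_mul_le (ht : t ∉ C) (v : Fin m) {θ : ℝ} (hθ : |θ| ≤ 1) :
    (((part C m d).filter (fun E => 2 * d * θ ^ 2 < θ * (vdeg E t v - d))).card : ℝ) ≤
      (part C m d).card * Real.exp (-(d * θ ^ 2)) := by
  have h1 := sum_exp_vdeg_le (d := d) ht v hθ
  have h2 : (((part C m d).filter (fun E => 2 * d * θ ^ 2 < θ * (vdeg E t v - d))).card : ℝ) *
      Real.exp (2 * d * θ ^ 2) ≤ ∑ E ∈ part C m d, Real.exp (θ * (vdeg E t v - d)) := by
    rw [← nsmul_eq_mul, ← Finset.sum_const]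
    refine (Finset.sum_le_sum fun E hE => ?_).trans (Finset.sum_le_sum_of_subset_of_nonneg
      (Finset.filter_subset _ _) fun _ _ _ => (Real.exp_pos _).le)
    exact Real.exp_le_exp.2 (Finset.mem_filter.1 hE).2.le
  refine le_of_mul_le_mul_right ((h2.trans h1).trans (le_of_eq ?_)) (Real.exp_pos (2 * d * θ ^ 2))
  rw [mul_assoc, ← Real.exp_add]
  ring_nf

instance (K d : ℕ) : DecidablePred (Near (m := m) K d) := fun _ =>
  inferInstanceAs (Decidable (∀ _, _ ∧ _))

lemma card_not_near_le (ht : t ∉ C) {K : ℕ} (hK : 0 < K) :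
    (((part C m d).filter (fun E => ¬ Near K d (vdeg E t))).card : ℝ) ≤
      (part C m d).card * (2 * m * Real.exp (-(d * (1 / (2 * K)) ^ 2))) := by
  have hK' : (1 : ℝ) ≤ K := by exact_mod_cast hK
  set θ : ℝ := 1 / (2 * K) with hθ
  have hθ0 : 0 < θ := by positivity
  have hθ1 : θ ≤ 1 := by
    rw [hθ, div_le_one (by positivity)]
    linarith
  have hKθ : θ * (2 * K) = 1 := by rw [hθ]; field_simp
  clear_value θ
  have hsub : (part C m d).filter (fun E => ¬ Near K d (vdeg E t)) ⊆
      Finset.univ.biUnion (fun v : Fin m =>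
        (part C m d).filter (fun E => 2 * d * θ ^ 2 < θ * (vdeg E t v - d)) ∪
        (part C m d).filter (fun E => 2 * d * (-θ) ^ 2 < -θ * (vdeg E t v - d))) := by
    intro E hE
    obtain ⟨hE, hn⟩ := Finset.mem_filter.1 hE
    simp only [Near, not_forall, not_and_or, not_le] at hn
    obtain ⟨v, hv⟩ := hn
    simp only [Finset.mem_biUnion, Finset.mem_univ, true_and, Finset.mem_union, Finset.mem_filter,
      hE]
    refine ⟨v, hv.symm.imp (fun h => ?_) (fun h => ?_)⟩
    · have h' : (K * d + d : ℝ) < K * vdeg E t v := by exact_mod_cast h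
      have : θ ^ 2 * (2 * ((K * d + d : ℝ) - K * vdeg E t v)) < 0 :=
        mul_neg_of_pos_of_neg (by positivity) (by linarith)
      linear_combination this + θ * (vdeg E t v - d) * hKθ
    · have h' : (K * vdeg E t v + d : ℝ) < K * d := by exact_mod_cast h
      have : θ ^ 2 * (2 * ((K * vdeg E t v + d : ℝ) - K * d)) < 0 :=
        mul_neg_of_pos_of_neg (by positivity) (by linarith)
      linear_combination this - θ * (vdeg E t v - d) * hKθ
  have h1 := fun v : Fin m => card_filter_lt_mul_le (d := d) ht v (θ := θ)
    (by rwa [abs_of_pos hθ0])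
  have h2 := fun v : Fin m => card_filter_lt_mul_le (d := d) ht v (θ := -θ)
    (by rwa [abs_neg, abs_of_pos hθ0])
  calc _ ≤ ∑ v : Fin m, ((((part C m d).filter
          (fun E => 2 * d * θ ^ 2 < θ * (vdeg E t v - d))).card : ℝ) +
        ((part C m d).filter (fun E => 2 * d * (-θ) ^ 2 < -θ * (vdeg E t v - d))).card) := by
        exact_mod_cast (Finset.card_le_card hsub).trans (Finset.card_biUnion_le.trans
          (Finset.sum_le_sum fun v _ => Finset.card_union_le _ _))
    _ ≤ ∑ _v : Fin m, ((part C m d).card * Real.exp (-(d * θ ^ 2)) +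
        (part C m d).card * Real.exp (-(d * (-θ) ^ 2))) :=
        Finset.sum_le_sum fun v _ => add_le_add (h1 v) (h2 v)
    _ = _ := by
        rw [Finset.sum_const, Finset.card_univ, Fintype.card_fin, nsmul_eq_mul, neg_sq]
        ring

lemma sq_le_exp_add_exp_neg (z : ℝ) : z ^ 2 ≤ Real.exp z + Real.exp (-z) - 2 := by
  have h1 : |z / 2| ≤ |Real.sinh (z / 2)| := by
    rcases le_total 0 (z / 2) with h | h
    · rw [abs_of_nonneg h, abs_of_nonneg (Real.sinh_nonneg_iff.2 h)]
      exact Real.self_le_sinh_iff.2 h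
    · rw [abs_of_nonpos h, abs_of_nonpos (Real.sinh_nonpos_iff.2 h)]
      exact neg_le_neg (Real.sinh_le_self_iff.2 h)
  have h2 := sq_le_sq.2 h1
  have h3 : Real.exp (z / 2) * Real.exp (z / 2) = Real.exp z := by
    rw [← Real.exp_add, add_halves]
  have h4 : Real.exp (-(z / 2)) * Real.exp (-(z / 2)) = Real.exp (-z) := by
    rw [← Real.exp_add, ← neg_add, add_halves]
  have h5 : Real.exp (z / 2) * Real.exp (-(z / 2)) = 1 := by
    rw [← Real.exp_add, add_neg_cancel, Real.exp_zero]
  rw [Real.sinh_eq] at h2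
  nlinarith

lemma sum_sq_vdeg_le (ht : t ∉ C) (hd : 0 < d) (v : Fin m) :
    ∑ E ∈ part C m d, ((vdeg E t v : ℝ) - d) ^ 2 ≤ (part C m d).card * (4 * d) := by
  have hd' : (1 : ℝ) ≤ d := by exact_mod_cast hd
  set θ : ℝ := (Real.sqrt d)⁻¹ with hθ
  have hθ0 : 0 < θ := by positivity
  have hθ1 : θ ≤ 1 := inv_le_one_of_one_le₀ (Real.one_le_sqrt.2 hd')
  have hθ2 : d * θ ^ 2 = 1 := by
    rw [hθ, inv_pow, Real.sq_sqrt (by positivity)]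
    field_simp
  have h1 := sum_exp_vdeg_le (d := d) ht v (θ := θ) (by rwa [abs_of_pos hθ0])
  have h2 := sum_exp_vdeg_le (d := d) ht v (θ := -θ) (by rwa [abs_neg, abs_of_pos hθ0])
  rw [neg_sq] at h2
  rw [hθ2] at h1 h2
  have he := Real.exp_one_lt_d9
  calc _ ≤ ∑ E ∈ part C m d, d * (Real.exp (θ * (vdeg E t v - d)) +
          Real.exp (-θ * (vdeg E t v - d)) - 2) := by
        refine Finset.sum_le_sum fun E _ => ?_
        have := sq_le_exp_add_exp_neg (θ * (vdeg E t v - d))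
        rw [neg_mul]
        refine le_trans (le_of_eq ?_) (mul_le_mul_of_nonneg_left this (by positivity))
        rw [mul_pow, ← mul_assoc, hθ2, one_mul]
    _ = d * (∑ E ∈ part C m d, Real.exp (θ * (vdeg E t v - d)) +
          ∑ E ∈ part C m d, Real.exp (-θ * (vdeg E t v - d)) - (part C m d).card * 2) := by
        rw [← Finset.mul_sum, Finset.sum_sub_distrib, Finset.sum_add_distrib, Finset.sum_const,
          nsmul_eq_mul]
    _ ≤ d * ((part C m d).card * Real.exp 1 + (part C m d).card * Real.exp 1 -
          (part C m d).card * 2) := by gcongr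
    _ = (part C m d).card * ((2 * Real.exp 1 - 2) * d) := by ring
    _ ≤ _ := by
        gcongr
        linarith

lemma card_lt_devSq_le (ht : t ∉ C) (hd : 0 < d) {Q : ℝ} (hQ : 0 < Q) :
    (((part C m d).filter (fun E => Q < (devSq d (vdeg E t) : ℝ))).card : ℝ) ≤
      (part C m d).card * (4 * (m * d) / Q) := by
  have h1 : ∑ E ∈ part C m d, (devSq d (vdeg E t) : ℝ) ≤ (part C m d).card * (4 * (m * d)) := by
    simp only [devSq, Int.cast_sum, Int.cast_pow, Int.cast_sub, Int.cast_natCast]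
    rw [Finset.sum_comm]
    refine (Finset.sum_le_sum fun v _ => sum_sq_vdeg_le ht hd v).trans (le_of_eq ?_)
    rw [Finset.sum_const, Finset.card_univ, Fintype.card_fin, nsmul_eq_mul]
    ring
  have h2 : (((part C m d).filter (fun E => Q < (devSq d (vdeg E t) : ℝ))).card : ℝ) * Q ≤
      ∑ E ∈ part C m d, (devSq d (vdeg E t) : ℝ) := by
    rw [← nsmul_eq_mul, ← Finset.sum_const]
    refine (Finset.sum_le_sum fun E hE => (Finset.mem_filter.1 hE).2.le).trans
      (Finset.sum_le_sum_of_subset_of_nonneg (Finset.filter_subset _ _) fun E _ _ => ?_)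
    exact Int.cast_nonneg (Finset.sum_nonneg fun _ _ => sq_nonneg _)
  rw [← mul_div_assoc, le_div_iff₀ hQ]
  exact h2.trans h1

end

section

variable {r m : ℕ} {C : Finset (Fin r)} {t : Fin r} {d : ℕ}

lemma sum_vdeg (E : Finset (Fin r → Fin m)) (t : Fin r) : ∑ v, vdeg E t v = E.card :=
  (Finset.card_eq_sum_card_fiberwise (s := E)
    (f := fun e : Fin r → Fin m => e t) (t := Finset.univ) fun _ _ => Finset.mem_univ _).symm

lemma card_part_empty : (part (∅ : Finset (Fin r)) m d).card = (m ^ r).choose (m * d) := by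
  have : part (∅ : Finset (Fin r)) m d = Finset.univ.powersetCard (m * d) := by
    ext E
    simp [mem_part]
  rw [this, Finset.card_powersetCard]
  simp

lemma card_part_singleton (t : Fin r) :
    (part {t} m d).card = ((m ^ (r - 1)).choose d) ^ m := by
  have h : (Fintype.piFinset fun v : Fin m => (layer t v).powersetCard d).card =
      ((m ^ (r - 1)).choose d) ^ m := by
    simp [Finset.card_powersetCard, card_layer]
  rw [← h]
  refine Finset.card_bij' (fun E _ v => E.filter (fun e => e t = v))
    (fun p _ => Finset.univ.biUnion p) ?_ ?_ ?_ ?_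
  · intro E hE
    rw [Fintype.mem_piFinset]
    intro v
    rw [Finset.mem_powersetCard]
    refine ⟨fun e he => mem_layer.2 (Finset.mem_filter.1 he).2, ?_⟩
    exact (mem_part.1 hE).2 t (Finset.mem_singleton_self t) v
  · intro p hp
    rw [Fintype.mem_piFinset] at hp
    simp only [Finset.mem_powersetCard] at hp
    have hv : ∀ v, vdeg (Finset.univ.biUnion p) t v = d := by
      intro v
      rw [← (hp v).2, vdeg]
      congr 1
      ext e
      simp only [Finset.mem_filter, Finset.mem_biUnion, Finset.mem_univ, true_and]
      constructor
      · rintro ⟨⟨w, hw⟩, h⟩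
        have := mem_layer.1 ((hp w).1 hw)
        rwa [← h, this]
      · exact fun h => ⟨⟨v, h⟩, mem_layer.1 ((hp v).1 h)⟩
    rw [mem_part]
    refine ⟨?_, fun s hs v => ?_⟩
    · rw [← sum_vdeg _ t]
      simp [hv]
    · rw [Finset.mem_singleton.1 hs, hv]
  · intro E _
    ext e
    simp
  · intro p hp
    rw [Fintype.mem_piFinset] at hp
    simp only [Finset.mem_powersetCard] at hp
    funext v
    ext e
    simp only [Finset.mem_filter, Finset.mem_biUnion, Finset.mem_univ, true_and]
    constructor
    · rintro ⟨⟨w, hw⟩, h⟩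
      have := mem_layer.1 ((hp w).1 hw)
      rwa [← h, this]
    · exact fun h => ⟨⟨v, h⟩, mem_layer.1 ((hp v).1 h)⟩

lemma card_part_univ (hr : 0 < r) : (part (Finset.univ : Finset (Fin r)) m d).card = Hcount r m d := by
  rw [Hcount]
  refine (Nat.subtype_card _ fun E => ?_).symm
  rw [mem_part]
  refine ⟨fun h t v => h.2 t (Finset.mem_univ t) v, fun h => ⟨?_, fun s _ v => h s v⟩⟩
  rw [← sum_vdeg E ⟨0, hr⟩]
  simp [vdeg, h]

lemma filter_part_eq_fam (ht : t ∉ C) {x : Fin m → ℕ} (hx : ∑ v, x v = m * d) :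
    (part C m d).filter (fun E => vdeg E t = x) =
      fam (insert t C) (Function.update (fun _ _ => d) t x) := by
  ext E
  rw [Finset.mem_filter, mem_part, mem_fam]
  constructor
  · rintro ⟨⟨_, h2⟩, h3⟩ s hs v
    by_cases hst : s = t
    · subst hst
      simp [h3]
    · rw [Function.update_of_ne hst]
      exact h2 s ((Finset.mem_insert.1 hs).resolve_left hst) v
  · intro h
    have h3 : vdeg E t = x := by
      funext v
      simpa using h t (Finset.mem_insert_self _ _) v
    refine ⟨⟨?_, fun s hs v => ?_⟩, h3⟩
    · rw [← sum_vdeg E t, h3, hx]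
    · simpa [ne_of_mem_of_not_mem hs ht] using h s (Finset.mem_insert_of_mem hs) v

lemma numFam_eq_card_filter (ht : t ∉ C) {x : Fin m → ℕ} (hx : ∑ v, x v = m * d) :
    numFam C t d x = (((part C m d).filter (fun E => vdeg E t = x)).card : ℝ) := by
  rw [filter_part_eq_fam ht hx, numFam]

lemma numFam_const (ht : t ∉ C) :
    numFam C t d (fun _ : Fin m => d) = ((part (insert t C) m d).card : ℝ) := by
  rw [numFam_eq_card_filter ht (by simp)]
  congr 2
  ext E
  simp only [Finset.mem_filter, mem_part, Finset.forall_mem_insert, funext_iff]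
  tauto

/-- The edge sets of `part C m d` whose degrees in class `t` are close to `d`, in the supremum and
in the quadratic sense. -/
noncomputable def good (C : Finset (Fin r)) (t : Fin r) (m d K : ℕ) (Q : ℝ) :
    Finset (Finset (Fin r → Fin m)) :=
  (part C m d).filter (fun E => Near K d (vdeg E t) ∧ (devSq d (vdeg E t) : ℝ) ≤ Q)

lemma le_card_good (ht : t ∉ C) (hd : 0 < d) {K : ℕ} (hK : 0 < K) {Q : ℝ} (hQ : 0 < Q) :
    (1 - (2 * m * Real.exp (-(d * (1 / (2 * K)) ^ 2)) + 4 * (m * d) / Q)) * (part C m d).card ≤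
      (good C t m d K Q).card := by
  have h1 := card_not_near_le (m := m) (d := d) ht hK
  have h2 := card_lt_devSq_le (m := m) ht hd hQ
  have h3 : (part C m d).card ≤ (good C t m d K Q).card +
      (((part C m d).filter (fun E => ¬ Near K d (vdeg E t))).card +
      ((part C m d).filter (fun E => Q < (devSq d (vdeg E t) : ℝ))).card) := by
    refine (Finset.card_le_card ?_).trans ((Finset.card_union_le _ _).trans
      (Nat.add_le_add_left (Finset.card_union_le _ _) _))
    intro E hE
    simp only [good, Finset.mem_union, Finset.mem_filter, hE, true_and]
    by_cases h : Near K d (vdeg E t)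
    · rcases le_or_gt (devSq d (vdeg E t) : ℝ) Q with h' | h'
      · exact Or.inl ⟨h, h'⟩
      · exact Or.inr (Or.inr h')
    · exact Or.inr (Or.inl h)
  have h4 : ((part C m d).card : ℝ) ≤ (good C t m d K Q).card +
      (((part C m d).filter (fun E => ¬ Near K d (vdeg E t))).card +
      ((part C m d).filter (fun E => Q < (devSq d (vdeg E t) : ℝ))).card) := by exact_mod_cast h3
  linarith

open Classical in
/-- The degree vectors of class `t` of the edge sets counted by `good`. -/
noncomputable def goodDegrees (t : Fin r) (m d K : ℕ) (Q : ℝ) : Finset (Fin m → ℕ) :=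
  ((Finset.univ : Finset (Finset (Fin r → Fin m))).image (fun E => vdeg E t)).filter
    (fun x => ∑ v, x v = m * d ∧ Near K d x ∧ (devSq d x : ℝ) ≤ Q)

lemma card_good_eq_sum (ht : t ∉ C) (K : ℕ) (Q : ℝ) :
    ((good C t m d K Q).card : ℝ) = ∑ x ∈ goodDegrees t m d K Q, numFam C t d x := by
  have hmaps : ∀ E ∈ good C t m d K Q, vdeg E t ∈ goodDegrees t m d K Q := by
    intro E hE
    obtain ⟨h1, h2⟩ := Finset.mem_filter.1 hE
    refine Finset.mem_filter.2 ⟨Finset.mem_image_of_mem _ (Finset.mem_univ E), ?_, h2⟩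
    rw [sum_vdeg, (mem_part.1 h1).1]
  rw [Finset.card_eq_sum_card_fiberwise hmaps, Nat.cast_sum]
  refine Finset.sum_congr rfl fun x hx => ?_
  obtain ⟨_, h1, h2⟩ := Finset.mem_filter.1 hx
  rw [numFam_eq_card_filter ht h1]
  congr 2
  ext E
  simp only [good, Finset.mem_filter]
  constructor
  · exact fun h => ⟨h.1.1, h.2⟩
  · exact fun h => ⟨⟨h.1, h.2 ▸ h2⟩, h.2⟩

lemma card_good_mul_le {C' : Finset (Fin r)} (ht : t ∉ C) (ht' : t ∉ C') {K : ℕ} {Q n Δ : ℝ}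
    (hS : Switch K d n Δ (numFam (m := m) C t d) (meanDuo C t d))
    (hS' : Switch K d n Δ (numFam (m := m) C' t d) (meanDuo C' t d))
    (hK : 8 ≤ K) (hdn : 2 * d ≤ n) (hΔ0 : 0 ≤ Δ) (hΔ : 8 * Δ ≤ d) (hd : 0 < d) :
    ((good C t m d K Q).card : ℝ) * (part (insert t C') m d).card ≤
      Real.exp (16 * Δ / d * m + 32 * Δ / d ^ 2 * Q) *
        ((good C' t m d K Q).card * (part (insert t C) m d).card) := by
  rw [card_good_eq_sum ht, card_good_eq_sum ht', ← numFam_const ht, ← numFam_const ht',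
    Finset.sum_mul, Finset.sum_mul, Finset.mul_sum]
  refine Finset.sum_le_sum fun x hx => ?_
  obtain ⟨_, h1, h2, h3⟩ := Finset.mem_filter.1 hx
  exact hS.compare hS' hK hdn hΔ0 hΔ hd h2 h1 h3

lemma card_part_insert_bounds (ht : t ∉ C) (hrd : 512 * r ^ 2 ≤ d) (hdn : 2 * d ≤ m ^ (r - 1))
    (hΔ : 8 * devBound r m d ≤ d) {Q ξ ε : ℝ} (hQ : 0 < Q)
    (hξ : 2 * m * Real.exp (-(d * (1 / (2 * (192 * r : ℕ))) ^ 2)) + 4 * (m * d) / Q ≤ ξ)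
    (hε : 16 * devBound r m d / d * m + 32 * devBound r m d / d ^ 2 * Q ≤ ε) :
    (1 - ξ) * Real.exp (-ε) * ((part C m d).card * ((m ^ (r - 1)).choose d : ℝ) ^ m) ≤
        ((m ^ r).choose (m * d) : ℝ) * (part (insert t C) m d).card ∧
    (1 - ξ) * Real.exp (-ε) * (((m ^ r).choose (m * d) : ℝ) * (part (insert t C) m d).card) ≤
        (part C m d).card * ((m ^ (r - 1)).choose d : ℝ) ^ m := by
  have hr : 0 < r := t.pos
  have hr2 : 0 < r ^ 2 := by positivity
  have hd : 0 < d := by omega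
  have hΔ0 : 0 ≤ devBound r m d := by unfold devBound; positivity
  have hdn' : (2 * d : ℝ) ≤ (m : ℝ) ^ (r - 1) := by exact_mod_cast hdn
  have key : ∀ C C' : Finset (Fin r), t ∉ C → t ∉ C' →
      (1 - ξ) * Real.exp (-ε) * ((part C m d).card * (part (insert t C') m d).card) ≤
        (part C' m d).card * (part (insert t C) m d).card := by
    intro C C' ht ht'
    have h1 := card_good_mul_le (m := m) (Q := Q) ht ht' (switch_numFam C t hrd hdn)
      (switch_numFam C' t hrd hdn) (by omega) hdn' hΔ0 hΔ hd
    have h2 := le_card_good (m := m) ht hd (by omega : 0 < 192 * r) hQ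
    have h3 : ((good C' t m d (192 * r) Q).card : ℝ) ≤ (part C' m d).card := by
      exact_mod_cast Finset.card_filter_le _ _
    have h4 : (1 - ξ) * (part C m d).card ≤ (good C t m d (192 * r) Q).card :=
      le_trans (by gcongr) h2
    rw [mul_comm (1 - ξ), mul_assoc, Real.exp_neg, inv_mul_le_iff₀ (Real.exp_pos ε), ← mul_assoc]
    calc _ ≤ ((good C t m d (192 * r) Q).card : ℝ) * (part (insert t C') m d).card := by gcongr
      _ ≤ _ := h1
      _ ≤ _ := by gcongr
  have h1 := key C ∅ ht (Finset.notMem_empty t)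
  have h2 := key ∅ C (Finset.notMem_empty t) ht
  rw [insert_empty_eq, card_part_empty, card_part_singleton, Nat.cast_pow] at h1 h2
  exact ⟨h1, by linarith⟩

lemma card_part_bounds (C : Finset (Fin r)) (hrd : 512 * r ^ 2 ≤ d) (hdn : 2 * d ≤ m ^ (r - 1))
    (hΔ : 8 * devBound r m d ≤ d) {Q ξ ε : ℝ} (hQ : 0 < Q)
    (hξ : 2 * m * Real.exp (-(d * (1 / (2 * (192 * r : ℕ))) ^ 2)) + 4 * (m * d) / Q ≤ ξ)
    (hε : 16 * devBound r m d / d * m + 32 * devBound r m d / d ^ 2 * Q ≤ ε) (hξ1 : ξ ≤ 1) :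
    ((1 - ξ) * Real.exp (-ε)) ^ C.card * (((m ^ r).choose (m * d) : ℝ) *
        (((m ^ (r - 1)).choose d : ℝ) ^ m) ^ C.card) ≤
      ((m ^ r).choose (m * d) : ℝ) ^ C.card * (part C m d).card ∧
    ((1 - ξ) * Real.exp (-ε)) ^ C.card *
        (((m ^ r).choose (m * d) : ℝ) ^ C.card * (part C m d).card) ≤
      ((m ^ r).choose (m * d) : ℝ) * (((m ^ (r - 1)).choose d : ℝ) ^ m) ^ C.card := by
  have ha : 0 ≤ (1 - ξ) * Real.exp (-ε) := mul_nonneg (by linarith) (Real.exp_pos _).le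
  induction C using Finset.induction_on with
  | empty => simp [card_part_empty]
  | insert t C ht ih =>
    obtain ⟨h1, h2⟩ := card_part_insert_bounds ht hrd hdn hΔ hQ hξ hε
    rw [Finset.card_insert_of_notMem ht]
    set a := (1 - ξ) * Real.exp (-ε)
    set T : ℝ := ((m ^ r).choose (m * d) : ℝ)
    set P : ℝ := ((m ^ (r - 1)).choose d : ℝ) ^ m
    have hT : 0 ≤ T := Nat.cast_nonneg _
    have hP : 0 ≤ P := by positivity
    constructor
    · calc a ^ (C.card + 1) * (T * P ^ (C.card + 1))
          = (a * P) * (a ^ C.card * (T * P ^ C.card)) := by ring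
        _ ≤ (a * P) * (T ^ C.card * (part C m d).card) :=
          mul_le_mul_of_nonneg_left ih.1 (mul_nonneg ha hP)
        _ = T ^ C.card * (a * ((part C m d).card * P)) := by ring
        _ ≤ T ^ C.card * (T * (part (insert t C) m d).card) := by gcongr
        _ = _ := by ring
    · calc a ^ (C.card + 1) * (T ^ (C.card + 1) * (part (insert t C) m d).card)
          = a ^ C.card * T ^ C.card * (a * (T * (part (insert t C) m d).card)) := by ring
        _ ≤ a ^ C.card * T ^ C.card * ((part C m d).card * P) := by gcongr
        _ = (a ^ C.card * (T ^ C.card * (part C m d).card)) * P := by ring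
        _ ≤ (T * P ^ C.card) * P := mul_le_mul_of_nonneg_right ih.2 hP
        _ = _ := by ring

lemma Hcount_div_Hhat_bounds (hr : 0 < r) (hrd : 512 * r ^ 2 ≤ d) (hdn : 2 * d ≤ m ^ (r - 1))
    (hΔ : 8 * devBound r m d ≤ d) {Q ξ ε : ℝ} (hQ : 0 < Q)
    (hξ : 2 * m * Real.exp (-(d * (1 / (2 * (192 * r : ℕ))) ^ 2)) + 4 * (m * d) / Q ≤ ξ)
    (hε : 16 * devBound r m d / d * m + 32 * devBound r m d / d ^ 2 * Q ≤ ε) (hξ1 : ξ ≤ 1) :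
    ((1 - ξ) * Real.exp (-ε)) ^ r ≤ Hcount r m d / Hhat r m d ∧
    ((1 - ξ) * Real.exp (-ε)) ^ r * (Hcount r m d / Hhat r m d) ≤ 1 := by
  obtain ⟨h1, h2⟩ := card_part_bounds (Finset.univ : Finset (Fin r)) hrd hdn hΔ hQ hξ hε hξ1
  rw [card_part_univ hr, Finset.card_univ, Fintype.card_fin] at h1 h2
  have hmr : m ^ r = m * m ^ (r - 1) := by
    rw [← pow_succ', Nat.sub_add_cancel hr]
  have hT : (0 : ℝ) < ((m ^ r).choose (m * d) : ℝ) := by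
    refine Nat.cast_pos.2 (Nat.choose_pos ?_)
    rw [hmr]
    exact Nat.mul_le_mul_left _ (by omega)
  have hP : (0 : ℝ) < ((m ^ (r - 1)).choose d : ℝ) := Nat.cast_pos.2 (Nat.choose_pos (by omega))
  unfold Hhat
  set a := (1 - ξ) * Real.exp (-ε)
  set T : ℝ := ((m ^ r).choose (m * d) : ℝ)
  set P : ℝ := ((m ^ (r - 1)).choose d : ℝ)
  have hTr : T ^ r = T * T ^ (r - 1) := by rw [← pow_succ', Nat.sub_add_cancel hr]
  rw [hTr, mul_assoc, mul_left_comm] at h1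
  rw [hTr, mul_assoc, mul_left_comm] at h2
  have h1 := le_of_mul_le_mul_left h1 hT
  have h2 := le_of_mul_le_mul_left h2 hT
  rw [← pow_mul, mul_comm m r] at h1 h2
  have e : (Hcount r m d : ℝ) / (P ^ (r * m) / T ^ (r - 1)) =
      T ^ (r - 1) * Hcount r m d / P ^ (r * m) := by
    field_simp
  rw [e]
  constructor
  · rw [le_div_iff₀ (by positivity)]
    exact h1
  · rw [← mul_div_assoc, div_le_one (by positivity)]
    exact h2

end

section

variable {r m d : ℕ}

lemma vdeg_add_vdeg_compl (E : Finset (Fin r → Fin m)) (t : Fin r) (v : Fin m) :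
    vdeg E t v + vdeg Eᶜ t v = m ^ (r - 1) := by
  rw [← card_layer t v, vdeg, vdeg, ← Finset.card_union_of_disjoint
    (Finset.disjoint_filter_filter disjoint_compl_right), ← Finset.filter_union,
    Finset.union_compl]
  rfl

lemma Hcount_compl (hd : d ≤ m ^ (r - 1)) :
    Hcount r m (m ^ (r - 1) - d) = Hcount r m d := by
  unfold Hcount
  refine Nat.card_congr ((Equiv.subtypeEquiv (Equiv.mk compl compl compl_compl compl_compl) ?_))
  intro E
  refine forall₂_congr fun t v => ?_
  have h := vdeg_add_vdeg_compl E t v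
  unfold vdeg at h
  change _ ↔ (Finset.filter (fun e => e t = v) Eᶜ).card = d
  omega

lemma Hhat_compl (hr : 0 < r) (hd : d ≤ m ^ (r - 1)) :
    Hhat r m (m ^ (r - 1) - d) = Hhat r m d := by
  have hmr : m ^ r = m * m ^ (r - 1) := by
    rw [← pow_succ', Nat.sub_add_cancel hr]
  have h : m * d ≤ m ^ r := by
    rw [hmr]
    exact Nat.mul_le_mul_left _ hd
  unfold Hhat
  rw [Nat.choose_symm hd, Nat.mul_sub, ← hmr, Nat.choose_symm h]

lemma Hcount_div_Hhat_min (hr : 0 < r) (hd : d ≤ m ^ (r - 1)) :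
    (Hcount r m (min d (m ^ (r - 1) - d)) : ℝ) / Hhat r m (min d (m ^ (r - 1) - d)) =
      Hcount r m d / Hhat r m d := by
  rcases min_choice d (m ^ (r - 1) - d) with h | h <;> rw [h]
  rw [Hcount_compl hd, Hhat_compl hr hd]

end

section

variable {r m d : ℕ}

lemma pow_five_le_two_pow (r : ℕ) : r ^ 5 ≤ 2 ^ (r + 8) := by
  rcases lt_or_ge r 8 with h | h
  · interval_cases r <;> norm_num
  · induction r, h using Nat.le_induction with
    | base => norm_num
    | succ k hk ih =>
      have h2 : 2 ^ (k + 1 + 8) = 2 * 2 ^ (k + 8) := by ring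
      rw [h2]
      refine le_trans ?_ (Nat.mul_le_mul_left 2 ih)
      obtain ⟨j, rfl⟩ := Nat.exists_eq_add_of_le hk
      have : 2 * (8 + j) ^ 5 = (8 + j + 1) ^ 5 +
          (6487 + 8155 * j + 2950 * j ^ 2 + 470 * j ^ 3 + 35 * j ^ 4 + j ^ 5) := by ring
      omega

lemma pow_five_mul_sq_le (hr : 3 ≤ r) (hm : 2 ≤ m) : r ^ 5 * m ^ 2 ≤ 2048 * m ^ (r - 1) := by
  obtain ⟨k, rfl⟩ := Nat.exists_eq_add_of_le hr
  have h1 := pow_five_le_two_pow (3 + k)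
  have h2 : 2 ^ (3 + k + 8) = 2048 * 2 ^ k := by ring
  have h3 : m ^ (3 + k - 1) = m ^ k * m ^ 2 := by
    rw [← pow_add]
    congr 1
    omega
  rw [h3, ← mul_assoc]
  refine Nat.mul_le_mul_right _ (h1.trans ?_)
  rw [h2]
  exact Nat.mul_le_mul_left _ (Nat.pow_le_pow_left hm k)

lemma devBound_le (hr : 1 ≤ r) (hm : 1 ≤ m) (hd : 1 ≤ d)
    (h : (m ^ (r - 1)) ^ 3 ≤ 2 ^ (d / (256 * r))) :
    devBound r m d ≤ 600 * r ^ 2 * d / m ^ (r - 1) := by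
  have hr' : (1 : ℝ) ≤ r := by exact_mod_cast hr
  have hd' : (1 : ℝ) ≤ d := by exact_mod_cast hd
  have hm' : (1 : ℝ) ≤ m := by exact_mod_cast hm
  have h' : ((m : ℝ) ^ (r - 1)) ^ 3 ≤ 2 ^ (d / (256 * r)) := by exact_mod_cast h
  unfold devBound
  set n : ℝ := (m : ℝ) ^ (r - 1) with hn
  have hn0 : 0 < n := by positivity
  have h1 : 18 * r * n ^ 2 / 2 ^ (d / (256 * r)) ≤ 18 * r * n ^ 2 / n ^ 3 := by gcongr
  have h2 : 18 * r * n ^ 2 / n ^ 3 = 18 * r / n := by field_simp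
  have h3 : 18 * r / n ≤ 88 * r ^ 2 * d / n := by
    have : (r : ℝ) * 1 ≤ r * (r * d) :=
      mul_le_mul_of_nonneg_left (by nlinarith) (by positivity)
    refine div_le_div_of_nonneg_right ?_ hn0.le
    nlinarith
  have h4 : 600 * r ^ 2 * d / n = 512 * r ^ 2 * d / n + 88 * r ^ 2 * d / n := by ring
  linarith

lemma pow_cube_le_two_pow (h : 1536 * r ^ 2 * Nat.sqrt m ≤ d) :
    (m ^ (r - 1)) ^ 3 ≤ 2 ^ (d / (256 * r)) := by
  rcases Nat.eq_zero_or_pos r with rfl | hr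
  · simp
  set s := Nat.sqrt m
  have h1 : m ≤ 2 ^ (2 * s) := by
    have h2 : s + 1 ≤ 2 ^ s := Nat.lt_two_pow_self
    calc m ≤ (s + 1) * (s + 1) := (Nat.lt_succ_sqrt m).le
      _ ≤ 2 ^ s * 2 ^ s := Nat.mul_le_mul h2 h2
      _ = _ := by rw [← pow_add, two_mul]
  rw [← pow_mul]
  refine (Nat.pow_le_pow_left h1 _).trans ?_
  rw [← pow_mul]
  refine Nat.pow_le_pow_right (by norm_num) ((Nat.le_div_iff_mul_le (by positivity)).2 ?_)
  refine le_trans ?_ h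
  calc 2 * s * ((r - 1) * 3) * (256 * r) ≤ 2 * s * (r * 3) * (256 * r) := by
        gcongr
        omega
    _ = _ := by ring

/-- The bound on `r * ξ` as a function of the number of vertices. -/
noncomputable def badShare (c x : ℝ) : ℝ :=
  2 * (x * Real.exp (-(c / 147456 * x))) + 4 / Real.sqrt x

/-- The lower bound for the ratio of the two counts as a function of the number of vertices. -/
noncomputable def ratioBound (c x : ℝ) : ℝ :=
  (1 - badShare c x) * Real.exp (-(58982400 / Real.sqrt x))

lemma tendsto_badShare {c : ℝ} (hc : 0 < c) : Tendsto (badShare c) atTop (nhds 0) := by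
  have hc' : 0 < c / 147456 := by positivity
  have h1 : Tendsto (fun x : ℝ => x * Real.exp (-(c / 147456 * x))) atTop (nhds 0) := by
    have := (Real.tendsto_pow_mul_exp_neg_atTop_nhds_zero 1).comp
      (tendsto_id.const_mul_atTop hc')
    have := this.const_mul (c / 147456)⁻¹
    rw [mul_zero] at this
    refine this.congr fun x => ?_
    simp only [Function.comp, id, pow_one]
    field_simp
  have h2 : Tendsto (fun x : ℝ => 4 / Real.sqrt x) atTop (nhds 0) :=
    tendsto_const_nhds.div_atTop Real.tendsto_sqrt_atTop
  have := (h1.const_mul 2).add h2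
  rw [mul_zero, add_zero] at this
  exact this

lemma tendsto_ratioBound {c : ℝ} (hc : 0 < c) : Tendsto (ratioBound c) atTop (nhds 1) := by
  have h1 : Tendsto (fun x : ℝ => 58982400 / Real.sqrt x) atTop (nhds 0) :=
    tendsto_const_nhds.div_atTop Real.tendsto_sqrt_atTop
  have h2 := (Real.continuous_exp.tendsto _).comp h1.neg
  have := ((tendsto_badShare hc).const_sub 1).mul h2
  rw [sub_zero, neg_zero, Real.exp_zero, mul_one] at this
  exact this

lemma ratio_bounds {c : ℝ} (hc : 0 < c) (hr : 3 ≤ r) (hm : 1 ≤ m) (hdn : 2 * d ≤ m ^ (r - 1))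
    (hcd : c * r ^ 16 * m ≤ d) (h1 : 512 ≤ c * (r * m : ℕ)) (h2 : (9830400 : ℝ) ≤ (r * m : ℕ))
    (h3 : 3072 ≤ c * Real.sqrt (r * m : ℕ)) (h4 : badShare c (r * m : ℕ) ≤ 1) :
    ratioBound c (r * m : ℕ) ≤ Hcount r m d / Hhat r m d ∧
      ratioBound c (r * m : ℕ) * (Hcount r m d / Hhat r m d) ≤ 1 := by
  have hr' : (3 : ℝ) ≤ r := by exact_mod_cast hr
  have hm1 : (1 : ℝ) ≤ m := by exact_mod_cast hm
  have hd0 : (0 : ℝ) < d := lt_of_lt_of_le (by positivity) hcd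
  have hd : 1 ≤ d := by exact_mod_cast hd0
  have hm2 : 2 ≤ m := by
    by_contra hlt
    have : m = 1 := by omega
    rw [this, one_pow] at hdn
    omega
  have hpow : (r : ℝ) ^ 5 * m ^ 2 ≤ 2048 * m ^ (r - 1) := by
    exact_mod_cast pow_five_mul_sq_le hr hm2
  push_cast at h1 h2 h3 h4 ⊢
  set N : ℝ := r * m with hN
  set w := Real.sqrt N with hw
  have hw2 : w * w = N := Real.mul_self_sqrt (by positivity)
  have hN0 : 0 < N := by positivity
  have hw0 : 0 < w := Real.sqrt_pos.2 hN0
  have hw1 : 1 ≤ w := Real.one_le_sqrt.2 (by linarith)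
  have hr14 : (1 : ℝ) ≤ (r : ℝ) ^ 13 := one_le_pow₀ (by linarith)
  have hcd' : c * N * r ^ 2 ≤ d := by
    refine le_trans ?_ hcd
    have : c * (r : ℝ) ^ 16 * m = (c * N * r ^ 2) * r ^ 13 := by rw [hN]; ring
    rw [this]
    exact le_mul_of_one_le_right (by positivity) hr14
  have hrd : 512 * r ^ 2 ≤ d := by
    have : (512 * r ^ 2 : ℝ) ≤ d := le_trans (by gcongr) hcd'
    exact_mod_cast this
  have hs : 1536 * r ^ 2 * Nat.sqrt m ≤ d := by
    set s := Nat.sqrt m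
    have hs1 : (s : ℝ) * s ≤ m := by exact_mod_cast Nat.sqrt_le m
    have hsw : (s : ℝ) * w ≤ N := by
      have h5 : (s : ℝ) ≤ w := Real.le_sqrt_of_sq_le (by nlinarith)
      nlinarith
    have : (1536 * r ^ 2 * s : ℝ) ≤ d := by
      refine le_trans ?_ hcd'
      have h6 : 3072 * (s : ℝ) ≤ c * N :=
        calc 3072 * (s : ℝ) ≤ c * w * s := by gcongr
          _ = c * (s * w) := by ring
          _ ≤ c * N := by gcongr
      nlinarith [sq_nonneg (r : ℝ)]
    exact_mod_cast this
  have hdev := devBound_le (by omega) hm hd (pow_cube_le_two_pow hs)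
  set n : ℝ := (m : ℝ) ^ (r - 1) with hn
  have hn0 : 0 < n := by positivity
  have hΔ : 8 * devBound r m d ≤ d := by
    have h5 : 4800 * (r : ℝ) ^ 2 ≤ n := by
      have : 9830400 * (r : ℝ) ^ 2 ≤ r ^ 5 * m ^ 2 := by
        have e : (r : ℝ) ^ 5 * m ^ 2 = N * (r ^ 2 * N) * r := by rw [hN]; ring
        have h6 : (r : ℝ) ^ 2 * 1 ≤ r ^ 2 * N := by gcongr; linarith
        calc 9830400 * (r : ℝ) ^ 2 ≤ N * (r ^ 2 * N) := by gcongr; linarith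
          _ ≤ N * (r ^ 2 * N) * r := le_mul_of_one_le_right (by positivity) (by linarith)
          _ = _ := e.symm
      linarith
    calc 8 * devBound r m d ≤ 8 * (600 * r ^ 2 * d / n) := by gcongr
      _ = (4800 * r ^ 2) * d / n := by ring
      _ ≤ n * d / n := by gcongr
      _ = d := by field_simp
  have hβ : r * (2 * m * Real.exp (-(c / 147456 * N)) + 4 / (r * w)) = badShare c N := by
    rw [badShare, ← hw, hN]
    field_simp
  have hξ0 : 0 ≤ 2 * m * Real.exp (-(c / 147456 * N)) + 4 / (r * w) := by positivity
  have hξ : 2 * m * Real.exp (-(d * (1 / (2 * (192 * r : ℕ))) ^ 2)) + 4 * (m * d) / (m * d * r * w)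
      ≤ 2 * m * Real.exp (-(c / 147456 * N)) + 4 / (r * w) := by
    have h5 : c / 147456 * N ≤ d * (1 / (2 * (192 * r : ℕ))) ^ 2 := by
      push_cast
      rw [show (d : ℝ) * (1 / (2 * (192 * r))) ^ 2 = d / r ^ 2 / 147456 by field_simp; norm_num]
      have : c * N ≤ d / r ^ 2 := by
        rw [le_div_iff₀ (by positivity)]
        exact hcd'
      linarith
    refine add_le_add (by gcongr) (le_of_eq ?_)
    field_simp
  have hε : 16 * devBound r m d / d * m + 32 * devBound r m d / d ^ 2 * (m * d * r * w) ≤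
      58982400 / (r * w) := by
    calc _ = devBound r m d / d * m * (16 + 32 * (r * w)) := by field_simp
      _ ≤ (600 * r ^ 2 * d / n) / d * m * (16 * (r * w) + 32 * (r * w)) := by
        gcongr
        nlinarith
      _ = 28800 * (r ^ 5 * m ^ 2) / n * w / (r ^ 2 * m) := by field_simp; ring
      _ ≤ 28800 * (2048 * n) / n * w / (r ^ 2 * m) := by gcongr
      _ = 58982400 * w / (r * N) := by rw [hN]; field_simp; norm_num
      _ = _ := by rw [← hw2]; field_simp
  have hξ1 : 2 * m * Real.exp (-(c / 147456 * N)) + 4 / (r * w) ≤ 1 := by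
    refine le_trans ?_ (hβ.le.trans h4)
    exact le_mul_of_one_le_left hξ0 (by linarith)
  obtain ⟨h5, h6⟩ := Hcount_div_Hhat_bounds (by omega) hrd hdn hΔ
    (by positivity : (0 : ℝ) < m * d * r * w) hξ hε hξ1
  have hle : ratioBound c N ≤ ((1 - (2 * m * Real.exp (-(c / 147456 * N)) + 4 / (r * w))) *
      Real.exp (-(58982400 / (r * w)))) ^ r := by
    have h7 := one_add_mul_le_pow (a := -(2 * m * Real.exp (-(c / 147456 * N)) + 4 / (r * w)))
      (by linarith) r
    rw [mul_neg, hβ, ← sub_eq_add_neg, ← sub_eq_add_neg] at h7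
    rw [mul_pow, ← Real.exp_nat_mul, ratioBound]
    have e : (r : ℝ) * -(58982400 / (r * w)) = -(58982400 / w) := by field_simp
    rw [e]
    gcongr
  have hρ : 0 ≤ Hcount r m d / Hhat r m d := by
    unfold Hhat
    positivity
  exact ⟨hle.trans h5, (mul_le_mul_of_nonneg_right hle hρ).trans h6⟩

end

end RegularCount

/-- for every constant `c > 0`: if `n = r(n)·m(n) → ∞`, `r ≥ 3`, `m ≥ 1`,
`0 ≤ d ≤ m^(r-1)` and `min{d, m^(r-1) − d} ≥ c·r^16·m` for all sufficiently large `n`,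
then `H_r(d,m) = (1+o(1))·Ĥ_r(d,m)`. -/
theorem regular_multipartite_hypergraph_count_dense
    (c : ℝ) (hc : 0 < c)
    (r m d : ℕ → ℕ)
    (hr : ∀ k, 3 ≤ r k) (hm : ∀ k, 1 ≤ m k)
    (hn : Tendsto (fun k => r k * m k) atTop atTop)
    (hd : ∀ k, d k ≤ (m k) ^ (r k - 1))
    (hmin : ∀ᶠ k in atTop,
      c * (r k : ℝ) ^ 16 * (m k : ℝ) ≤
        (min (d k) ((m k) ^ (r k - 1) - d k) : ℕ)) :
    Tendsto (fun k => (Hcount (r k) (m k) (d k) : ℝ) / Hhat (r k) (m k) (d k))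
      atTop (nhds 1) := by
  have hx : Tendsto (fun k => ((r k * m k : ℕ) : ℝ)) atTop atTop :=
    tendsto_natCast_atTop_atTop.comp hn
  have hb := (RegularCount.tendsto_ratioBound hc).comp hx
  have hpos := hb.eventually (lt_mem_nhds (zero_lt_one))
  have hbad := ((RegularCount.tendsto_badShare hc).comp hx).eventually (ge_mem_nhds zero_lt_one)
  have hbnd : ∀ᶠ k in atTop,
      RegularCount.ratioBound c (r k * m k : ℕ) ≤ Hcount (r k) (m k) (d k) / Hhat (r k) (m k) (d k) ∧
      RegularCount.ratioBound c (r k * m k : ℕ) *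
        (Hcount (r k) (m k) (d k) / Hhat (r k) (m k) (d k)) ≤ 1 := by
    filter_upwards [hmin, hbad, (hx.const_mul_atTop hc).eventually_ge_atTop 512,
      hx.eventually_ge_atTop 9830400,
      ((Real.tendsto_sqrt_atTop.comp hx).const_mul_atTop hc).eventually_ge_atTop 3072]
      with k h1 h2 h3 h4 h5
    rw [← RegularCount.Hcount_div_Hhat_min (by have := hr k; omega) (hd k)]
    exact RegularCount.ratio_bounds hc (hr k) (hm k) (by omega) h1 h3 h4 h5 h2
  have hinv := hb.inv₀ one_ne_zero
  rw [inv_one] at hinv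
  refine tendsto_of_tendsto_of_tendsto_of_le_of_le' hb hinv (hbnd.mono fun k h => h.1) ?_
  filter_upwards [hbnd, hpos] with k h1 h2
  change 0 < RegularCount.ratioBound c (r k * m k : ℕ) at h2
  change _ ≤ (RegularCount.ratioBound c (r k * m k : ℕ))⁻¹
  rw [← one_div, le_div_iff₀' h2]
  exact h1.2
end

section
/- Let a, b, c, r₀ be real constants with c > 0 and r₀ a constant lower bound for r. Then there exists a constant C > 0 (depending only on a, b, c, r₀) such that for all integers r ≥ r₀ and m ≥ 2, writing n = rm, one has r^a · m^{−cr+b} ≤ C · n^{b − c·r₀}. -/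
/-- let `a, b, c, r₀` be real constants with `c > 0`. Then there is a constant
`C > 0` such that for all integers `r ≥ r₀` (with `r ≥ 1`) and `m ≥ 2`, writing `n = r·m`,
we have `r^a · m^(−c·r+b) ≤ C · n^(b − c·r₀)`. -/
theorem pow_error_bound (a b c r₀ : ℝ) (hc : 0 < c) :
    ∃ C : ℝ, 0 < C ∧ ∀ r m : ℕ, 1 ≤ r → 2 ≤ m → r₀ ≤ (r : ℝ) →
      (r : ℝ) ^ a * (m : ℝ) ^ (-c * (r : ℝ) + b) ≤
        C * (((r * m : ℕ) : ℝ)) ^ (b - c * r₀) := by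
  obtain ⟨K, hK⟩ := ((tendsto_rpow_mul_exp_neg_mul_atTop_nhds_zero (a - b + c * r₀)
    (c * Real.log 2) (by positivity)).comp tendsto_natCast_atTop_atTop).bddAbove_range
  have hK' (r : ℕ) : (r : ℝ) ^ (a - b + c * r₀) * Real.exp (-(c * Real.log 2) * r) ≤ K :=
    hK ⟨r, rfl⟩
  have hK0 : 0 < K := lt_of_lt_of_le (by positivity) (hK' 1)
  refine ⟨K * 2 ^ (c * r₀), by positivity, fun r m hr hm hrr => ?_⟩
  have hr0 : (0 : ℝ) < r := by exact_mod_cast hr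
  have hm2 : (2 : ℝ) ≤ m := by exact_mod_cast hm
  have hm0 : (0 : ℝ) < m := by linarith
  have hmono : (m : ℝ) ^ (-(c * (r - r₀))) ≤ 2 ^ (-(c * (r - r₀))) :=
    Real.rpow_le_rpow_of_nonpos two_pos hm2
      (neg_nonpos.2 (mul_nonneg hc.le (sub_nonneg.2 hrr)))
  have htwo : (2 : ℝ) ^ (-(c * (r - r₀))) =
      Real.exp (-(c * Real.log 2) * r) * 2 ^ (c * r₀) := by
    rw [Real.rpow_def_of_pos two_pos, Real.rpow_def_of_pos two_pos, ← Real.exp_add]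
    ring_nf
  rw [Nat.cast_mul, Real.mul_rpow hr0.le hm0.le]
  calc (r : ℝ) ^ a * (m : ℝ) ^ (-c * (r : ℝ) + b)
      = (r : ℝ) ^ (a - b + c * r₀) * (m : ℝ) ^ (-(c * (r - r₀))) *
          ((r : ℝ) ^ (b - c * r₀) * (m : ℝ) ^ (b - c * r₀)) := by
        rw [mul_mul_mul_comm, ← Real.rpow_add hr0, ← Real.rpow_add hm0]
        ring_nf
    _ ≤ (r : ℝ) ^ (a - b + c * r₀) * (Real.exp (-(c * Real.log 2) * r) * 2 ^ (c * r₀)) *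
          ((r : ℝ) ^ (b - c * r₀) * (m : ℝ) ^ (b - c * r₀)) := by
        rw [← htwo]
        gcongr
    _ ≤ K * 2 ^ (c * r₀) * ((r : ℝ) ^ (b - c * r₀) * (m : ℝ) ^ (b - c * r₀)) := by
        rw [← mul_assoc _ (Real.exp _)]
        gcongr
        exact hK' r
end

section
/- Let r ≥ 2, m ≥ 1, d ≥ 1 be integers. Encode a configuration as an (r−1)-tuple (σ₂, …, σ_r) of permutations of Fin(md); with vertex map v : Fin(md) → Fin m given by v(s) = ⌊s/d⌋, the i-th edge of the configuration (for i ∈ Fin(md)) is the r-tuple (v(i), v(σ₂(i)), …, v(σ_r(i))) ∈ (Fin m)^r. Then H_r(d,m) · (d!)^{rm} equals the number of (r−1)-tuples (σ₂, …, σ_r) of permutations of Fin(md) for which the map i ↦ i-th edge is injective. Equivalently, H_r(d,m) = (((md)!)^{r−1} / (d!)^{rm}) · P_r(d,m), where P_r(d,m) is the fraction of the ((md)!)^{r−1} tuples whose edge map is injective. -/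
/-- The vertex map of the configuration model: spine `s` is attached to vertex `⌊s/d⌋`. -/
def vmap {m d : ℕ} (s : Fin (m * d)) : Fin m :=
  ⟨s.val / d, Nat.div_lt_of_lt_mul (by simp [Nat.mul_comm])⟩

/-- The `i`-th edge of the configuration `(σ₂, …, σ_r)`:
`(v(i), v(σ₂ i), …, v(σ_r i)) ∈ (Fin m)^r`. -/
def edgeOf (r m d : ℕ) (σ : Fin (r - 1) → Equiv.Perm (Fin (m * d)))
    (i : Fin (m * d)) : Fin r → Fin m :=
  fun t => if h : t.val = 0 then vmap i
    else vmap ((σ ⟨t.val - 1, by have := t.isLt; omega⟩) i)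

/-- The probability that a uniform random configuration provides a simple hypergraph. -/
noncomputable def Pconf (r m d : ℕ) : ℝ :=
  (Nat.card {σ : Fin (r - 1) → Equiv.Perm (Fin (m * d)) //
      Function.Injective (edgeOf r m d σ)} : ℝ) / ((m * d).factorial : ℝ) ^ (r - 1)

open Finset in
/-- A map to `V` whose fibres have the same cardinalities as those of `v` factors through `v` by a
permutation. -/
theorem exists_perm_comp_eq {S V : Type*} [Fintype S] [DecidableEq V] (v f : S → V)
    (h : ∀ x, #{s | f s = x} = #{s | v s = x}) : ∃ π : Equiv.Perm S, v ∘ π = f := by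
  let e : ∀ x, {s // f s = x} ≃ {s // v s = x} := fun x =>
    Fintype.equivOfCardEq (by simpa [Fintype.card_subtype] using h x)
  refine ⟨(Equiv.sigmaFiberEquiv f).symm.trans
    ((Equiv.sigmaCongrRight e).trans (Equiv.sigmaFiberEquiv v)), ?_⟩
  funext s
  exact (e (f s) ⟨s, rfl⟩).2

open Finset in
/-- If `f` and `v` have all fibres of size `d`, then `(d!) ^ |V|` permutations carry `v` to `f`. -/
theorem card_perm_comp_eq {S V : Type*} [Fintype S] [Fintype V] [DecidableEq V] (v f : S → V)
    (d : ℕ) (hv : ∀ x, #{s | v s = x} = d) (hf : ∀ x, #{s | f s = x} = d) :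
    Nat.card {π : Equiv.Perm S // v ∘ π = f} = d.factorial ^ Fintype.card V := by
  classical
  obtain ⟨π₀, h₀⟩ := exists_perm_comp_eq v f fun x => (hf x).trans (hv x).symm
  have key : Nat.card {π : Equiv.Perm S // v ∘ π = v} = d.factorial ^ Fintype.card V := by
    rw [Nat.card_eq_fintype_card, DomMulAct.stabilizer_card v]
    simp [Fintype.card_subtype, hv]
  rw [← key]
  refine Nat.card_congr ((Equiv.mulRight π₀⁻¹).subtypeEquiv fun π => ?_)
  subst h₀
  simp only [funext_iff, Function.comp_apply, Equiv.coe_mulRight, Equiv.Perm.mul_apply]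
  constructor
  · intro h s
    simpa using h (π₀⁻¹ s)
  · intro h s
    simpa using h (π₀ s)

/-- The vertex map has all fibres of size `d`. -/
theorem card_vmap_fiber (m d : ℕ) (x : Fin m) :
    (Finset.univ.filter fun s : Fin (m * d) => vmap s = x).card = d := by
  have h : ∀ s : Fin (m * d), vmap s = (finProdFinEquiv.symm s).1 := fun s => rfl
  simp only [h]
  rw [← Fintype.card_subtype, Fintype.card_congr
    ((finProdFinEquiv.symm.subtypeEquiv (q := fun p : Fin m × Fin d => p.1 = x)
      fun s => Iff.rfl).trans (Equiv.prodSubtypeFstEquivSubtypeProd (p := fun y => y = x)))]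
  simp

/-- The tuples of permutations whose edge map is injective correspond to the ordered regular
edge sets together with, for each class, a permutation carrying the vertex map to the
coordinate map of that class. -/
theorem card_injective_edge_tuples {S V : Type*} [Fintype S] [Fintype V] [DecidableEq V]
    (v : S → V) (d k : ℕ) (hv : ∀ x, (Finset.univ.filter fun s => v s = x).card = d) :
    Nat.card {F : Fin (k + 1) → Equiv.Perm S // Function.Injective fun i t => v (F t i)} =
      Nat.card {E : Finset (Fin (k + 1) → V) //
        ∀ t, ∀ x, (E.filter fun e => e t = x).card = d} *
      ((Fintype.card S).factorial * (d.factorial ^ Fintype.card V) ^ (k + 1)) := by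
  classical
  have hS : Fintype.card S = Fintype.card V * d := by
    rw [← Finset.card_univ, Finset.card_eq_sum_card_fiberwise (f := v) (t := Finset.univ)
      (by simp)]
    simp [hv]
  let H := {E : Finset (Fin (k + 1) → V) // ∀ t, ∀ x, (E.filter fun e => e t = x).card = d}
  let T := Σ E : H, Σ e : S ≃ E.1, (t : Fin (k + 1)) →
    {π : Equiv.Perm S // v ∘ π = fun s => (e s).1 t}
  have hE : ∀ E : H, E.1.card = Fintype.card S := fun E => by
    rw [hS, Finset.card_eq_sum_card_fiberwise (f := fun e => e 0) (t := Finset.univ) (by simp)]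
    simp [E.2 0]
  have hT : Nat.card T = Nat.card H *
      ((Fintype.card S).factorial * (d.factorial ^ Fintype.card V) ^ (k + 1)) := by
    have h1 : ∀ (E : H) (e : S ≃ E.1), Nat.card ((t : Fin (k + 1)) →
        {π : Equiv.Perm S // v ∘ π = fun s => (e s).1 t}) =
        (d.factorial ^ Fintype.card V) ^ (k + 1) := fun E e => by
      rw [Nat.card_pi, Finset.prod_congr rfl fun t _ => card_perm_comp_eq v _ d hv fun x => ?_]
      · simp
      · refine Eq.trans ?_ (E.2 t x)
        refine Finset.card_bij (fun s _ => (e s).1) (by simp) (fun a _ b _ h => ?_)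
          fun b hb => ?_
        · exact e.injective (Subtype.ext h)
        · rw [Finset.mem_filter] at hb
          exact ⟨e.symm ⟨b, hb.1⟩, by simpa using hb.2, by simp⟩
    have h2 : ∀ E : H, Nat.card (S ≃ E.1) = (Fintype.card S).factorial := fun E => by
      rw [Nat.card_eq_fintype_card, Fintype.card_equiv
        (Fintype.equivOfCardEq (by rw [Fintype.card_coe, hE E]))]
    rw [Nat.card_sigma]
    simp only [Nat.card_sigma, h1, Finset.sum_const, Finset.card_univ, smul_eq_mul,
      ← Nat.card_eq_fintype_card]
    simp only [h2, Finset.sum_const, Finset.card_univ, smul_eq_mul, ← Nat.card_eq_fintype_card]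
  rw [← hT]
  have hedge : ∀ (p : T) (i : S), (fun t => v ((p.2.2 t).1 i)) = (p.2.1 i).1 := fun p i =>
    funext fun t => congrFun (p.2.2 t).2 i
  let g : T → {F : Fin (k + 1) → Equiv.Perm S // Function.Injective fun i t => v (F t i)} :=
    fun p => ⟨fun t => (p.2.2 t).1, fun i j hij => p.2.1.injective <| Subtype.ext <| by
      rw [← hedge, ← hedge]; exact hij⟩
  refine (Nat.card_congr (Equiv.ofBijective g ⟨?_, ?_⟩)).symm
  · intro p q hpq
    have hF : (fun t => (p.2.2 t).1) = fun t => (q.2.2 t).1 := congrArg Subtype.val hpq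
    have he : ∀ i, (p.2.1 i).1 = (q.2.1 i).1 := fun i => by
      rw [← hedge, ← hedge]
      funext t
      rw [show (p.2.2 t).1 = (q.2.2 t).1 from congrFun hF t]
    obtain ⟨⟨E, hE₁⟩, e, π⟩ := p
    obtain ⟨⟨E', hE₂⟩, e', π'⟩ := q
    have hEE : E = E' := by
      ext x
      constructor
      · intro hx
        have := he (e.symm ⟨x, hx⟩)
        simp only [Equiv.apply_symm_apply] at this
        rw [this]
        exact (e' _).2
      · intro hx
        have := he (e'.symm ⟨x, hx⟩)
        simp only [Equiv.apply_symm_apply] at this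
        rw [← this]
        exact (e _).2
    subst hEE
    obtain rfl : e = e' := Equiv.ext fun i => Subtype.ext (he i)
    obtain rfl : π = π' := funext fun t => Subtype.ext (congrFun hF t)
    rfl
  · rintro ⟨F, hF⟩
    let E : Finset (Fin (k + 1) → V) := Finset.univ.image fun i t => v (F t i)
    have hreg : ∀ t, ∀ x, (E.filter fun e => e t = x).card = d := fun t x => by
      rw [Finset.filter_image, Finset.card_image_of_injective _ hF, ← hv x]
      exact Finset.card_equiv (F t) (by simp)
    let e : S ≃ E := Equiv.ofBijective
      (fun i => ⟨fun t => v (F t i), Finset.mem_image_of_mem _ (Finset.mem_univ i)⟩)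
      ⟨fun i j h => hF (congrArg Subtype.val h), fun ⟨x, hx⟩ => by
        obtain ⟨i, -, rfl⟩ := Finset.mem_image.1 hx
        exact ⟨i, rfl⟩⟩
    exact ⟨⟨⟨E, hreg⟩, e, fun t => ⟨F t, rfl⟩⟩, rfl⟩

/-- A tuple of `k + 1` permutations with injective edge map amounts to its first permutation and
a configuration with injective edge map. -/
theorem card_injective_edge_tuples_eq_mul (k m d : ℕ) :
    Nat.card {F : Fin (k + 1) → Equiv.Perm (Fin (m * d)) //
        Function.Injective fun i t => vmap (F t i)} =
      (m * d).factorial * Nat.card {σ : Fin k → Equiv.Perm (Fin (m * d)) //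
        Function.Injective (edgeOf (k + 1) m d σ)} := by
  have hedge : ∀ (F : Fin (k + 1) → Equiv.Perm (Fin (m * d))),
      (fun i t => vmap (F t i)) =
        edgeOf (k + 1) m d (fun t : Fin k => F t.succ * (F 0)⁻¹) ∘ F 0 := fun F => by
    funext i t
    refine Fin.cases ?_ (fun t => ?_) t
    · simp [edgeOf]
    · simp [edgeOf]
  let Φ : (Fin (k + 1) → Equiv.Perm (Fin (m * d))) ≃
      Equiv.Perm (Fin (m * d)) × (Fin k → Equiv.Perm (Fin (m * d))) :=
    { toFun := fun F => (F 0, fun t => F t.succ * (F 0)⁻¹)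
      invFun := fun p => Fin.cons p.1 fun t => p.2 t * p.1
      left_inv := fun F => by
        funext t
        refine Fin.cases ?_ (fun t => ?_) t <;> simp
      right_inv := fun p => by simp }
  rw [Nat.card_congr ((Φ.subtypeEquiv (q := fun p => True ∧
    Function.Injective (edgeOf (k + 1) m d p.2)) fun F => ?_).trans
      (Equiv.subtypeProdEquivProd (p := fun _ => True)
        (q := fun σ => Function.Injective (edgeOf (k + 1) m d σ)))), Nat.card_prod]
  · rw [Nat.card_congr (Equiv.subtypeUnivEquiv fun _ => trivial), Nat.card_perm, Nat.card_fin]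
    rfl
  · rw [hedge F, true_and]
    exact Function.Injective.of_comp_iff' _ (F 0).bijective

/-- `H_r(d,m)·(d!)^{rm}` equals the number of `(r−1)`-tuples of permutations
of `Fin (m·d)` whose edge map is injective; equivalently,
`H_r(d,m) = (((m·d)!)^{r−1} / (d!)^{rm}) · P_r(d,m)`. -/
theorem configuration_model_count (r m d : ℕ) (hr : 2 ≤ r) (hm : 1 ≤ m) (hd : 1 ≤ d) :
    Hcount r m d * (Nat.factorial d) ^ (r * m) =
      Nat.card {σ : Fin (r - 1) → Equiv.Perm (Fin (m * d)) //
        Function.Injective (edgeOf r m d σ)} ∧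
    (Hcount r m d : ℝ) =
      ((m * d).factorial : ℝ) ^ (r - 1) / (Nat.factorial d : ℝ) ^ (r * m) *
        Pconf r m d := by
  have count : Hcount r m d * (Nat.factorial d) ^ (r * m) =
      Nat.card {σ : Fin (r - 1) → Equiv.Perm (Fin (m * d)) //
        Function.Injective (edgeOf r m d σ)} := by
    obtain ⟨k, rfl⟩ : ∃ k, r = k + 1 := ⟨r - 1, by omega⟩
    refine Nat.eq_of_mul_eq_mul_left (m * d).factorial_pos ?_
    have h := (card_injective_edge_tuples_eq_mul k m d).symm.trans
      (card_injective_edge_tuples vmap d k (card_vmap_fiber m d))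
    refine Eq.trans ?_ h.symm
    rw [Fintype.card_fin, Fintype.card_fin, ← pow_mul, mul_comm m (k + 1), Hcount]
    ring
  refine ⟨count, ?_⟩
  have hn : ((m * d).factorial : ℝ) ≠ 0 := by exact_mod_cast (m * d).factorial_ne_zero
  have hd' : (d.factorial : ℝ) ≠ 0 := by exact_mod_cast d.factorial_ne_zero
  rw [Pconf, ← count]
  push_cast
  field_simp
end

section
/- Let n = rm → ∞ with integers r = r(n) ≥ 3, m = m(n) ≥ 1, and let d = d(n) ≥ 1 be integers with r·d² = o(m^{r−2}). Then P_r(d,m) = 1 − o(1); that is, the proportion of (r−1)-tuples (σ₂, …, σ_r) of permutations of Fin(md) whose edge map i ↦ (v(i), v(σ₂(i)), …, v(σ_r(i))) is injective tends to 1. -/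
open Filter Asymptotics

theorem card_filter_vmap_eq {m d : ℕ} (a : Fin m) :
    (Finset.univ.filter fun s : Fin (m * d) => vmap s = a).card = d := by
  have h : (Finset.univ.filter fun s : Fin (m * d) => vmap s = a)
      = Finset.univ.map ⟨fun x : Fin d => finProdFinEquiv (a, x),
          fun x y hxy => by simpa using hxy⟩ := by
    ext s
    simp only [Finset.mem_filter, Finset.mem_univ, true_and, Finset.mem_map]
    constructor
    · rintro rfl
      exact ⟨(finProdFinEquiv.symm s).2, finProdFinEquiv.apply_symm_apply s⟩
    · rintro ⟨x, rfl⟩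
      exact congrArg Prod.fst (finProdFinEquiv.symm_apply_apply (a, x))
  rw [h, Finset.card_map, Finset.card_univ, Fintype.card_fin]

/-- The permutations sending `i` and `j` to spines attached to the same vertex. -/
def collidingPerms {m d : ℕ} (i j : Fin (m * d)) : Finset (Equiv.Perm (Fin (m * d))) :=
  Finset.univ.filter fun σ => vmap (σ j) = vmap (σ i)

theorem card_collidingPerms_eq {m d : ℕ} {i j k : Fin (m * d)} (hj : j ≠ i) (hk : k ≠ i) :
    (collidingPerms i j).card = (collidingPerms i k).card := by
  refine Finset.card_equiv (Equiv.mulRight (Equiv.swap j k)) fun σ => ?_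
  simp [collidingPerms, Equiv.swap_apply_of_ne_of_ne hj.symm hk.symm]

theorem card_collidingPerms_mul_sub_one {m d : ℕ} {i j : Fin (m * d)} (hj : j ≠ i) :
    (m * d - 1) * (collidingPerms i j).card = (m * d).factorial * (d - 1) := by
  have hcount (σ : Equiv.Perm (Fin (m * d))) :
      ((Finset.univ.erase i).filter fun k => vmap (σ k) = vmap (σ i)).card = d - 1 := by
    have hcard : (Finset.univ.filter fun k => vmap (σ k) = vmap (σ i)).card = d :=
      (Finset.card_equiv σ fun k => by simp).trans (card_filter_vmap_eq (vmap (σ i)))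
    rw [Finset.filter_erase, Finset.card_erase_of_mem (by simp), hcard]
  have hdouble := Finset.sum_card_bipartiteAbove_eq_sum_card_bipartiteBelow
    (s := (Finset.univ : Finset (Equiv.Perm (Fin (m * d))))) (t := Finset.univ.erase i)
    (fun σ k => vmap (σ k) = vmap (σ i))
  have hleft : ∀ k ∈ Finset.univ.erase i,
      (Finset.bipartiteBelow (fun (σ : Equiv.Perm (Fin (m * d))) k => vmap (σ k) = vmap (σ i))
        Finset.univ k).card = (collidingPerms i j).card := fun k hk =>
    (card_collidingPerms_eq (Finset.ne_of_mem_erase hk) hj)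
  rw [Finset.sum_congr rfl hleft] at hdouble
  simp only [Finset.bipartiteAbove, hcount] at hdouble
  simpa [Finset.card_erase_of_mem, Fintype.card_perm] using hdouble.symm

theorem card_collidingPerms_mul_le {m d : ℕ} {i j : Fin (m * d)} (hj : j ≠ i) :
    (collidingPerms i j).card * m ≤ (m * d).factorial := by
  have h := card_collidingPerms_mul_sub_one hj
  have hpos : 0 < m * d - 1 := by
    have := i.isLt
    have := j.isLt
    have := Fin.val_ne_of_ne hj
    omega
  have hm : 0 < m := Nat.pos_of_ne_zero fun h0 => by simp [h0] at hpos
  refine Nat.le_of_mul_le_mul_left ?_ hpos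
  have hle : (d - 1) * m ≤ m * d - 1 := by
    rw [Nat.sub_mul, one_mul, mul_comm d m]
    omega
  calc (m * d - 1) * ((collidingPerms i j).card * m)
      = (m * d).factorial * ((d - 1) * m) := by rw [← mul_assoc, h, mul_assoc]
    _ ≤ (m * d).factorial * (m * d - 1) := Nat.mul_le_mul_left _ hle
    _ = (m * d - 1) * (m * d).factorial := mul_comm _ _

/-- Ordered pairs of distinct spines attached to the same vertex. -/
def siblingPairs (m d : ℕ) : Finset (Fin (m * d) × Fin (m * d)) :=
  Finset.univ.filter fun p => p.2 ≠ p.1 ∧ vmap p.2 = vmap p.1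

theorem card_siblingPairs_le (m d : ℕ) : (siblingPairs m d).card ≤ m * d * d := by
  have hsub : siblingPairs m d ⊆
      (Finset.univ : Finset (Fin (m * d))).biUnion fun i =>
        (Finset.univ.filter fun s : Fin (m * d) => vmap s = vmap i).map
          ⟨fun s => (i, s), Prod.mk_right_injective i⟩ := by
    rintro ⟨i, j⟩ h
    simpa [siblingPairs] using (Finset.mem_filter.mp h).2.2
  refine (Finset.card_le_card hsub).trans ?_
  refine (Finset.card_biUnion_le_card_mul _ _ d fun i _ => ?_).trans (by simp)
  rw [Finset.card_map, card_filter_vmap_eq]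

open Classical in
theorem card_not_injective_edgeOf_mul_le {r m d : ℕ} (hr : 1 ≤ r) :
    (Finset.univ.filter fun σ => ¬ Function.Injective (edgeOf r m d σ)).card * m ^ (r - 1)
      ≤ m * d * d * (m * d).factorial ^ (r - 1) := by
  have hsub : (Finset.univ.filter fun σ => ¬ Function.Injective (edgeOf r m d σ)) ⊆
      (siblingPairs m d).biUnion fun p =>
        Fintype.piFinset fun _ : Fin (r - 1) => collidingPerms p.1 p.2 := by
    intro σ hσ
    simp only [Finset.mem_filter, Finset.mem_univ, true_and, Function.Injective,
      not_forall] at hσ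
    obtain ⟨j, i, he, hne⟩ := hσ
    simp only [Finset.mem_biUnion, siblingPairs, collidingPerms, Finset.mem_filter,
      Finset.mem_univ, true_and, Fintype.mem_piFinset]
    refine ⟨(i, j), ⟨hne, by simpa [edgeOf] using congrFun he ⟨0, hr⟩⟩, fun t => ?_⟩
    simpa [edgeOf] using congrFun he ⟨t.val + 1, by omega⟩
  calc _ ≤ (∑ p ∈ siblingPairs m d, (collidingPerms p.1 p.2).card ^ (r - 1)) * m ^ (r - 1) := by
        refine Nat.mul_le_mul_right _ ((Finset.card_le_card hsub).trans ?_)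
        refine Finset.card_biUnion_le.trans (le_of_eq ?_)
        simp
    _ = ∑ p ∈ siblingPairs m d, ((collidingPerms p.1 p.2).card * m) ^ (r - 1) := by
        simp only [Finset.sum_mul, mul_pow]
    _ ≤ ∑ _p ∈ siblingPairs m d, (m * d).factorial ^ (r - 1) :=
        Finset.sum_le_sum fun p hp => Nat.pow_le_pow_left
          (card_collidingPerms_mul_le (Finset.mem_filter.mp hp).2.1) _
    _ ≤ m * d * d * (m * d).factorial ^ (r - 1) := by
        rw [Finset.sum_const, smul_eq_mul]
        exact Nat.mul_le_mul_right _ (card_siblingPairs_le m d)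

theorem Pconf_le_one (r m d : ℕ) : Pconf r m d ≤ 1 := by
  refine div_le_one_of_le₀ ?_ (by positivity)
  have h := Nat.card_le_card_of_injective
    (Subtype.val : {σ // Function.Injective (edgeOf r m d σ)} → _) Subtype.val_injective
  rw [Nat.card_eq_fintype_card (α := Fin (r - 1) → _)] at h
  simp only [Fintype.card_pi, Fintype.card_perm, Fintype.card_fin, Finset.prod_const,
    Finset.card_univ] at h
  exact_mod_cast h

theorem one_sub_le_Pconf {r m d : ℕ} (hr : 2 ≤ r) (hm : 1 ≤ m) :
    1 - (d : ℝ) ^ 2 / (m : ℝ) ^ (r - 2) ≤ Pconf r m d := by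
  classical
  have hbad := card_not_injective_edgeOf_mul_le (m := m) (d := d) (by omega : 1 ≤ r)
  have htot := Finset.card_filter_add_card_filter_not
    (s := (Finset.univ : Finset (Fin (r - 1) → Equiv.Perm (Fin (m * d)))))
    (fun σ => Function.Injective (edgeOf r m d σ))
  simp only [Finset.card_univ, Fintype.card_pi, Fintype.card_perm, Fintype.card_fin,
    Finset.prod_const] at htot
  rw [Pconf, Nat.card_eq_fintype_card, Fintype.card_subtype]
  set good := (Finset.univ.filter fun σ => Function.Injective (edgeOf r m d σ)).card
  set bad := (Finset.univ.filter fun σ => ¬ Function.Injective (edgeOf r m d σ)).card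
  obtain ⟨s, rfl⟩ : ∃ s, r = s + 2 := ⟨r - 2, by omega⟩
  simp only [Nat.add_sub_cancel, show s + 2 - 1 = s + 1 from rfl] at *
  have hmpos : (0 : ℝ) < m := by exact_mod_cast hm
  have hF : (0 : ℝ) < ((m * d).factorial : ℝ) ^ (s + 1) := by
    have := Nat.factorial_pos (m * d)
    positivity
  have hbad' : (bad : ℝ) * m ^ s ≤ d ^ 2 * ((m * d).factorial : ℝ) ^ (s + 1) := by
    refine le_of_mul_le_mul_left ?_ hmpos
    have : (bad : ℝ) * m ^ (s + 1) ≤ m * d * d * ((m * d).factorial : ℝ) ^ (s + 1) := by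
      exact_mod_cast hbad
    calc _ = (bad : ℝ) * m ^ (s + 1) := by ring
      _ ≤ _ := this
      _ = _ := by ring
  have htot' : (good : ℝ) + bad = ((m * d).factorial : ℝ) ^ (s + 1) := by exact_mod_cast htot
  have hratio : (bad : ℝ) / ((m * d).factorial : ℝ) ^ (s + 1) ≤ d ^ 2 / (m : ℝ) ^ s := by
    rwa [div_le_div_iff₀ hF (by positivity)]
  have hgood : (good : ℝ) / ((m * d).factorial : ℝ) ^ (s + 1)
      = 1 - bad / ((m * d).factorial : ℝ) ^ (s + 1) := by
    rw [eq_sub_iff_add_eq, ← add_div, htot', div_self hF.ne']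
  rw [hgood]
  linarith

/-- if `n = r(n)·m(n) → ∞`, `r ≥ 3`, `m ≥ 1`, `d ≥ 1` and `r·d² = o(m^(r-2))`,
then `P_r(d,m) = 1 − o(1)`. -/
theorem configuration_model_simple_whp
    (r m d : ℕ → ℕ)
    (hr : ∀ k, 3 ≤ r k) (hm : ∀ k, 1 ≤ m k) (hd : ∀ k, 1 ≤ d k)
    (hn : Tendsto (fun k => r k * m k) atTop atTop)
    (ho : (fun k => (r k : ℝ) * (d k : ℝ) ^ 2) =o[atTop]
      (fun k => (m k : ℝ) ^ (r k - 2))) :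
    Tendsto (fun k => Pconf (r k) (m k) (d k)) atTop (nhds 1) := by
  have hlim := ho.tendsto_div_nhds_zero
  have hlower : Tendsto (fun k => 1 - (r k : ℝ) * (d k : ℝ) ^ 2 / (m k : ℝ) ^ (r k - 2))
      atTop (nhds 1) := by
    simpa using hlim.const_sub 1
  refine tendsto_of_tendsto_of_tendsto_of_le_of_le hlower tendsto_const_nhds (fun k => ?_)
    fun k => Pconf_le_one _ _ _
  refine le_trans ?_ (one_sub_le_Pconf ((hr k).trans' (by norm_num)) (hm k))
  have hr1 : (1 : ℝ) ≤ r k := by exact_mod_cast (hr k).trans' (by norm_num)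
  have : (d k : ℝ) ^ 2 ≤ r k * (d k : ℝ) ^ 2 := le_mul_of_one_le_left (by positivity) hr1
  dsimp only
  gcongr
end
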